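/- arXiv:2501.06387 — 2 statements merged into one kernel-verified Lean document; each statement's English description precedes it below -/
import Mathlib

section
/- (Dispersive decay for the half wave in L^p.) Fix d ≥ 2 and 2 ≤ p < ∞, and let p' = p/(p−1). There is a constant C (depending only on d and p) such that for every Schwartz function f on ℝ^d, every t ≠ 0, and either choice of sign, ‖ e^{±it|∇|} f ‖_{L^p(ℝ^d)} ≤ C · |t|^{−(d−1)(1/2 − 1/p)} · ‖ |∇|^{(d+1)(1/2 − 1/p)} f ‖_{L^{p'}(ℝ^d)}. -/
open MeasureTheory SchwartzMap Metric Set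
open scoped ENNReal NNReal FourierTransform RealInnerProductSpace

noncomputable section

abbrev Ed (d : ℕ) := EuclideanSpace ℝ (Fin d)

/-- Fourier multiplier with symbol `m` on `ℝ^d`. -/
def fmulD (d : ℕ) (m : Ed d → ℂ) (f : Ed d → ℂ) : Ed d → ℂ :=
  𝓕⁻ (fun ξ => m ξ * 𝓕 f ξ)

/-- The fractional derivative `|∇|^s` on `ℝ^d`. -/
def absGradD (d : ℕ) (s : ℝ) (f : Ed d → ℂ) : Ed d → ℂ :=
  fmulD d (fun ξ => (((2 * Real.pi * ‖ξ‖) ^ s : ℝ) : ℂ)) f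

/-- The half-wave propagator `e^{σ i t |∇|}` on `ℝ^d`. -/
def halfWaveD (d : ℕ) (σ t : ℝ) (f : Ed d → ℂ) : Ed d → ℂ :=
  fmulD d (fun ξ => Complex.exp (Complex.I * (σ * (2 * Real.pi * t * ‖ξ‖)))) f

/-- A Littlewood–Paley bump function on `ℝ^d`. -/
structure IsLPBumpD (d : ℕ) (φ : Ed d → ℝ) : Prop where
  smooth : ContDiff ℝ (⊤ : ℕ∞) φ
  mem_Icc : ∀ ξ, φ ξ ∈ Icc (0:ℝ) 1
  eq_one : ∀ ξ : Ed d, ‖ξ‖ ≤ 1 → φ ξ = 1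
  eq_zero : ∀ ξ : Ed d, 2 ≤ ‖ξ‖ → φ ξ = 0

/-- The Littlewood–Paley projection `P_N` on `ℝ^d`. -/
def LPD (d : ℕ) (φ : Ed d → ℝ) (N : ℝ) (f : Ed d → ℂ) : Ed d → ℂ :=
  fmulD d (fun ξ => ((φ (N⁻¹ • ξ) - φ ((2 / N) • ξ) : ℝ) : ℂ)) f

/-- The homogeneous Besov norm `Ḃ^s_{p,1}` on `ℝ^d`. -/
def besovD (d : ℕ) (φ : Ed d → ℝ) (s : ℝ) (p : ℝ≥0∞) (f : Ed d → ℂ) : ℝ≥0∞ :=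
  ∑' n : ℤ, ENNReal.ofReal (((2:ℝ) ^ n) ^ s) * eLpNorm (LPD d φ ((2:ℝ) ^ n) f) p volume

/-- The Hardy–Littlewood maximal function (with values in `ℝ≥0∞`). -/
def HLMax (d : ℕ) (g : Ed d → ℂ) (x : Ed d) : ℝ≥0∞ :=
  ⨆ r ∈ Ioi (0:ℝ), (volume (ball x r))⁻¹ * ∫⁻ y in ball x r, ‖g y‖₊

namespace HalfWave

set_option linter.unusedSectionVars false

variable {V : Type*} [NormedAddCommGroup V] [InnerProductSpace ℝ V] [FiniteDimensional ℝ V]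
  [MeasurableSpace V] [BorelSpace V]

theorem continuous_fourier {f : V → ℂ} (hf : Integrable f) : Continuous (𝓕 f) :=
  VectorFourier.fourierIntegral_continuous Real.continuous_fourierChar
    (by exact continuous_inner) hf

theorem continuous_fourierInv {f : V → ℂ} (hf : Integrable f) : Continuous (𝓕⁻ f) := by
  rw [Real.fourierInv_eq_fourier_comp_neg]
  exact continuous_fourier hf.comp_neg

theorem norm_fourier_le (f : V → ℂ) (ξ : V) : ‖𝓕 f ξ‖ ≤ ∫ x, ‖f x‖ :=
  VectorFourier.norm_fourierIntegral_le_integral_norm _ _ _ _ _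

theorem norm_fourierInv_le (f : V → ℂ) (x : V) : ‖𝓕⁻ f x‖ ≤ ∫ ξ, ‖f ξ‖ := by
  rw [Real.fourierInv_eq_fourier_neg]
  exact norm_fourier_le f _

theorem integral_fourier_mul_eq {f g : V → ℂ} (hf : Integrable f) (hg : Integrable g) :
    ∫ ξ, 𝓕 f ξ * g ξ = ∫ x, f x * 𝓕 g x := by
  have h := VectorFourier.integral_fourierIntegral_smul_eq_flip (L := innerₗ V) (μ := volume)
    (ν := volume) Real.continuous_fourierChar (by exact continuous_inner) hf hg
  rw [flip_innerₗ] at h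
  exact h

theorem integral_fourierInv_mul_eq {f g : V → ℂ} (hf : Integrable f) (hg : Integrable g) :
    ∫ x, 𝓕⁻ f x * g x = ∫ ξ, f ξ * 𝓕 g (-ξ) := by
  rw [Real.fourierInv_eq_fourier_comp_neg, integral_fourier_mul_eq hf.comp_neg hg,
    ← integral_neg_eq_self]
  simp

/-- The Fourier transform on `L²` agrees with the Fourier integral on `L¹ ∩ L²`. -/
theorem fourier_toLp_ae_eq {f : V → ℂ} (hf : Integrable f) (hf2 : MemLp f 2) :
    ((𝓕 (hf2.toLp f) : Lp ℂ 2 (volume : Measure V)) : V → ℂ) =ᵐ[volume] 𝓕 f := by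
  apply ae_eq_of_integral_contDiff_smul_eq
  · exact (Lp.memLp _).locallyIntegrable one_le_two
  · exact (continuous_fourier hf).locallyIntegrable
  intro g hg hgc
  have hg₁ : HasCompactSupport (Complex.ofRealCLM ∘ g) := hgc.comp_left rfl
  have hg₂ : ContDiff ℝ (⊤ : ℕ∞) (Complex.ofRealCLM ∘ g) :=
    Complex.ofRealCLM.contDiff.comp hg
  set G : 𝓢(V, ℂ) := hg₁.toSchwartzMap hg₂ with hG
  have hGg : ∀ x, G x = (g x : ℂ) := fun x => rfl
  have h := congrArg (fun T : 𝓢'(V, ℂ) => T G)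
    (Lp.fourier_toTemperedDistribution_eq (hf2.toLp f))
  simp only [TemperedDistribution.fourier_apply] at h
  erw [Lp.toTemperedDistribution_apply, Lp.toTemperedDistribution_apply] at h
  calc ∫ x, g x • (𝓕 (hf2.toLp f) : Lp ℂ 2 (volume : Measure V)) x
      = ∫ x, G x • (𝓕 (hf2.toLp f) : Lp ℂ 2 (volume : Measure V)) x := by
        simp [hGg]
    _ = ∫ x, (𝓕 G) x • (hf2.toLp f) x := h.symm
    _ = ∫ x, 𝓕 (G : V → ℂ) x * f x := by
        apply integral_congr_ae
        filter_upwards [hf2.coeFn_toLp] with x hx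
        rw [hx, smul_eq_mul, SchwartzMap.fourier_coe]
    _ = ∫ x, G x * 𝓕 f x := integral_fourier_mul_eq G.integrable hf
    _ = ∫ x, g x • 𝓕 f x := by simp [hGg]

theorem memLp_fourier {f : V → ℂ} (hf : Integrable f) (hf2 : MemLp f 2) : MemLp (𝓕 f) 2 :=
  (Lp.memLp _).ae_eq (fourier_toLp_ae_eq hf hf2)

/-- Plancherel's theorem for functions in `L¹ ∩ L²`. -/
theorem eLpNorm_fourier {f : V → ℂ} (hf : Integrable f) (hf2 : MemLp f 2) :
    eLpNorm (𝓕 f) 2 = eLpNorm f 2 := by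
  rw [← eLpNorm_congr_ae (fourier_toLp_ae_eq hf hf2), ← Lp.enorm_def,
    ← eLpNorm_congr_ae hf2.coeFn_toLp, ← Lp.enorm_def]
  simp [enorm, nnnorm]

theorem memLp_comp_neg {f : V → ℂ} {p : ℝ≥0∞} (hf : MemLp f p) : MemLp (fun x => f (-x)) p :=
  hf.comp_measurePreserving (Measure.measurePreserving_neg volume)

theorem memLp_fourierInv {f : V → ℂ} (hf : Integrable f) (hf2 : MemLp f 2) :
    MemLp (𝓕⁻ f) 2 := by
  rw [Real.fourierInv_eq_fourier_comp_neg]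
  exact memLp_fourier hf.comp_neg (memLp_comp_neg hf2)

theorem eLpNorm_fourierInv {f : V → ℂ} (hf : Integrable f) (hf2 : MemLp f 2) :
    eLpNorm (𝓕⁻ f) 2 = eLpNorm f 2 := by
  rw [Real.fourierInv_eq_fourier_comp_neg, eLpNorm_fourier hf.comp_neg (memLp_comp_neg hf2)]
  exact eLpNorm_comp_measurePreserving hf2.1 (Measure.measurePreserving_neg volume)

theorem conj_fourier_conj (f : V → ℂ) (x : V) :
    (starRingEnd ℂ) (𝓕 (fun y => (starRingEnd ℂ) (f y)) x) = 𝓕⁻ f x := by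
  rw [Real.fourier_eq', Real.fourierInv_eq', ← integral_conj]
  congr 1 with y
  simp [← Complex.exp_conj, Complex.conj_ofReal, Complex.conj_ofNat]

/-- Parseval's identity for functions in `L¹ ∩ L²`. -/
theorem integral_fourierInv_mul_fourier {f g : V → ℂ} (hf : Integrable f) (hf2 : MemLp f 2)
    (hg : Integrable g) (hg2 : MemLp g 2) :
    ∫ x, 𝓕⁻ f x * 𝓕 g x = ∫ ξ, f ξ * g ξ := by
  have hc : Integrable (fun y => (starRingEnd ℂ) (f y)) :=
    (memLp_one_iff_integrable.1 (memLp_one_iff_integrable.2 hf).star)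
  have hc2 : MemLp (fun y => (starRingEnd ℂ) (f y)) 2 := hf2.star
  have h := Lp.inner_fourier_eq (hc2.toLp _) (hg2.toLp _)
  rw [L2.inner_def, L2.inner_def] at h
  convert h using 1
  · apply integral_congr_ae
    filter_upwards [fourier_toLp_ae_eq hc hc2, fourier_toLp_ae_eq hg hg2] with x h1 h2
    rw [h1, h2, ← conj_fourier_conj]
    simp [mul_comm]
  · apply integral_congr_ae
    filter_upwards [hc2.coeFn_toLp, hg2.coeFn_toLp] with x h1 h2
    rw [h1, h2]
    simp [mul_comm]

theorem lintegral_indicator_Ioc_rpow {r c : ℝ} (hr : 0 < r) (hc : 0 ≤ c) :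
    ∫⁻ s : ℝ, (Ioc 0 c).indicator (fun s => ENNReal.ofReal (s ^ (r - 1))) s =
      ENNReal.ofReal (c ^ r / r) := by
  have hint : IntegrableOn (fun s : ℝ => s ^ (r - 1)) (Ioc 0 c) :=
    (intervalIntegrable_iff_integrableOn_Ioc_of_le hc).1
      (intervalIntegral.intervalIntegrable_rpow' (by linarith))
  rw [lintegral_indicator measurableSet_Ioc, ← ofReal_integral_eq_lintegral_ofReal hint,
    ← intervalIntegral.integral_of_le hc, integral_rpow (Or.inl (by linarith))]
  · simp [Real.zero_rpow hr.ne']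
  · filter_upwards [ae_restrict_mem measurableSet_Ioc] with s hs
    exact Real.rpow_nonneg hs.1.le _

theorem measurable_indicator_Ioc_rpow {X : Type*} [MeasurableSpace X] {c : X → ℝ}
    (hc : Measurable c) (r : ℝ) :
    Measurable fun z : X × ℝ =>
      (Ioc 0 (c z.1)).indicator (fun s => ENNReal.ofReal (s ^ r)) z.2 := by
  have : (fun z : X × ℝ => (Ioc 0 (c z.1)).indicator (fun s => ENNReal.ofReal (s ^ r)) z.2) =
      {z : X × ℝ | 0 < z.2 ∧ z.2 ≤ c z.1}.indicator (fun z => ENNReal.ofReal (z.2 ^ r)) := by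
    ext z
    simp [indicator]
  rw [this]
  refine Measurable.indicator (by fun_prop) ?_
  exact (measurableSet_lt measurable_const measurable_snd).inter
    (measurableSet_le measurable_snd (hc.comp measurable_fst))

/-- Real interpolation between an `L¹ → L^∞` bound and an `L² → L²` bound for a fixed function `a`;
`S E` plays the role of the operator applied to `a` restricted to `E`. -/
theorem lintegral_rpow_le_of_endpoint_bounds {X Y : Type*} [MeasurableSpace X] [MeasurableSpace Y]
    {μ : Measure X} {ν : Measure Y} [SFinite μ] [SFinite ν] {p q : ℝ} (hp : 2 < p)
    (hq : q = p / (p - 1)) {a : X → ℂ} (ha : Measurable a) {A : ℝ} (hA : 0 < A)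
    {S : Set X → Y → ℂ} (hS : Measurable (S univ))
    (hadd : ∀ E, MeasurableSet E → ∀ y, S univ y = S E y + S Eᶜ y)
    (h1 : ∀ E, MeasurableSet E → ∀ y, ‖S E y‖ₑ ≤ ENNReal.ofReal A * ∫⁻ x in E, ‖a x‖ₑ ∂μ)
    (h2 : ∀ E, MeasurableSet E → ∫⁻ y, ‖S E y‖ₑ ^ 2 ∂ν ≤ ∫⁻ x in E, ‖a x‖ₑ ^ 2 ∂μ) :
    ∫⁻ y, ‖S univ y‖ₑ ^ p ∂ν ≤
      4 * ENNReal.ofReal ((2 * A) ^ (p - 2)) * (∫⁻ x, ‖a x‖ₑ ^ q ∂μ) ^ (p - 1) := by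
  have hq1 : 1 < q := by rw [hq, lt_div_iff₀] <;> linarith
  have hpq : 2 + (1 - q) * (p - 2) = q := by
    rw [hq]
    field_simp [show p - 1 ≠ 0 by linarith]
    ring
  set G := ∫⁻ x, ‖a x‖ₑ ^ q ∂μ with hG
  rcases eq_or_ne G ⊤ with hGt | hGt
  · rw [hGt, ENNReal.top_rpow_of_pos (by linarith), ENNReal.mul_top]
    · exact le_top
    · simp only [ne_eq, mul_eq_zero, OfNat.ofNat_ne_zero, ENNReal.ofReal_eq_zero, not_le, false_or]
      positivity
  rcases eq_or_ne G 0 with hG0 | hG0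
  · have ha0 : ∀ᵐ x ∂μ, ‖a x‖ₑ = 0 := by
      have := (lintegral_eq_zero_iff (by fun_prop)).1 hG0
      filter_upwards [this] with x hx
      simpa [show 0 < q by linarith, show ¬ q < 0 by linarith] using hx
    have hz : ∀ y, ‖S univ y‖ₑ = 0 := by
      intro y
      have := h1 univ MeasurableSet.univ y
      rw [Measure.restrict_univ, lintegral_congr_ae ha0] at this
      simpa using this
    simp [hz, show 0 < p by linarith]
  set g := G.toReal with hg
  have hg0 : 0 < g := ENNReal.toReal_pos hG0 hGt
  have hGg : G = ENNReal.ofReal g := (ENNReal.ofReal_toReal hGt).symm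
  set c : X → ℝ := fun x => 2 * A * g * ‖a x‖ ^ (1 - q) with hc
  have hcm : Measurable c := by fun_prop
  have hc0 : ∀ x, 0 ≤ c x := fun x => by positivity
  set k : ℝ → ℝ → ℝ≥0∞ := fun c => (Ioc 0 c).indicator fun s => ENNReal.ofReal (s ^ (p - 2 - 1))
    with hk
  have hkint : ∀ c, 0 ≤ c → ∫⁻ s, k c s = ENNReal.ofReal (c ^ (p - 2) / (p - 2)) := fun c hc =>
    lintegral_indicator_Ioc_rpow (by linarith) hc
  have hp2 : ENNReal.ofReal (p - 2) ≠ 0 := by simpa using hp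
  have hkey : ∀ s : ℝ, ∫⁻ y, k ‖S univ y‖ s * ‖S univ y‖ₑ ^ 2 ∂ν ≤
      ∫⁻ x, 4 * (k (c x) s * ‖a x‖ₑ ^ 2) ∂μ := by
    intro s
    by_cases hs : 0 < s
    swap
    · simp [hk, hs]
    set E : Set X := {x | c x < s} with hE
    have hEm : MeasurableSet E := measurableSet_lt hcm measurable_const
    have hEint : ENNReal.ofReal A * ∫⁻ x in E, ‖a x‖ₑ ∂μ ≤ ENNReal.ofReal (s / 2) := by
      have : ∫⁻ x in E, ‖a x‖ₑ ∂μ ≤ ∫⁻ x in E, ENNReal.ofReal (s / (2 * A * g)) * ‖a x‖ₑ ^ q ∂μ := by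
        apply setLIntegral_mono (by fun_prop)
        intro x hx
        rcases eq_or_ne (a x) 0 with h0 | h0
        · simp [h0]
        have hax : 0 < ‖a x‖ := norm_pos_iff.2 h0
        rw [← ofReal_norm, ENNReal.ofReal_rpow_of_pos hax, ← ENNReal.ofReal_mul (by positivity)]
        apply ENNReal.ofReal_le_ofReal
        have hx' : 2 * A * g * ‖a x‖ ^ (1 - q) < s := hx
        rw [div_mul_eq_mul_div, le_div_iff₀ (by positivity)]
        calc ‖a x‖ * (2 * A * g) = 2 * A * g * (‖a x‖ ^ (1 - q) * ‖a x‖ ^ q) := by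
              rw [← Real.rpow_add hax]; simp; ring
          _ = (2 * A * g * ‖a x‖ ^ (1 - q)) * ‖a x‖ ^ q := by ring
          _ ≤ s * ‖a x‖ ^ q := by gcongr
      calc _ ≤ ENNReal.ofReal A * (ENNReal.ofReal (s / (2 * A * g)) * G) := by
            gcongr
            refine this.trans ?_
            rw [lintegral_const_mul _ (by fun_prop)]
            gcongr
            exact setLIntegral_le_lintegral _ _
        _ = ENNReal.ofReal (s / 2) := by
            rw [hGg, ← ENNReal.ofReal_mul (by positivity), ← ENNReal.ofReal_mul (by positivity)]
            congr 1
            field_simp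
    calc ∫⁻ y, k ‖S univ y‖ s * ‖S univ y‖ₑ ^ 2 ∂ν
        ≤ ∫⁻ y, ENNReal.ofReal (s ^ (p - 2 - 1)) * (4 * ‖S Eᶜ y‖ₑ ^ 2) ∂ν := by
          apply lintegral_mono
          intro y
          by_cases hy : s ≤ ‖S univ y‖
          · simp only [hk, indicator, mem_Ioc, hs, hy, and_self, if_true]
            gcongr
            have hb : ‖S E y‖ ≤ s / 2 := by
              have := (h1 E hEm y).trans hEint
              rw [← ofReal_norm] at this
              exact (ENNReal.ofReal_le_ofReal_iff (by positivity)).1 this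
            have hb2 : ‖S univ y‖ ≤ 2 * ‖S Eᶜ y‖ := by
              have := norm_add_le (S E y) (S Eᶜ y)
              rw [← hadd E hEm y] at this
              linarith
            have : ‖S univ y‖ₑ ≤ 2 * ‖S Eᶜ y‖ₑ := by
              rw [← ofReal_norm, ← ofReal_norm, ← ENNReal.ofReal_ofNat,
                ← ENNReal.ofReal_mul (by norm_num)]
              exact ENNReal.ofReal_le_ofReal hb2
            calc ‖S univ y‖ₑ ^ 2 ≤ (2 * ‖S Eᶜ y‖ₑ) ^ 2 := by gcongr
              _ = 4 * ‖S Eᶜ y‖ₑ ^ 2 := by rw [mul_pow]; norm_num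
          · simp [hk, hy]
      _ = ENNReal.ofReal (s ^ (p - 2 - 1)) * (4 * ∫⁻ y, ‖S Eᶜ y‖ₑ ^ 2 ∂ν) := by
          rw [lintegral_const_mul' _ _ (by simp), lintegral_const_mul' _ _ (by simp)]
      _ ≤ ENNReal.ofReal (s ^ (p - 2 - 1)) * (4 * ∫⁻ x in Eᶜ, ‖a x‖ₑ ^ 2 ∂μ) := by
          gcongr
          exact h2 _ hEm.compl
      _ = ∫⁻ x, 4 * (k (c x) s * ‖a x‖ₑ ^ 2) ∂μ := by
          rw [← lintegral_const_mul' _ _ (by simp), ← lintegral_const_mul' _ _ (by simp),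
            ← lintegral_indicator hEm.compl]
          congr 1 with x
          by_cases hx : s ≤ c x
          · simp [hk, hE, indicator, hx, hs, not_lt.2 hx]
            ring
          · simp [hk, hE, indicator, hx, not_le.1 hx]
  calc ∫⁻ y, ‖S univ y‖ₑ ^ p ∂ν
      = ∫⁻ y, ENNReal.ofReal (p - 2) * (∫⁻ s, k ‖S univ y‖ s * ‖S univ y‖ₑ ^ 2) ∂ν := by
        congr 1 with y
        rw [lintegral_mul_const' _ _ (by simp), hkint _ (norm_nonneg _), ← mul_assoc,
          ← ENNReal.ofReal_mul (by linarith), mul_div_cancel₀ _ (by linarith),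
          ← ENNReal.ofReal_rpow_of_nonneg (norm_nonneg _) (by linarith), ofReal_norm,
          ← ENNReal.rpow_natCast, ← ENNReal.rpow_add_of_nonneg _ _ (by linarith) (by norm_num)]
        norm_num
    _ = ENNReal.ofReal (p - 2) * ∫⁻ s, (∫⁻ y, k ‖S univ y‖ s * ‖S univ y‖ₑ ^ 2 ∂ν) := by
        rw [lintegral_const_mul' _ _ (by simp), lintegral_lintegral_swap]
        exact ((measurable_indicator_Ioc_rpow hS.norm _).mul
          ((hS.comp measurable_fst).enorm.pow_const 2)).aemeasurable
    _ ≤ ENNReal.ofReal (p - 2) * ∫⁻ s, (∫⁻ x, 4 * (k (c x) s * ‖a x‖ₑ ^ 2) ∂μ) := by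
        gcongr with s
        exact hkey s
    _ = ENNReal.ofReal (p - 2) * ∫⁻ x, (∫⁻ s, 4 * (k (c x) s * ‖a x‖ₑ ^ 2)) ∂μ := by
        rw [lintegral_lintegral_swap]
        exact (((measurable_indicator_Ioc_rpow hcm _).mul
          ((ha.comp measurable_fst).enorm.pow_const 2)).const_mul 4).comp
            measurable_swap |>.aemeasurable
    _ = ∫⁻ x, 4 * ENNReal.ofReal ((2 * A * g) ^ (p - 2)) * ‖a x‖ₑ ^ q ∂μ := by
        rw [← lintegral_const_mul' _ _ (by simp)]
        congr 1 with x
        rw [lintegral_const_mul' _ _ (by simp), lintegral_mul_const' _ _ (by simp),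
          hkint _ (hc0 x), mul_left_comm, ← mul_assoc (ENNReal.ofReal (p - 2)),
          ← ENNReal.ofReal_mul (by linarith), mul_div_cancel₀ _ (by linarith), mul_assoc]
        congr 1
        rcases eq_or_ne (a x) 0 with h0 | h0
        · simp [h0, show 0 < q by linarith]
        have hax : 0 < ‖a x‖ := norm_pos_iff.2 h0
        rw [← ofReal_norm, ENNReal.ofReal_rpow_of_pos hax, ← ENNReal.ofReal_pow hax.le,
          ← ENNReal.ofReal_mul (by positivity), ← ENNReal.ofReal_mul (by positivity), hc]
        congr 1
        rw [Real.mul_rpow (by positivity) (by positivity), ← Real.rpow_mul hax.le, mul_assoc,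
          ← Real.rpow_natCast, ← Real.rpow_add hax]
        congr 2
        push_cast
        linarith
    _ = 4 * ENNReal.ofReal ((2 * A * g) ^ (p - 2)) * G := by
        rw [lintegral_const_mul' _ _ (ENNReal.mul_ne_top (by simp) (by simp))]
    _ = _ := by
        rw [hGg, Real.mul_rpow (by positivity) (by positivity), ENNReal.ofReal_mul (by positivity),
          ENNReal.ofReal_rpow_of_pos hg0, mul_assoc, mul_assoc, mul_assoc,
          ← ENNReal.ofReal_mul (by positivity), ← Real.rpow_add_one hg0.ne']
        congr 4
        ring

/-- Bounded, measurable and integrable functions. -/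
structure IsBddIntegrable (a : V → ℂ) : Prop where
  measurable : Measurable a
  integrable : Integrable a
  bounded : ∃ C, ∀ x, ‖a x‖ ≤ C

theorem IsBddIntegrable.lintegral_rpow_ne_top {a : V → ℂ} (ha : IsBddIntegrable a) {q : ℝ}
    (hq : 1 ≤ q) : ∫⁻ x, ‖a x‖ₑ ^ q ≠ ⊤ := by
  obtain ⟨C, hC⟩ := ha.bounded
  refine ne_top_of_le_ne_top (b := ENNReal.ofReal C ^ (q - 1) * ∫⁻ x, ‖a x‖ₑ) ?_ ?_
  · exact ENNReal.mul_ne_top (ENNReal.rpow_ne_top_of_nonneg (by linarith) (by simp))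
      ha.integrable.2.ne
  · rw [← lintegral_const_mul' _ _ (ENNReal.rpow_ne_top_of_nonneg (by linarith) (by simp))]
    refine lintegral_mono fun x => ?_
    calc ‖a x‖ₑ ^ q = ‖a x‖ₑ ^ (q - 1) * ‖a x‖ₑ ^ (1 : ℝ) := by
          rw [← ENNReal.rpow_add_of_nonneg _ _ (by linarith) (by norm_num), sub_add_cancel]
      _ ≤ ENNReal.ofReal C ^ (q - 1) * ‖a x‖ₑ := by
          rw [ENNReal.rpow_one]
          gcongr
          rw [← ofReal_norm]
          exact ENNReal.ofReal_le_ofReal (hC x)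

theorem IsBddIntegrable.memLp_two {a : V → ℂ} (ha : IsBddIntegrable a) : MemLp a 2 := by
  refine ⟨ha.integrable.1, ?_⟩
  rw [eLpNorm_lt_top_iff_lintegral_rpow_enorm_lt_top (by simp) (by simp)]
  exact (ha.lintegral_rpow_ne_top (by norm_num)).lt_top

theorem IsBddIntegrable.indicator {a : V → ℂ} (ha : IsBddIntegrable a) {E : Set V}
    (hE : MeasurableSet E) : IsBddIntegrable (E.indicator a) := by
  refine ⟨ha.measurable.indicator hE, ha.integrable.indicator hE, ?_⟩
  obtain ⟨C, hC⟩ := ha.bounded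
  exact ⟨C, fun x => (norm_indicator_le_norm_self _ _).trans (hC x)⟩

theorem integrable_mul_fourier {m b : V → ℂ} (hm : Integrable m) (hb : Integrable b) :
    Integrable fun ξ => m ξ * 𝓕 b ξ :=
  hm.mul_bdd (c := ∫ x, ‖b x‖) (continuous_fourier hb).aestronglyMeasurable
    (Filter.Eventually.of_forall (norm_fourier_le b))

theorem fourierInv_mul_fourier_eq_integral {m b : V → ℂ} (hm : Integrable m) (hb : Integrable b)
    (y : V) : 𝓕⁻ (fun ξ => m ξ * 𝓕 b ξ) y = ∫ x, 𝓕⁻ m (y - x) * b x := by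
  have hint : Integrable fun ξ : V => Complex.exp (↑(2 * Real.pi * ⟪ξ, y⟫) * Complex.I) * m ξ := by
    refine hm.bdd_mul (c := 1) (by fun_prop) (Filter.Eventually.of_forall fun ξ => ?_)
    rw [Complex.norm_exp_ofReal_mul_I]
  have h := integral_fourier_mul_eq hint hb
  rw [Real.fourierInv_eq']
  simp only [smul_eq_mul, ← mul_assoc]
  rw [← h]
  congr 1 with x
  congr 1
  rw [Real.fourier_eq', Real.fourierInv_eq']
  congr 1 with ξ
  rw [smul_eq_mul, smul_eq_mul, ← mul_assoc, ← Complex.exp_add, inner_sub_right]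
  congr 2
  push_cast
  ring

theorem lintegral_enorm_sq_eq {X : Type*} [MeasurableSpace X] {μ : Measure X} (f : X → ℂ) :
    ∫⁻ x, ‖f x‖ₑ ^ 2 ∂μ = eLpNorm f 2 μ ^ 2 := by
  rw [eLpNorm_eq_lintegral_rpow_enorm_toReal (by simp) (by simp), ← ENNReal.rpow_natCast,
    ← ENNReal.rpow_mul]
  simp

theorem lintegral_fourierInv_mul_fourier_sq_le {m b : V → ℂ} (hm : Integrable m)
    (hm1 : ∀ ξ, ‖m ξ‖ ≤ 1) (hb : Integrable b) (hb2 : MemLp b 2) :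
    ∫⁻ y, ‖𝓕⁻ (fun ξ => m ξ * 𝓕 b ξ) y‖ₑ ^ 2 ≤ ∫⁻ x, ‖b x‖ₑ ^ 2 := by
  have hle : ∀ ξ, ‖m ξ * 𝓕 b ξ‖ ≤ ‖𝓕 b ξ‖ := fun ξ => by
    rw [norm_mul]
    exact mul_le_of_le_one_left (norm_nonneg _) (hm1 ξ)
  have hi := integrable_mul_fourier hm hb
  have h2 : MemLp (fun ξ => m ξ * 𝓕 b ξ) 2 :=
    (memLp_fourier hb hb2).mono hi.1 (Filter.Eventually.of_forall hle)
  rw [lintegral_enorm_sq_eq, lintegral_enorm_sq_eq, eLpNorm_fourierInv hi h2,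
    ← eLpNorm_fourier hb hb2]
  gcongr
  exact eLpNorm_mono hle

/-- `L^q → L^p` bound for a Fourier multiplier with bounded symbol and bounded kernel. -/
theorem lintegral_fourierInv_mul_fourier_rpow_le {p q : ℝ} (hp : 2 < p) (hq : q = p / (p - 1))
    {m a : V → ℂ} (hm : Integrable m) (hm1 : ∀ ξ, ‖m ξ‖ ≤ 1) {A : ℝ} (hA : 0 < A)
    (hmA : ∀ x, ‖𝓕⁻ m x‖ ≤ A) (ha : IsBddIntegrable a) :
    ∫⁻ y, ‖𝓕⁻ (fun ξ => m ξ * 𝓕 a ξ) y‖ₑ ^ p ≤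
      4 * ENNReal.ofReal ((2 * A) ^ (p - 2)) * (∫⁻ x, ‖a x‖ₑ ^ q) ^ (p - 1) := by
  set S : Set V → V → ℂ := fun E => 𝓕⁻ (fun ξ => m ξ * 𝓕 (E.indicator a) ξ) with hS
  have hSu : S univ = 𝓕⁻ (fun ξ => m ξ * 𝓕 a ξ) := by simp [hS]
  rw [← hSu]
  refine lintegral_rpow_le_of_endpoint_bounds hp hq ha.measurable hA
    (continuous_fourierInv (integrable_mul_fourier hm ?_)).measurable ?_ ?_ ?_
  · simpa using ha.integrable
  · intro E hE y
    have hi := ha.integrable.indicator hE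
    have hi' := ha.integrable.indicator hE.compl
    rw [hSu, hS]
    simp only
    rw [fourierInv_mul_fourier_eq_integral hm ha.integrable,
      fourierInv_mul_fourier_eq_integral hm hi, fourierInv_mul_fourier_eq_integral hm hi']
    have hK : Continuous fun x => 𝓕⁻ m (y - x) :=
      (continuous_fourierInv hm).comp (continuous_const.sub continuous_id)
    rw [← integral_add (hi.bdd_mul (c := A) hK.aestronglyMeasurable
        (Filter.Eventually.of_forall fun x => hmA _))
      (hi'.bdd_mul (c := A) hK.aestronglyMeasurable (Filter.Eventually.of_forall fun x => hmA _))]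
    congr 1 with x
    rw [← mul_add, indicator_self_add_compl_apply]
  · intro E hE y
    rw [hS]
    simp only
    rw [fourierInv_mul_fourier_eq_integral hm (ha.integrable.indicator hE),
      ← lintegral_indicator hE, ← lintegral_const_mul' _ _ (by simp)]
    refine (enorm_integral_le_lintegral_enorm _).trans (lintegral_mono fun x => ?_)
    rw [enorm_mul, enorm_indicator_eq_indicator_enorm]
    gcongr
    rw [← ofReal_norm]
    exact ENNReal.ofReal_le_ofReal (hmA _)
  · intro E hE
    rw [← lintegral_indicator hE]
    refine (lintegral_fourierInv_mul_fourier_sq_le hm hm1 (ha.integrable.indicator hE)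
      ((ha.indicator hE).memLp_two)).trans_eq ?_
    congr 1 with x
    by_cases hx : x ∈ E <;> simp [hx]

theorem add_rpow_half_ge_of_mem_Icc {q : ℝ} (hq1 : 1 < q) (hq2 : q ≤ 2) {x y : ℝ}
    (hx : x ∈ Icc (0 : ℝ) 2) (hy : y ∈ Icc (0 : ℝ) 2) :
    ((x + y) / 2) ^ q + q * (q - 1) / 16 * (x - y) ^ 2 ≤ (x ^ q + y ^ q) / 2 := by
  have hconv : ConvexOn ℝ (Icc (0 : ℝ) 2) fun t => t ^ q - q * (q - 1) / 4 * t ^ 2 := by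
    have hd : ∀ t : ℝ, HasDerivAt (fun t => t ^ q - q * (q - 1) / 4 * t ^ 2)
        (q * t ^ (q - 1) - q * (q - 1) / 2 * t) t := fun t => by
      have h1 := Real.hasDerivAt_rpow_const (x := t) (p := q) (Or.inr hq1.le)
      have h2 := (hasDerivAt_pow 2 t).const_mul (q * (q - 1) / 4)
      refine (h1.sub h2).congr_deriv ?_
      simp
      ring
    refine convexOn_of_hasDerivWithinAt2_nonneg (convex_Icc 0 2)
      (f' := fun t => q * t ^ (q - 1) - q * (q - 1) / 2 * t)
      (f'' := fun t => q * ((q - 1) * t ^ (q - 1 - 1)) - q * (q - 1) / 2)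
      (fun t _ => (hd t).continuousAt.continuousWithinAt)
      (fun t _ => (hd t).hasDerivWithinAt) (fun t ht => ?_) (fun t ht => ?_)
    · rw [interior_Icc] at ht
      have h1 := (Real.hasDerivAt_rpow_const (x := t) (p := q - 1) (Or.inl ht.1.ne')).const_mul q
      have h2 := (hasDerivAt_id t).const_mul (q * (q - 1) / 2)
      refine ((h1.sub h2).congr_deriv ?_).hasDerivWithinAt
      simp
    · rw [interior_Icc] at ht
      have h : (1 / 2 : ℝ) ≤ t ^ (q - 1 - 1) := by
        calc (1 / 2 : ℝ) = 2 ^ (-1 : ℝ) := by rw [Real.rpow_neg_one]; norm_num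
          _ ≤ 2 ^ (q - 1 - 1) := by
            apply Real.rpow_le_rpow_of_exponent_le <;> linarith
          _ ≤ t ^ (q - 1 - 1) := Real.rpow_le_rpow_of_nonpos ht.1 ht.2.le (by linarith)
      have hq0 : 0 ≤ q * (q - 1) := by nlinarith
      nlinarith
  have h := hconv.2 hx hy (by norm_num : (0 : ℝ) ≤ 1 / 2) (by norm_num : (0 : ℝ) ≤ 1 / 2)
    (by norm_num)
  simp only [smul_eq_mul] at h
  rw [show 1 / 2 * x + 1 / 2 * y = (x + y) / 2 by ring] at h
  linarith

/-- A quantitative form of the uniform convexity of `‖·‖ ^ q`. -/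
theorem norm_half_add_rpow_add_le_of_norm_add_norm {E : Type*} [NormedAddCommGroup E]
    [InnerProductSpace ℝ E] {q : ℝ} (hq1 : 1 < q) (hq2 : q ≤ 2) {a b : E}
    (hab : ‖a‖ + ‖b‖ = 2) :
    ‖(1 / 2 : ℝ) • (a + b)‖ ^ q + q * (q - 1) / 16 * ‖a - b‖ ^ 2 ≤ (‖a‖ ^ q + ‖b‖ ^ q) / 2 := by
  have h1 := add_rpow_half_ge_of_mem_Icc hq1 hq2 (x := ‖a‖) (y := ‖b‖)
    ⟨norm_nonneg _, by linarith [norm_nonneg b]⟩ ⟨norm_nonneg _, by linarith [norm_nonneg a]⟩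
  rw [hab] at h1
  have hpar := parallelogram_law_with_norm ℝ a b
  set m := ‖(1 / 2 : ℝ) • (a + b)‖ with hm
  have hmm : m = ‖a + b‖ / 2 := by rw [hm, norm_smul]; norm_num; ring
  set δ := ‖a - b‖ with hδ
  have hδ2 : (‖a‖ - ‖b‖) ^ 2 ≤ δ ^ 2 := by
    rw [sq_le_sq, abs_of_nonneg (norm_nonneg (a - b))]
    exact abs_norm_sub_norm_le a b
  have hm0 : 0 ≤ m := norm_nonneg _
  set η := (δ ^ 2 - (‖a‖ - ‖b‖) ^ 2) / 4 with hη
  have hm2 : m ^ 2 = 1 + -η := by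
    rw [hmm, hη]
    nlinarith
  have h2 : m ^ q ≤ 1 + q / 2 * -η := by
    calc m ^ q = (1 + -η) ^ (q / 2) := by
          rw [← hm2, ← Real.rpow_natCast, ← Real.rpow_mul hm0]
          congr 1
          push_cast
          ring
      _ ≤ _ := by
          apply rpow_one_add_le_one_add_mul_self <;> nlinarith
  have h3 : (1 : ℝ) ^ q = 1 := Real.one_rpow q
  norm_num at h1
  have : q * (q - 1) / 16 * (δ ^ 2 - (‖a‖ - ‖b‖) ^ 2) ≤ q / 2 * η := by
    rw [hη]
    nlinarith [mul_nonneg (mul_nonneg (by linarith : 0 ≤ q) (by linarith : 0 ≤ 2 - q))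
      (sub_nonneg.2 hδ2), mul_nonneg (by linarith : 0 ≤ q) (sub_nonneg.2 hδ2)]
  linarith

theorem norm_sub_rpow_le_gap {E : Type*} [NormedAddCommGroup E]
    [InnerProductSpace ℝ E] {q : ℝ} (hq1 : 1 < q) (hq2 : q ≤ 2) (a b : E) :
    ‖(1 / 2 : ℝ) • (a + b)‖ ^ q ≤ (‖a‖ ^ q + ‖b‖ ^ q) / 2 ∧
    ‖a - b‖ ^ q ≤ (16 / (q * (q - 1))) ^ (q / 2) *
      (((‖a‖ ^ q + ‖b‖ ^ q) / 2 - ‖(1 / 2 : ℝ) • (a + b)‖ ^ q) ^ (q / 2) *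
        ((‖a‖ ^ q + ‖b‖ ^ q) / 2) ^ (1 - q / 2)) := by
  have hq0 : 0 < q * (q - 1) := by nlinarith
  have key : ∀ a b : E, ‖a‖ + ‖b‖ = 2 →
      ‖(1 / 2 : ℝ) • (a + b)‖ ^ q ≤ (‖a‖ ^ q + ‖b‖ ^ q) / 2 ∧
      ‖a - b‖ ^ q ≤ (16 / (q * (q - 1))) ^ (q / 2) *
      (((‖a‖ ^ q + ‖b‖ ^ q) / 2 - ‖(1 / 2 : ℝ) • (a + b)‖ ^ q) ^ (q / 2) *
        ((‖a‖ ^ q + ‖b‖ ^ q) / 2) ^ (1 - q / 2)) := by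
    intro a b hab
    have h := norm_half_add_rpow_add_le_of_norm_add_norm hq1 hq2 hab
    have hle : ‖(1 / 2 : ℝ) • (a + b)‖ ^ q ≤ (‖a‖ ^ q + ‖b‖ ^ q) / 2 :=
      le_trans (le_add_of_nonneg_right (by positivity)) h
    refine ⟨hle, ?_⟩
    set gap := (‖a‖ ^ q + ‖b‖ ^ q) / 2 - ‖(1 / 2 : ℝ) • (a + b)‖ ^ q with hgap
    have hgap0 : 0 ≤ gap := by linarith
    have h1 : (1 : ℝ) ≤ (‖a‖ ^ q + ‖b‖ ^ q) / 2 := by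
      have h1 := add_rpow_half_ge_of_mem_Icc hq1 hq2 (x := ‖a‖) (y := ‖b‖)
        ⟨norm_nonneg _, by linarith [norm_nonneg b]⟩ ⟨norm_nonneg _, by linarith [norm_nonneg a]⟩
      rw [hab] at h1
      norm_num at h1
      refine le_trans (le_add_of_nonneg_right (by positivity)) h1
    calc ‖a - b‖ ^ q = (‖a - b‖ ^ 2) ^ (q / 2) := by
          rw [← Real.rpow_natCast, ← Real.rpow_mul (norm_nonneg _)]
          congr 1
          push_cast
          ring
      _ ≤ (16 / (q * (q - 1)) * gap) ^ (q / 2) := by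
          gcongr
          rw [div_mul_eq_mul_div, le_div_iff₀ hq0]
          linarith
      _ = (16 / (q * (q - 1))) ^ (q / 2) * (gap ^ (q / 2) * 1) := by
          rw [Real.mul_rpow (by positivity) hgap0, mul_one]
      _ ≤ _ := by
          gcongr
          exact Real.one_le_rpow h1 (by linarith)
  rcases eq_or_lt_of_le (add_nonneg (norm_nonneg a) (norm_nonneg b)) with h0 | h0
  · have ha : a = 0 := norm_eq_zero.1 (by linarith [norm_nonneg a, norm_nonneg b])
    have hb : b = 0 := norm_eq_zero.1 (by linarith [norm_nonneg a, norm_nonneg b])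
    simp [ha, hb, Real.zero_rpow (show q ≠ 0 by linarith),
      Real.zero_rpow (show q / 2 ≠ 0 by linarith)]
  set s := (‖a‖ + ‖b‖) / 2 with hs
  have hs0 : 0 < s := by positivity
  obtain ⟨h1, h2⟩ := key (s⁻¹ • a) (s⁻¹ • b) (by
    rw [norm_smul, norm_smul, Real.norm_of_nonneg (by positivity), ← mul_add, hs]
    field_simp)
  rw [← smul_add, smul_comm, norm_smul s⁻¹, norm_smul s⁻¹, norm_smul s⁻¹,
    Real.norm_of_nonneg (by positivity), Real.mul_rpow (by positivity) (norm_nonneg _),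
    Real.mul_rpow (by positivity) (norm_nonneg _), Real.mul_rpow (by positivity) (norm_nonneg _),
    ← mul_add, mul_div_assoc] at h1 h2
  have hsq : 0 < s⁻¹ ^ q := by positivity
  have hle := (mul_le_mul_iff_right₀ hsq).1 h1
  refine ⟨hle, ?_⟩
  rw [← smul_sub, norm_smul, Real.norm_of_nonneg (by positivity),
    Real.mul_rpow (by positivity) (norm_nonneg _), ← mul_sub,
    Real.mul_rpow hsq.le (sub_nonneg.2 hle), Real.mul_rpow hsq.le (by positivity),
    mul_mul_mul_comm, ← Real.rpow_add hsq, add_sub_cancel, Real.rpow_one, mul_left_comm] at h2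
  exact (mul_le_mul_iff_right₀ hsq).1 h2

theorem enorm_integral_rpow_le {Ω : Type*} [MeasurableSpace Ω] {μ : Measure Ω}
    [IsProbabilityMeasure μ] {f : Ω → ℂ} (hf : AEStronglyMeasurable f μ) {q : ℝ} (hq : 1 ≤ q) :
    ‖∫ x, f x ∂μ‖ₑ ^ q ≤ ∫⁻ x, ‖f x‖ₑ ^ q ∂μ := by
  have h := eLpNorm'_le_eLpNorm'_of_exponent_le (μ := μ) one_pos hq hf
  simp only [eLpNorm', ENNReal.rpow_one, ne_eq, one_ne_zero, not_false_eq_true, div_self] at h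
  calc ‖∫ x, f x ∂μ‖ₑ ^ q ≤ ((∫⁻ x, ‖f x‖ₑ ^ q ∂μ) ^ (1 / q)) ^ q := by
        gcongr
        exact (enorm_integral_le_lintegral_enorm _).trans h
    _ = _ := by
        rw [← ENNReal.rpow_mul, one_div_mul_cancel (by linarith), ENNReal.rpow_one]

theorem enorm_rpow_eq_ofReal {E : Type*} [NormedAddCommGroup E] (a : E) {q : ℝ} (hq : 0 ≤ q) :
    ‖a‖ₑ ^ q = ENNReal.ofReal (‖a‖ ^ q) := by
  rw [← ofReal_norm, ENNReal.ofReal_rpow_of_nonneg (norm_nonneg _) hq]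

section Average

variable (ν : Measure V) [IsProbabilityMeasure ν]

/-- The convolution of a function with a probability measure. -/
def average (u : V → ℂ) (x : V) : ℂ := ∫ z, u (x - z) ∂ν

variable {ν} {u : V → ℂ}

theorem lintegral_average_rpow_le (hu : IsBddIntegrable u) {q : ℝ} (hq : 1 ≤ q) :
    ∫⁻ x, ‖average ν u x‖ₑ ^ q ≤ ∫⁻ x, ‖u x‖ₑ ^ q := by
  have hm := hu.measurable
  calc ∫⁻ x, ‖average ν u x‖ₑ ^ q ≤ ∫⁻ x, (∫⁻ z, ‖u (x - z)‖ₑ ^ q ∂ν) := by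
        refine lintegral_mono fun x => enorm_integral_rpow_le ?_ hq
        exact Measurable.aestronglyMeasurable (by fun_prop)
    _ = ∫⁻ z, (∫⁻ x, ‖u (x - z)‖ₑ ^ q) ∂ν :=
        lintegral_lintegral_swap (Measurable.aemeasurable (by fun_prop))
    _ = ∫⁻ x, ‖u x‖ₑ ^ q := by
        simp [lintegral_sub_right_eq_self (fun x => ‖u x‖ₑ ^ q)]

theorem IsBddIntegrable.average (hu : IsBddIntegrable u) : IsBddIntegrable (average ν u) := by
  have hm := hu.measurable
  obtain ⟨C, hC⟩ := hu.bounded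
  have hmeas : StronglyMeasurable (HalfWave.average ν u) :=
    StronglyMeasurable.integral_prod_right' (f := fun z : V × V => u (z.1 - z.2))
      (Measurable.stronglyMeasurable (by fun_prop))
  refine ⟨hmeas.measurable, ⟨hmeas.aestronglyMeasurable, ?_⟩, C, fun x => ?_⟩
  · have h := lintegral_average_rpow_le (ν := ν) hu le_rfl
    simp only [ENNReal.rpow_one] at h
    exact h.trans_lt hu.integrable.2
  · refine (norm_integral_le_of_norm_le_const (C := C)
      (Filter.Eventually.of_forall fun z => hC _)).trans ?_
    simp

theorem average_average (hu : IsBddIntegrable u) (x : V) :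
    average ν (average ν u) x = ∫ z, u (x - z.1 - z.2) ∂ν.prod ν := by
  have hm := hu.measurable
  obtain ⟨C, hC⟩ := hu.bounded
  rw [integral_prod]
  · rfl
  · exact Integrable.of_bound (Measurable.aestronglyMeasurable (by fun_prop)) C
      (Filter.Eventually.of_forall fun z => hC _)

theorem lintegral_sub_average_average_rpow_le (hν : MeasurePreserving Neg.neg ν ν)
    (hu : IsBddIntegrable u) {q : ℝ} (hq : 1 ≤ q) :
    ∫⁻ x, ‖u x - average ν (average ν u) x‖ₑ ^ q ≤
      ∫⁻ x, (∫⁻ z, ‖u (x - z.1) - u (x - z.2)‖ₑ ^ q ∂ν.prod ν) := by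
  have hm := hu.measurable
  obtain ⟨C, hC⟩ := hu.bounded
  have hflip : MeasurePreserving (fun z : V × V => (z.1, -z.2)) (ν.prod ν) (ν.prod ν) :=
    (MeasurePreserving.id ν).prod hν
  calc ∫⁻ x, ‖u x - average ν (average ν u) x‖ₑ ^ q
      ≤ ∫⁻ x, (∫⁻ z, ‖u x - u (x - z.1 - z.2)‖ₑ ^ q ∂ν.prod ν) := by
        refine lintegral_mono fun x => ?_
        have : u x - average ν (average ν u) x = ∫ z, (u x - u (x - z.1 - z.2)) ∂ν.prod ν := by
          rw [average_average hu, integral_sub (integrable_const _)]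
          · simp
          · exact Integrable.of_bound (Measurable.aestronglyMeasurable (by fun_prop)) C
              (Filter.Eventually.of_forall fun z => hC _)
        simp only [this]
        exact enorm_integral_rpow_le (Measurable.aestronglyMeasurable (by fun_prop)) hq
    _ = ∫⁻ z, (∫⁻ x, ‖u x - u (x - z.1 - z.2)‖ₑ ^ q) ∂ν.prod ν :=
        lintegral_lintegral_swap (Measurable.aemeasurable (by fun_prop))
    _ = ∫⁻ z, (∫⁻ x, ‖u (x + z.2) - u (x - z.1)‖ₑ ^ q) ∂ν.prod ν := by
        congr 1 with z
        rw [← lintegral_add_right_eq_self _ z.2]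
        congr 1 with x
        congr 4
        abel
    _ = ∫⁻ z, (∫⁻ x, ‖u (x - z.2) - u (x - z.1)‖ₑ ^ q) ∂ν.prod ν := by
        rw [← hflip.lintegral_comp (Measurable.lintegral_prod_right' (f := fun z : (V × V) × V =>
          ‖u (z.2 + z.1.2) - u (z.2 - z.1.1)‖ₑ ^ q) (by fun_prop))]
        simp [sub_eq_add_neg]
    _ = ∫⁻ x, (∫⁻ z, ‖u (x - z.2) - u (x - z.1)‖ₑ ^ q ∂ν.prod ν) :=
        lintegral_lintegral_swap (Measurable.aemeasurable (by fun_prop))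
    _ = _ := by simp_rw [enorm_sub_rev]

theorem lintegral_prod_comp_fst_add (hu : IsBddIntegrable u) {q : ℝ} :
    ∫⁻ w : V × V × V, ENNReal.ofReal ((‖u (w.1 - w.2.1)‖ ^ q + ‖u (w.1 - w.2.2)‖ ^ q) / 2)
      ∂(volume : Measure V).prod (ν.prod ν) = ∫⁻ x, ENNReal.ofReal (‖u x‖ ^ q) := by
  have hm := hu.measurable
  set F : V → ℝ≥0∞ := fun x => ENNReal.ofReal (‖u x‖ ^ q) with hF
  have hFm : Measurable F := by fun_prop
  have hsplit : ∀ w : V × V × V,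
      ENNReal.ofReal ((‖u (w.1 - w.2.1)‖ ^ q + ‖u (w.1 - w.2.2)‖ ^ q) / 2) =
      2⁻¹ * (F (w.1 - w.2.1) + F (w.1 - w.2.2)) := fun w => by
    rw [hF, ← ENNReal.ofReal_add (by positivity) (by positivity), div_eq_inv_mul,
      ENNReal.ofReal_mul (by norm_num), ENNReal.ofReal_inv_of_pos (by norm_num)]
    simp
  simp_rw [hsplit]
  rw [lintegral_const_mul _ (by fun_prop), lintegral_prod _ (by fun_prop),
    lintegral_lintegral_swap (Measurable.aemeasurable (by fun_prop))]
  have : ∀ z : V × V, ∫⁻ x, F (x - z.1) + F (x - z.2) = 2 * ∫⁻ x, F x := fun z => by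
    rw [lintegral_add_left (by fun_prop), lintegral_sub_right_eq_self F,
      lintegral_sub_right_eq_self F, two_mul]
  simp_rw [this]
  rw [lintegral_const, measure_univ, mul_one, ← mul_assoc, ENNReal.inv_mul_cancel (by simp)
    (by simp), one_mul]

theorem lintegral_average_rpow_le_midpoint (hu : IsBddIntegrable u) {q : ℝ} (hq : 1 ≤ q) :
    ∫⁻ x, ‖average ν u x‖ₑ ^ q ≤
      ∫⁻ w : V × V × V, ENNReal.ofReal
        (‖(1 / 2 : ℝ) • (u (w.1 - w.2.1) + u (w.1 - w.2.2))‖ ^ q)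
        ∂(volume : Measure V).prod (ν.prod ν) := by
  have hm := hu.measurable
  obtain ⟨C, hC⟩ := hu.bounded
  rw [lintegral_prod _ (Measurable.aemeasurable (by fun_prop))]
  refine lintegral_mono fun x => ?_
  have hi : Integrable (fun z => u (x - z)) ν :=
    Integrable.of_bound (Measurable.aestronglyMeasurable (by fun_prop)) C
      (Filter.Eventually.of_forall fun z => hC _)
  have : average ν u x = ∫ z, (1 / 2 : ℝ) • (u (x - z.1) + u (x - z.2)) ∂ν.prod ν := by
    rw [integral_smul, integral_add (hi.comp_fst ν) (hi.comp_snd ν),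
      integral_fun_fst (fun z => u (x - z)), integral_fun_snd (fun z => u (x - z))]
    simp only [probReal_univ, one_smul]
    rw [← two_smul ℝ, smul_smul]
    norm_num [average]
  rw [this]
  refine (enorm_integral_rpow_le (Measurable.aestronglyMeasurable (by fun_prop)) hq).trans_eq ?_
  congr 1 with z
  rw [enorm_rpow_eq_ofReal _ (by linarith)]

/-- Averaging twice moves a function in `L^q` by an amount controlled by the loss of norm. -/
theorem lintegral_sub_average_average_le (hν : MeasurePreserving Neg.neg ν ν)
    (hu : IsBddIntegrable u) {q : ℝ} (hq1 : 1 < q) (hq2 : q ≤ 2) :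
    ∫⁻ x, ‖u x - average ν (average ν u) x‖ₑ ^ q ≤
      ENNReal.ofReal ((16 / (q * (q - 1))) ^ (q / 2)) *
        (((∫⁻ x, ‖u x‖ₑ ^ q) - ∫⁻ x, ‖average ν u x‖ₑ ^ q) ^ (q / 2) *
          (∫⁻ x, ‖u x‖ₑ ^ q) ^ (1 - q / 2)) := by
  have hm := hu.measurable
  have hq0 : 0 ≤ q := by linarith
  set P := (volume : Measure V).prod (ν.prod ν) with hP
  set mid : V × V × V → ℝ := fun w =>
    ‖(1 / 2 : ℝ) • (u (w.1 - w.2.1) + u (w.1 - w.2.2))‖ ^ q with hmid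
  set av : V × V × V → ℝ := fun w => (‖u (w.1 - w.2.1)‖ ^ q + ‖u (w.1 - w.2.2)‖ ^ q) / 2 with hav
  have hmidm : Measurable mid := by fun_prop
  have havm : Measurable av := by fun_prop
  have hle : ∀ w, mid w ≤ av w := fun w => (norm_sub_rpow_le_gap hq1 hq2 _ _).1
  have hav_int : ∫⁻ w, ENNReal.ofReal (av w) ∂P = ∫⁻ x, ‖u x‖ₑ ^ q := by
    rw [hav, hP, lintegral_prod_comp_fst_add hu]
    simp_rw [enorm_rpow_eq_ofReal _ hq0]
  have hgap_int : ∫⁻ w, ENNReal.ofReal (av w - mid w) ∂P ≤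
      (∫⁻ x, ‖u x‖ₑ ^ q) - ∫⁻ x, ‖average ν u x‖ₑ ^ q := by
    have hne : ∫⁻ x, ‖average ν u x‖ₑ ^ q ≠ ⊤ := hu.average.lintegral_rpow_ne_top hq1.le
    refine ENNReal.le_sub_of_add_le_right hne ?_
    calc _ ≤ (∫⁻ w, ENNReal.ofReal (av w - mid w) ∂P) + ∫⁻ w, ENNReal.ofReal (mid w) ∂P := by
          gcongr
          exact lintegral_average_rpow_le_midpoint hu hq1.le
      _ = ∫⁻ w, ENNReal.ofReal (av w) ∂P := by
          rw [← lintegral_add_left (by fun_prop)]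
          congr 1 with w
          rw [← ENNReal.ofReal_add (sub_nonneg.2 (hle w)) (by positivity), sub_add_cancel]
      _ = _ := hav_int
  calc ∫⁻ x, ‖u x - average ν (average ν u) x‖ₑ ^ q
      ≤ ∫⁻ x, (∫⁻ z, ‖u (x - z.1) - u (x - z.2)‖ₑ ^ q ∂ν.prod ν) :=
        lintegral_sub_average_average_rpow_le hν hu hq1.le
    _ = ∫⁻ w : V × V × V, ‖u (w.1 - w.2.1) - u (w.1 - w.2.2)‖ₑ ^ q ∂P := by
        rw [hP, lintegral_prod _ (Measurable.aemeasurable (by fun_prop))]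
    _ ≤ ∫⁻ w, ENNReal.ofReal ((16 / (q * (q - 1))) ^ (q / 2)) *
          (ENNReal.ofReal (av w - mid w) ^ (q / 2) * ENNReal.ofReal (av w) ^ (1 - q / 2)) ∂P := by
        refine lintegral_mono fun w => ?_
        have h := (norm_sub_rpow_le_gap hq1 hq2 (u (w.1 - w.2.1)) (u (w.1 - w.2.2))).2
        have h0 : 0 ≤ av w - mid w := sub_nonneg.2 (hle w)
        rw [enorm_rpow_eq_ofReal _ hq0, ENNReal.ofReal_rpow_of_nonneg h0 (by linarith),
          ENNReal.ofReal_rpow_of_nonneg (by positivity) (by linarith),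
          ← ENNReal.ofReal_mul (by positivity), ← ENNReal.ofReal_mul (by
            have : 0 < q * (q - 1) := by nlinarith
            positivity)]
        exact ENNReal.ofReal_le_ofReal h
    _ ≤ _ := by
        rw [lintegral_const_mul _ (by fun_prop)]
        gcongr
        refine (ENNReal.lintegral_mul_norm_pow_le (by fun_prop) (by fun_prop) (by linarith)
          (by linarith) (by ring)).trans ?_
        rw [hav_int]
        gcongr

end Average

/-- The symbol `2π‖ξ‖` of `|∇|`. -/
def rad (ξ : V) : ℝ := 2 * Real.pi * ‖ξ‖

theorem rad_nonneg (ξ : V) : 0 ≤ rad ξ := by unfold rad; positivity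

theorem continuous_rad : Continuous (rad : V → ℝ) := by unfold rad; fun_prop

theorem measurable_rad : Measurable (rad : V → ℝ) := continuous_rad.measurable

theorem rad_neg (ξ : V) : rad (-ξ) = rad ξ := by simp [rad]

theorem integrable_cexp_neg_mul_rad_sq {y : ℂ} (hy : 0 < y.re) :
    Integrable fun ξ : V => Complex.exp (-y * (rad ξ : ℂ) ^ 2) := by
  have hb : 0 < (y * (4 * Real.pi ^ 2 : ℝ)).re := by
    rw [Complex.re_mul_ofReal]; positivity
  have h := GaussianFourier.integrable_cexp_neg_mul_sq_norm_add hb 0 (0 : V)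
  refine h.congr (Filter.Eventually.of_forall fun ξ => ?_)
  simp only [rad]
  congr 1
  push_cast
  ring

theorem fourierInv_cexp_neg_mul_rad_sq {y : ℂ} (hy : 0 < y.re) (x : V) :
    𝓕⁻ (fun ξ : V => Complex.exp (-y * (rad ξ : ℂ) ^ 2)) x =
      (1 / (4 * Real.pi * y)) ^ (Module.finrank ℝ V / 2 : ℂ) *
        Complex.exp (-(‖x‖ : ℂ) ^ 2 / (4 * y)) := by
  have hb : 0 < (y * (4 * Real.pi ^ 2 : ℝ)).re := by
    rw [Complex.re_mul_ofReal]; positivity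
  have hy0 : y ≠ 0 := fun h => by simp [h] at hy
  have hpi : (Real.pi : ℂ) ≠ 0 := by exact_mod_cast Real.pi_ne_zero
  have h := fourier_gaussian_innerProductSpace hb (-x)
  rw [Real.fourierInv_eq_fourier_neg]
  convert h using 2
  · ext ξ
    simp only [rad]
    congr 1
    push_cast
    ring
  · congr 1
    push_cast
    field_simp
  · congr 1
    rw [norm_neg]
    push_cast
    field_simp

theorem fourier_fourierInv_eq_of_integrable {f : V → ℂ} (hc : Continuous f) (hf : Integrable f)
    (hf' : Integrable (𝓕⁻ f)) : 𝓕 (𝓕⁻ f) = f := by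
  refine hc.fourier_fourierInv_eq hf ?_
  rw [Real.fourierInv_eq_fourier_comp_neg] at hf'
  have := hf'.comp_neg
  convert this using 1
  ext ξ
  rw [← Real.fourierInv_eq_fourier_comp_neg, Real.fourierInv_eq_fourier_neg, neg_neg]

/-- The heat kernel. -/
def gaussKer (τ : ℝ) (x : V) : ℝ :=
  (1 / (4 * Real.pi * τ)) ^ (Module.finrank ℝ V / 2 : ℝ) * Real.exp (-‖x‖ ^ 2 / (4 * τ))

theorem gaussKer_nonneg {τ : ℝ} (hτ : 0 < τ) (x : V) : 0 ≤ gaussKer τ x := by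
  unfold gaussKer; positivity

theorem continuous_gaussKer (τ : ℝ) : Continuous (gaussKer τ : V → ℝ) := by
  unfold gaussKer; fun_prop

theorem fourierInv_cexp_neg_ofReal_mul_rad_sq {τ : ℝ} (hτ : 0 < τ) (x : V) :
    𝓕⁻ (fun ξ : V => Complex.exp (-τ * (rad ξ : ℂ) ^ 2)) x = gaussKer τ x := by
  rw [fourierInv_cexp_neg_mul_rad_sq (by simpa using hτ), gaussKer, Complex.ofReal_mul,
    Complex.ofReal_cpow (by positivity)]
  push_cast
  rfl

theorem integrable_gaussKer {τ : ℝ} (hτ : 0 < τ) : Integrable (gaussKer τ : V → ℝ) := by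
  have hb : 0 < ((1 / (4 * τ) : ℝ) : ℂ).re := by rw [Complex.ofReal_re]; positivity
  have h := (GaussianFourier.integrable_cexp_neg_mul_sq_norm_add hb 0 (0 : V)).norm.const_mul
    ((1 / (4 * Real.pi * τ)) ^ (Module.finrank ℝ V / 2 : ℝ))
  refine h.congr (Filter.Eventually.of_forall fun x => ?_)
  simp only [gaussKer, Complex.norm_exp]
  congr 2
  rw [zero_mul, add_zero, ← Complex.ofReal_neg, ← Complex.ofReal_pow, ← Complex.ofReal_mul,
    Complex.ofReal_re]
  field_simp

theorem integral_gaussKer {τ : ℝ} (hτ : 0 < τ) : ∫ x : V, gaussKer τ x = 1 := by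
  have h := GaussianFourier.integral_rexp_neg_mul_sq_norm (V := V) (b := 1 / (4 * τ))
    (by positivity)
  have : ∀ x : V, gaussKer τ x = (1 / (4 * Real.pi * τ)) ^ (Module.finrank ℝ V / 2 : ℝ) *
      Real.exp (-(1 / (4 * τ)) * ‖x‖ ^ 2) := fun x => by
    rw [gaussKer]
    congr 2
    field_simp
  simp_rw [this]
  rw [integral_const_mul, h, ← Real.mul_rpow (by positivity) (by positivity)]
  convert Real.one_rpow _ using 2
  field_simp

/-- The Gaussian probability measure whose convolution operator is `exp (τ Δ)`. -/
def gaussMeasure (τ : ℝ) : Measure V :=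
  (volume : Measure V).withDensity fun x => ENNReal.ofReal (gaussKer τ x)

theorem isProbabilityMeasure_gaussMeasure {τ : ℝ} (hτ : 0 < τ) :
    IsProbabilityMeasure (gaussMeasure τ : Measure V) := by
  constructor
  rw [gaussMeasure, withDensity_apply _ MeasurableSet.univ, Measure.restrict_univ,
    ← ofReal_integral_eq_lintegral_ofReal (integrable_gaussKer hτ)
    (Filter.Eventually.of_forall (gaussKer_nonneg hτ)), integral_gaussKer hτ, ENNReal.ofReal_one]

theorem measurePreserving_neg_gaussMeasure (τ : ℝ) :
    MeasurePreserving Neg.neg (gaussMeasure τ : Measure V) (gaussMeasure τ) := by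
  refine ⟨measurable_neg, Measure.ext fun E hE => ?_⟩
  rw [Measure.map_apply measurable_neg hE, gaussMeasure, withDensity_apply _ hE,
    withDensity_apply _ (measurable_neg hE),
    ← (Measure.measurePreserving_neg (volume : Measure V)).setLIntegral_comp_preimage hE
      (continuous_gaussKer τ).measurable.ennreal_ofReal]
  simp [gaussKer]

/-- The heat semigroup `exp (τ Δ)`. -/
def heat (τ : ℝ) (f : V → ℂ) : V → ℂ :=
  𝓕⁻ fun ξ => Complex.exp (-τ * (rad ξ : ℂ) ^ 2) * 𝓕 f ξ

theorem heat_eq_average {τ : ℝ} (hτ : 0 < τ) {f : V → ℂ} (hf : Integrable f) :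
    heat τ f = average (gaussMeasure τ) f := by
  ext x
  rw [heat, fourierInv_mul_fourier_eq_integral
    (integrable_cexp_neg_mul_rad_sq (by simpa using hτ)) hf, average, gaussMeasure,
    integral_withDensity_eq_integral_toReal_smul
      (continuous_gaussKer τ).measurable.ennreal_ofReal (by simp),
    ← integral_sub_left_eq_self _ _ x]
  congr 1 with z
  rw [fourierInv_cexp_neg_ofReal_mul_rad_sq hτ, sub_sub_cancel,
    ENNReal.toReal_ofReal (gaussKer_nonneg hτ _), Complex.real_smul]

theorem integrable_heat_symbol {τ : ℝ} (hτ : 0 < τ) {f : V → ℂ} (hf : Integrable f) :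
    Integrable fun ξ : V => Complex.exp (-τ * (rad ξ : ℂ) ^ 2) * 𝓕 f ξ :=
  integrable_mul_fourier (integrable_cexp_neg_mul_rad_sq (by simpa using hτ)) hf

theorem IsBddIntegrable.heat {f : V → ℂ} (hf : IsBddIntegrable f) {τ : ℝ} (hτ : 0 < τ) :
    IsBddIntegrable (heat τ f) := by
  have := isProbabilityMeasure_gaussMeasure (V := V) hτ
  rw [heat_eq_average hτ hf.integrable]
  exact hf.average

theorem fourier_heat {f : V → ℂ} (hf : IsBddIntegrable f) {τ : ℝ} (hτ : 0 < τ) :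
    𝓕 (heat τ f) = fun ξ => Complex.exp (-τ * (rad ξ : ℂ) ^ 2) * 𝓕 f ξ := by
  refine fourier_fourierInv_eq_of_integrable ?_ (integrable_heat_symbol hτ hf.integrable)
    (hf.heat hτ).integrable
  have h1 := continuous_fourier hf.integrable
  have h2 := continuous_rad (V := V)
  fun_prop

theorem heat_heat {f : V → ℂ} (hf : IsBddIntegrable f) {σ τ : ℝ} (hτ : 0 < τ) :
    heat σ (heat τ f) = heat (σ + τ) f := by
  rw [heat, fourier_heat hf hτ, heat]
  congr 1 with ξ
  rw [← mul_assoc, ← Complex.exp_add]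
  congr 2
  push_cast
  ring

theorem lintegral_heat_rpow_le {f : V → ℂ} (hf : IsBddIntegrable f) {τ : ℝ} (hτ : 0 < τ) {q : ℝ}
    (hq : 1 ≤ q) : ∫⁻ x, ‖heat τ f x‖ₑ ^ q ≤ ∫⁻ x, ‖f x‖ₑ ^ q := by
  have := isProbabilityMeasure_gaussMeasure (V := V) hτ
  rw [heat_eq_average hτ hf.integrable]
  exact lintegral_average_rpow_le hf hq

/-- The loss of `L^q` norm along the heat flow controls the increments of the flow. -/
theorem lintegral_heat_sub_heat_le {f : V → ℂ} (hf : IsBddIntegrable f) {q : ℝ} (hq1 : 1 < q)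
    (hq2 : q ≤ 2) {σ τ : ℝ} (hσ : 0 < σ) (hστ : σ < τ) :
    (∫⁻ x, ‖heat σ f x - heat τ f x‖ₑ ^ q) ^ (2 / q) ≤
      ENNReal.ofReal (16 / (q * (q - 1))) *
        (((∫⁻ x, ‖heat σ f x‖ₑ ^ q) - ∫⁻ x, ‖heat τ f x‖ₑ ^ q) *
          (∫⁻ x, ‖f x‖ₑ ^ q) ^ (2 / q - 1)) := by
  have hq0 : 0 < q := by linarith
  have hK : 0 < 16 / (q * (q - 1)) := div_pos (by norm_num) (mul_pos hq0 (by linarith))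
  set ρ := (τ - σ) / 2 with hρ
  have hρ0 : 0 < ρ := by rw [hρ]; linarith
  have := isProbabilityMeasure_gaussMeasure (V := V) hρ0
  have hu := hf.heat hσ
  have h := lintegral_sub_average_average_le (measurePreserving_neg_gaussMeasure ρ) hu hq1 hq2
  rw [← heat_eq_average hρ0 hu.integrable, ← heat_eq_average hρ0 (hu.heat hρ0).integrable,
    heat_heat hu hρ0, heat_heat hf hσ, show ρ + ρ + σ = τ by rw [hρ]; ring] at h
  have hloss : ∫⁻ x, ‖heat τ f x‖ₑ ^ q ≤ ∫⁻ x, ‖heat ρ (heat σ f) x‖ₑ ^ q := by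
    rw [show τ = ρ + (ρ + σ) by rw [hρ]; ring, ← heat_heat hf (by linarith), ← heat_heat hf hσ]
    exact lintegral_heat_rpow_le (hu.heat hρ0) hρ0 hq1.le
  calc _ ≤ (ENNReal.ofReal ((16 / (q * (q - 1))) ^ (q / 2)) *
        (((∫⁻ x, ‖heat σ f x‖ₑ ^ q) - ∫⁻ x, ‖heat τ f x‖ₑ ^ q) ^ (q / 2) *
          (∫⁻ x, ‖f x‖ₑ ^ q) ^ (1 - q / 2))) ^ (2 / q) := by
        gcongr
        refine h.trans ?_
        gcongr ENNReal.ofReal _ * (?_ * ?_)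
        · exact ENNReal.rpow_le_rpow (tsub_le_tsub_left hloss _) (by positivity)
        · exact ENNReal.rpow_le_rpow (lintegral_heat_rpow_le hf hσ hq1.le) (by linarith)
    _ = _ := by
        rw [ENNReal.mul_rpow_of_nonneg _ _ (by positivity),
          ENNReal.mul_rpow_of_nonneg _ _ (by positivity),
          ENNReal.ofReal_rpow_of_nonneg (by positivity) (by positivity),
          ← Real.rpow_mul hK.le, ← ENNReal.rpow_mul, ← ENNReal.rpow_mul,
          show q / 2 * (2 / q) = 1 by field_simp, Real.rpow_one, ENNReal.rpow_one,
          show (1 - q / 2) * (2 / q) = 2 / q - 1 by field_simp]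

/-- The difference of two dyadic times of the heat flow, a Littlewood–Paley piece of `g`. -/
def heatPiece (s : ℝ) (g : V → ℂ) (x : V) : ℂ :=
  heat (Real.exp (2 * s)) g x - heat (Real.exp (2 * (s + 1))) g x

/-- The radial symbol of `heatPiece 0`. -/
def pieceSymbol (ρ : ℝ) : ℝ := Real.exp (-ρ ^ 2) - Real.exp (-(Real.exp 1 * ρ) ^ 2)

theorem IsBddIntegrable.heatPiece {g : V → ℂ} (hg : IsBddIntegrable g) (s : ℝ) :
    IsBddIntegrable (heatPiece s g) := by
  have h1 := hg.heat (Real.exp_pos (2 * s))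
  have h2 := hg.heat (Real.exp_pos (2 * (s + 1)))
  refine ⟨h1.measurable.sub h2.measurable, h1.integrable.sub h2.integrable, ?_⟩
  obtain ⟨C₁, hC₁⟩ := h1.bounded
  obtain ⟨C₂, hC₂⟩ := h2.bounded
  exact ⟨C₁ + C₂, fun x => (norm_sub_le _ _).trans (add_le_add (hC₁ x) (hC₂ x))⟩

theorem fourier_heatPiece {g : V → ℂ} (hg : IsBddIntegrable g) (s : ℝ) (ξ : V) :
    𝓕 (heatPiece s g) ξ = pieceSymbol (Real.exp s * rad ξ) * 𝓕 g ξ := by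
  have h1 := hg.heat (Real.exp_pos (2 * s))
  have h2 := hg.heat (Real.exp_pos (2 * (s + 1)))
  have hsub : 𝓕 (heatPiece s g) ξ =
      𝓕 (heat (Real.exp (2 * s)) g) ξ - 𝓕 (heat (Real.exp (2 * (s + 1))) g) ξ := by
    simp only [Real.fourier_eq, heatPiece, smul_sub]
    exact integral_sub ((Real.fourierIntegral_convergent_iff ξ).2 h1.integrable)
      ((Real.fourierIntegral_convergent_iff ξ).2 h2.integrable)
  rw [hsub, fourier_heat hg (Real.exp_pos _), fourier_heat hg (Real.exp_pos _)]
  simp only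
  rw [← sub_mul, pieceSymbol]
  push_cast
  congr 3
  · rw [show (2 : ℂ) * s = s + s by ring, Complex.exp_add]
    ring
  · rw [show (2 : ℂ) * (s + 1) = (1 + s) + (1 + s) by ring, Complex.exp_add, Complex.exp_add]
    ring

theorem measurable_heatPiece (g : V → ℂ) (hg : Integrable g) :
    Measurable fun z : ℝ × V => heatPiece z.1 g z.2 := by
  have hheat : Measurable fun z : ℝ × V => heat z.1 g z.2 := by
    have hc := continuous_fourier hg
    have hr := continuous_rad (V := V)
    simp only [heat, Real.fourierInv_eq']
    refine (StronglyMeasurable.integral_prod_right' (f := fun w : (ℝ × V) × V =>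
      Complex.exp (((2 * Real.pi * ⟪w.2, w.1.2⟫ : ℝ) : ℂ) * Complex.I) •
        (Complex.exp (-(w.1.1 : ℂ) * (rad w.2 : ℂ) ^ 2) * 𝓕 g w.2)) ?_).measurable
    exact Continuous.stronglyMeasurable (by fun_prop)
  have hm₀ : Measurable fun z : ℝ × V => (Real.exp (2 * z.1), z.2) := by fun_prop
  have hm₁ : Measurable fun z : ℝ × V => (Real.exp (2 * (z.1 + 1)), z.2) := by fun_prop
  exact (hheat.comp hm₀).sub (hheat.comp hm₁)

theorem measurable_lintegral_heatPiece {g : V → ℂ} (hg : Integrable g) (q r : ℝ) :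
    Measurable fun s : ℝ => (∫⁻ x, ‖heatPiece s g x‖ₑ ^ q) ^ r := by
  have := measurable_heatPiece g hg
  exact (Measurable.lintegral_prod_right'
    (f := fun z : ℝ × V => ‖heatPiece z.1 g z.2‖ₑ ^ q) (by fun_prop)).pow_const r

theorem sum_tsub_succ_le {G : ℕ → ℝ≥0∞} (hG : Antitone G) (N : ℕ) :
    ∑ i ∈ Finset.range N, (G i - G (i + 1)) ≤ G 0 := by
  suffices h : ∑ i ∈ Finset.range N, (G i - G (i + 1)) + G N ≤ G 0 from le_self_add.trans h
  induction N with
  | zero => simp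
  | succ N ih =>
    rwa [Finset.sum_range_succ, add_assoc, tsub_add_cancel_of_le (hG N.le_succ)]

theorem setLIntegral_Ioc_add_nat_le {h : ℝ → ℝ≥0∞} (hh : Measurable h) (a : ℝ) (N : ℕ) :
    ∫⁻ s in Ioc a (a + N), h s ≤
      ∫⁻ s in Ioc a (a + 1), ∑ i ∈ Finset.range N, h (s + i) := by
  induction N with
  | zero => simp
  | succ N ih =>
    have hunion : Ioc a (a + (N + 1 : ℕ)) = Ioc a (a + N) ∪ Ioc (a + N) (a + 1 + N) := by
      rw [Ioc_union_Ioc_eq_Ioc (by simp) (by linarith)]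
      push_cast
      congr 1
      ring
    simp_rw [Finset.sum_range_succ]
    rw [lintegral_add_right _ (by fun_prop), hunion]
    refine (lintegral_union_le _ _ _).trans (add_le_add ih (le_of_eq ?_))
    rw [← (measurePreserving_add_right (volume : Measure ℝ) (N : ℝ)).setLIntegral_comp_preimage
      measurableSet_Ioc hh]
    simp

/-- Square function estimate for the heat flow in `L^q`, `1 < q ≤ 2`. -/
theorem setLIntegral_heatPiece_le {g : V → ℂ} (hg : IsBddIntegrable g) {q : ℝ} (hq1 : 1 < q)
    (hq2 : q ≤ 2) (a : ℝ) (N : ℕ) :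
    ∫⁻ s in Ioc a (a + N), (∫⁻ x, ‖heatPiece s g x‖ₑ ^ q) ^ (2 / q) ≤
      ENNReal.ofReal (16 / (q * (q - 1))) * (∫⁻ x, ‖g x‖ₑ ^ q) ^ (2 / q) := by
  have hq0 : 0 < q := by linarith
  have hq2' : 0 ≤ 2 / q - 1 := by rw [sub_nonneg, le_div_iff₀ hq0]; linarith
  have hanti : ∀ s : ℝ, Antitone fun i : ℕ =>
      ∫⁻ x, ‖heat (Real.exp (2 * (s + i))) g x‖ₑ ^ q := fun s => antitone_nat_of_succ_le fun i => by
    have hlt : Real.exp (2 * (s + i)) < Real.exp (2 * (s + (i + 1 : ℕ))) := by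
      apply Real.exp_lt_exp.2
      push_cast
      linarith
    rw [← sub_add_cancel (Real.exp (2 * (s + (i + 1 : ℕ)))) (Real.exp (2 * (s + i))),
      ← heat_heat hg (Real.exp_pos _)]
    exact lintegral_heat_rpow_le (hg.heat (Real.exp_pos _)) (sub_pos.2 hlt) hq1.le
  refine (setLIntegral_Ioc_add_nat_le (measurable_lintegral_heatPiece hg.integrable q _) a N).trans
    ?_
  refine (lintegral_mono (g := fun _ => ENNReal.ofReal (16 / (q * (q - 1))) *
    (∫⁻ x, ‖g x‖ₑ ^ q) ^ (2 / q)) fun s => ?_).trans (by simp)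
  set G : ℕ → ℝ≥0∞ := fun i => ∫⁻ x, ‖heat (Real.exp (2 * (s + i))) g x‖ₑ ^ q with hG
  calc ∑ i ∈ Finset.range N, (∫⁻ x, ‖heatPiece (s + i) g x‖ₑ ^ q) ^ (2 / q)
      ≤ ∑ i ∈ Finset.range N, ENNReal.ofReal (16 / (q * (q - 1))) *
          ((G i - G (i + 1)) * (∫⁻ x, ‖g x‖ₑ ^ q) ^ (2 / q - 1)) := by
        refine Finset.sum_le_sum fun i _ => ?_
        have := lintegral_heat_sub_heat_le hg hq1 hq2 (Real.exp_pos (2 * (s + i)))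
          (τ := Real.exp (2 * (s + i + 1))) (Real.exp_lt_exp.2 (by linarith))
        simpa [hG, heatPiece, add_assoc] using this
    _ = ENNReal.ofReal (16 / (q * (q - 1))) *
          ((∑ i ∈ Finset.range N, (G i - G (i + 1))) * (∫⁻ x, ‖g x‖ₑ ^ q) ^ (2 / q - 1)) := by
        rw [Finset.sum_mul, Finset.mul_sum]
    _ ≤ ENNReal.ofReal (16 / (q * (q - 1))) *
          ((∫⁻ x, ‖g x‖ₑ ^ q) ^ (1 : ℝ) * (∫⁻ x, ‖g x‖ₑ ^ q) ^ (2 / q - 1)) := by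
        gcongr
        rw [ENNReal.rpow_one]
        exact (sum_tsub_succ_le (hanti s) N).trans
          (lintegral_heat_rpow_le hg (Real.exp_pos _) hq1.le)
    _ = _ := by
        rw [← ENNReal.rpow_add_of_nonneg _ _ zero_le_one hq2', add_sub_cancel]

theorem integrable_exp_mul_exp_neg_exp {β c : ℝ} (hβ : 0 < β) (hc : 0 < c) :
    Integrable fun s : ℝ => Real.exp (β * s) * Real.exp (-c * Real.exp s) := by
  have h := Real.GammaIntegral_convergent hβ
  rw [← Real.range_exp, ← image_univ, integrableOn_image_iff_integrableOn_abs_deriv_smul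
    MeasurableSet.univ (fun x _ => (Real.hasDerivAt_exp x).hasDerivWithinAt)
    Real.exp_injective.injOn, integrableOn_univ] at h
  refine ((h.comp_add_right (Real.log c)).const_mul (Real.exp (-β * Real.log c))).congr
    (Filter.Eventually.of_forall fun s => ?_)
  simp only [smul_eq_mul, abs_of_pos (Real.exp_pos _)]
  rw [← Real.exp_mul, ← Real.exp_add, ← Real.exp_add, ← Real.exp_add, ← Real.exp_add]
  congr 1
  rw [Real.exp_add, Real.exp_log hc]
  ring

section Subordination

variable {y : ℂ}

theorem integrable_cosh_mul_cexp (hy : 0 < y.re) {c : ℝ} (hc : 0 < c) :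
    Integrable (fun u : ℝ => (Real.cosh u : ℂ) * Complex.exp (-y * ((c * Real.sinh u : ℝ) : ℂ) ^ 2))
    ∧ ∫ u : ℝ, (Real.cosh u : ℂ) * Complex.exp (-y * ((c * Real.sinh u : ℝ) : ℂ) ^ 2) =
      (1 / c) * (Real.pi / y) ^ (1 / 2 : ℂ) := by
  have hd : ∀ u ∈ (univ : Set ℝ),
      HasDerivWithinAt (fun u => c * Real.sinh u) (c * Real.cosh u) univ u := fun u _ =>
    ((Real.hasDerivAt_sinh u).const_mul c).hasDerivWithinAt
  have hinj : InjOn (fun u => c * Real.sinh u) univ := fun u _ v _ h =>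
    Real.sinh_injective (mul_left_cancel₀ hc.ne' h)
  have himg : (fun u => c * Real.sinh u) '' univ = univ := by
    rw [image_univ, range_eq_univ]
    intro w
    obtain ⟨u, hu⟩ := Real.sinh_surjective (w / c)
    exact ⟨u, by simp only [hu]; field_simp⟩
  have hpt : ∀ u, |c * Real.cosh u| • Complex.exp (-y * ((c * Real.sinh u : ℝ) : ℂ) ^ 2) =
      c * ((Real.cosh u : ℂ) * Complex.exp (-y * ((c * Real.sinh u : ℝ) : ℂ) ^ 2)) := fun u => by
    rw [abs_of_pos (mul_pos hc (Real.cosh_pos u)), Complex.real_smul, Complex.ofReal_mul, mul_assoc]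
  have hc' : (c : ℂ) ≠ 0 := by exact_mod_cast hc.ne'
  have hi := integrable_cexp_neg_mul_sq hy
  have hI := integral_gaussian_complex hy
  constructor
  · rw [← integrableOn_univ, ← himg,
      integrableOn_image_iff_integrableOn_abs_deriv_smul MeasurableSet.univ hd hinj,
      integrableOn_univ] at hi
    simp_rw [hpt] at hi
    exact (integrable_const_mul_iff hc'.isUnit _).1 hi
  · rw [← setIntegral_univ, ← himg,
      integral_image_eq_integral_abs_deriv_smul MeasurableSet.univ hd hinj, setIntegral_univ] at hI
    simp_rw [hpt] at hI
    rw [integral_const_mul] at hI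
    rw [← hI]
    field_simp

theorem integral_exp_neg_mul_cexp (hy : 0 < y.re) {c : ℝ} (hc : 0 < c) :
    ∫ u : ℝ, (Real.exp (-u) : ℂ) * Complex.exp (-y * ((c * Real.sinh u : ℝ) : ℂ) ^ 2) =
      (1 / c) * (Real.pi / y) ^ (1 / 2 : ℂ) := by
  obtain ⟨hi, hI⟩ := integrable_cosh_mul_cexp hy hc
  set g : ℝ → ℂ := fun u => (Real.sinh u : ℂ) *
    Complex.exp (-y * ((c * Real.sinh u : ℝ) : ℂ) ^ 2) with hg
  have hgi : Integrable g := by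
    refine hi.mono (Continuous.aestronglyMeasurable (by fun_prop))
      (Filter.Eventually.of_forall fun u => ?_)
    rw [hg, norm_mul, norm_mul, Complex.norm_real, Complex.norm_real, Real.norm_eq_abs,
      Real.norm_of_nonneg (Real.cosh_pos u).le]
    gcongr
    rw [abs_le]
    constructor
    · linarith [Real.cosh_add_sinh u, Real.exp_pos u]
    · linarith [Real.cosh_sub_sinh u, Real.exp_pos (-u)]
  have hodd : ∫ u, g u = 0 := by
    have h1 : ∫ u, g (-u) = ∫ u, g u := integral_neg_eq_self g volume
    have h2 : ∀ u, g (-u) = -g u := fun u => by simp [hg]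
    simp_rw [h2] at h1
    rw [integral_neg] at h1
    exact self_eq_neg.1 h1.symm
  rw [← hI, ← sub_zero (∫ u : ℝ, (Real.cosh u : ℂ) * _), ← hodd, ← integral_sub hi hgi]
  congr 1 with u
  rw [hg, ← sub_mul, ← Complex.ofReal_sub, Real.cosh_sub_sinh]

/-- The subordination formula expressing a Poisson kernel through Gaussians. -/
theorem integral_subordination (hy : 0 < y.re) {r : ℝ} (hr : 0 < r) :
    ∫ u : ℝ, (Real.exp (-u) : ℂ) * Complex.exp (-y * ((Real.exp (-(2 * u)) / 4 : ℝ) : ℂ)) *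
        Complex.exp (-(y * (Real.exp (2 * u) : ℝ)) * (r : ℂ) ^ 2) =
      (Real.pi / y) ^ (1 / 2 : ℂ) * Complex.exp (-y * r) := by
  set c := √(2 * r) with hc
  have hc0 : 0 < c := by positivity
  have hc2 : c ^ 2 = 2 * r := Real.sq_sqrt (by positivity)
  have hc' : (c : ℂ) ≠ 0 := by exact_mod_cast hc0.ne'
  have h := integral_exp_neg_mul_cexp hy hc0
  rw [← integral_add_right_eq_self _ (Real.log c)] at h
  have hpt : ∀ u : ℝ, (Real.exp (-(u + Real.log c)) : ℂ) *
      Complex.exp (-y * ((c * Real.sinh (u + Real.log c) : ℝ) : ℂ) ^ 2) =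
      (1 / c * Complex.exp (y * r)) * ((Real.exp (-u) : ℂ) *
        Complex.exp (-y * ((Real.exp (-(2 * u)) / 4 : ℝ) : ℂ)) *
        Complex.exp (-(y * (Real.exp (2 * u) : ℝ)) * (r : ℂ) ^ 2)) := fun u => by
    have h1 : Real.exp (-(u + Real.log c)) = 1 / c * Real.exp (-u) := by
      rw [neg_add, Real.exp_add, Real.exp_neg (Real.log c), Real.exp_log hc0]
      ring
    have h2 : (c * Real.sinh (u + Real.log c)) ^ 2 =
        -r + Real.exp (-(2 * u)) / 4 + Real.exp (2 * u) * r ^ 2 := by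
      rw [Real.sinh_eq, h1, Real.exp_add, Real.exp_log hc0]
      have e1 : Real.exp (2 * u) = Real.exp u ^ 2 := by rw [two_mul, Real.exp_add, sq]
      have e2 : Real.exp (-(2 * u)) = Real.exp (-u) ^ 2 := by
        rw [two_mul, neg_add, Real.exp_add, sq]
      have e3 : Real.exp u * Real.exp (-u) = 1 := by rw [← Real.exp_add]; simp
      have hr' : r = c ^ 2 / 2 := by linarith
      rw [e1, e2, hr']
      field_simp
      linear_combination (-8 * c ^ 2) * e3
    rw [← Complex.ofReal_pow, h2, h1]
    have h3 : -y * ((-r + Real.exp (-(2 * u)) / 4 + Real.exp (2 * u) * r ^ 2 : ℝ) : ℂ) =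
        y * r + -y * ((Real.exp (-(2 * u)) / 4 : ℝ) : ℂ) +
          -(y * (Real.exp (2 * u) : ℝ)) * (r : ℂ) ^ 2 := by
      push_cast
      ring
    rw [h3, Complex.exp_add, Complex.exp_add]
    push_cast
    ring
  simp_rw [hpt] at h
  rw [integral_const_mul, mul_assoc] at h
  have h' := mul_left_cancel₀ (one_div_ne_zero hc') h
  have he : Complex.exp (-y * r) = (Complex.exp (y * r))⁻¹ := by rw [neg_mul, Complex.exp_neg]
  rw [← h', he, mul_right_comm, mul_inv_cancel₀ (Complex.exp_ne_zero _), one_mul]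

end Subordination

section KernelBound

variable {y : ℂ}

/-- The integrand of the subordination formula. -/
def subIntegrand (y : ℂ) (ξ : V) (u : ℝ) : ℂ :=
  (Real.exp (-u) : ℂ) * Complex.exp (-y * ((Real.exp (-(2 * u)) / 4 : ℝ) : ℂ)) *
    Complex.exp (-(y * (Real.exp (2 * u) : ℝ)) * (rad ξ : ℂ) ^ 2)

theorem continuous_subIntegrand (y : ℂ) :
    Continuous fun z : V × ℝ => subIntegrand y z.1 z.2 := by
  have := continuous_rad (V := V)
  unfold subIntegrand
  fun_prop

theorem norm_subIntegrand (y : ℂ) (ξ : V) (u : ℝ) :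
    ‖subIntegrand y ξ u‖ = Real.exp (-u) * Real.exp (-(y.re / 4) * Real.exp (-(2 * u))) *
      Real.exp (-y.re * rad (Real.exp u • ξ) ^ 2) := by
  have hr : rad (Real.exp u • ξ) = Real.exp u * rad ξ := by
    rw [rad, rad, norm_smul, Real.norm_of_nonneg (Real.exp_pos u).le]
    ring
  rw [subIntegrand, norm_mul, norm_mul, Complex.norm_exp, Complex.norm_exp, Complex.norm_real,
    Real.norm_of_nonneg (Real.exp_pos _).le, Complex.re_mul_ofReal, ← Complex.ofReal_pow,
    Complex.re_mul_ofReal, Complex.neg_re, Complex.neg_re, Complex.re_mul_ofReal, hr, two_mul,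
    Real.exp_add u u]
  congr 1
  · congr 2; ring
  · congr 1; ring

theorem exp_neg_natCast_mul (n : ℕ) (u : ℝ) :
    |(Real.exp u ^ n)⁻¹| = Real.exp (-(n * u)) := by
  rw [abs_of_nonneg (by positivity), ← Real.exp_nat_mul, Real.exp_neg]

theorem integral_norm_subIntegrand (y : ℂ) (u : ℝ) :
    ∫ ξ : V, ‖subIntegrand y ξ u‖ =
      (∫ ξ : V, Real.exp (-y.re * rad ξ ^ 2)) *
        (Real.exp (-((Module.finrank ℝ V + 1) * u)) *
          Real.exp (-(y.re / 4) * Real.exp (-(2 * u)))) := by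
  simp_rw [norm_subIntegrand]
  rw [integral_const_mul,
    Measure.integral_comp_smul volume (fun ξ : V => Real.exp (-y.re * rad ξ ^ 2)),
    exp_neg_natCast_mul, smul_eq_mul, add_mul, one_mul, neg_add, Real.exp_add]
  ring

theorem integrable_exp_neg_mul_exp_neg {k c : ℝ} (hk : 0 < k) (hc : 0 < c) :
    Integrable fun u : ℝ => Real.exp (-(k * u)) * Real.exp (-c * Real.exp (-(2 * u))) := by
  have h := (integrable_exp_mul_exp_neg_exp (half_pos hk) hc).comp_mul_left' (R := -2)
    (by norm_num)
  refine h.congr (Filter.Eventually.of_forall fun u => ?_)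
  simp only
  congr 2
  · ring
  · congr 2; ring

theorem integral_exp_neg_mul_exp_neg {k ε : ℝ} (hε : 0 < ε) :
    ∫ u : ℝ, Real.exp (-(k * u)) * Real.exp (-(ε / 4) * Real.exp (-(2 * u))) =
      ε ^ (-(k / 2)) *
        ∫ u : ℝ, Real.exp (-(k * u)) * Real.exp (-(1 / 4) * Real.exp (-(2 * u))) := by
  rw [← integral_add_right_eq_self _ (Real.log ε / 2), ← integral_const_mul]
  congr 1 with u
  have h1 : Real.exp (-(k * (u + Real.log ε / 2))) = ε ^ (-(k / 2)) * Real.exp (-(k * u)) := by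
    rw [Real.rpow_def_of_pos hε, ← Real.exp_add]
    congr 1; ring
  have h2 : Real.exp (-(2 * (u + Real.log ε / 2))) = ε⁻¹ * Real.exp (-(2 * u)) := by
    rw [← Real.exp_log (inv_pos.2 hε), ← Real.exp_add, Real.log_inv]
    congr 1; ring
  rw [h1, h2, mul_assoc]
  congr 3
  field_simp

theorem integrable_subIntegrand (hy : 0 < y.re) :
    Integrable (fun z : V × ℝ => subIntegrand y z.1 z.2) (volume.prod volume) := by
  rw [integrable_prod_iff' (continuous_subIntegrand y).aestronglyMeasurable]
  constructor
  · refine Filter.Eventually.of_forall fun u => ?_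
    have hy' : 0 < (y * (Real.exp (2 * u) : ℝ)).re := by
      rw [Complex.re_mul_ofReal]; positivity
    simp only [subIntegrand]
    exact (integrable_cexp_neg_mul_rad_sq hy').const_mul _
  · simp_rw [integral_norm_subIntegrand]
    exact (integrable_exp_neg_mul_exp_neg (by positivity) (by positivity)).const_mul _

variable [Nontrivial V]

theorem integral_subIntegrand_ae_eq (hy : 0 < y.re) :
    (fun ξ : V => ∫ u, subIntegrand y ξ u) =ᵐ[volume]
      fun ξ => (Real.pi / y) ^ (1 / 2 : ℂ) * Complex.exp (-y * rad ξ) := by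
  have h0 : ∀ᵐ ξ : V, ξ ≠ 0 := by
    simp [ae_iff]
  filter_upwards [h0] with ξ hξ
  have hr : 0 < rad ξ := by
    have := norm_pos_iff.2 hξ
    unfold rad; positivity
  exact integral_subordination hy hr

theorem cpow_half_ne_zero (hy : 0 < y.re) : (Real.pi / y : ℂ) ^ (1 / 2 : ℂ) ≠ 0 := by
  have hy0 : y ≠ 0 := fun h => by simp [h] at hy
  have hpi : (Real.pi : ℂ) ≠ 0 := by exact_mod_cast Real.pi_ne_zero
  rw [Complex.cpow_ne_zero_iff]
  exact Or.inl (div_ne_zero hpi hy0)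

theorem integrable_cexp_neg_mul_rad (hy : 0 < y.re) :
    Integrable fun ξ : V => Complex.exp (-y * rad ξ) := by
  have h := (integrable_subIntegrand (V := V) hy).integral_prod_left.congr
    (integral_subIntegrand_ae_eq hy)
  exact (integrable_const_mul_iff (cpow_half_ne_zero hy).isUnit _).1 h

theorem fourierInv_cexp_neg_mul_rad (hy : 0 < y.re) (x : V) :
    (Real.pi / y) ^ (1 / 2 : ℂ) * 𝓕⁻ (fun ξ : V => Complex.exp (-y * rad ξ)) x =
      ∫ u, 𝓕⁻ (fun ξ : V => subIntegrand y ξ u) x := by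
  simp only [Real.fourierInv_eq', smul_eq_mul]
  rw [← integral_const_mul, ← integral_integral_swap]
  · refine integral_congr_ae ?_
    filter_upwards [integral_subIntegrand_ae_eq (V := V) hy] with ξ hξ
    rw [integral_const_mul, hξ]
    ring
  · refine (integrable_subIntegrand (V := V) hy).bdd_mul (c := 1)
      (Continuous.aestronglyMeasurable (by fun_prop)) (Filter.Eventually.of_forall fun z => ?_)
    rw [Complex.norm_exp_ofReal_mul_I]

theorem norm_fourierInv_subIntegrand_le (hy : 0 < y.re) (x : V) (u : ℝ) :
    ‖𝓕⁻ (fun ξ : V => subIntegrand y ξ u) x‖ ≤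
      (1 / (4 * Real.pi * ‖y‖)) ^ (Module.finrank ℝ V / 2 : ℝ) *
        (Real.exp (-((Module.finrank ℝ V + 1) * u)) *
          Real.exp (-(y.re / 4) * Real.exp (-(2 * u)))) := by
  have hy' : 0 < (y * (Real.exp (2 * u) : ℝ)).re := by
    rw [Complex.re_mul_ofReal]; positivity
  have h1 : 𝓕⁻ (fun ξ : V => subIntegrand y ξ u) x =
      (Real.exp (-u) : ℂ) * Complex.exp (-y * ((Real.exp (-(2 * u)) / 4 : ℝ) : ℂ)) *
        𝓕⁻ (fun ξ : V => Complex.exp (-(y * (Real.exp (2 * u) : ℝ)) * (rad ξ : ℂ) ^ 2)) x := by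
    simp only [Real.fourierInv_eq', smul_eq_mul, subIntegrand]
    rw [← integral_const_mul]
    congr 1 with ξ
    ring
  have hre : (-(‖x‖ : ℂ) ^ 2 / (4 * (y * (Real.exp (2 * u) : ℝ)))).re ≤ 0 := by
    have : (-(‖x‖ : ℂ) ^ 2 / (4 * (y * (Real.exp (2 * u) : ℝ)))) =
        ((-(‖x‖ ^ 2 / 4) : ℝ) : ℂ) * (y * (Real.exp (2 * u) : ℝ))⁻¹ := by
      push_cast
      rw [div_eq_mul_inv, mul_inv]
      ring
    rw [this, Complex.re_ofReal_mul, Complex.inv_re]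
    have h1 := div_nonneg hy'.le (Complex.normSq_nonneg (y * (Real.exp (2 * u) : ℝ)))
    nlinarith [sq_nonneg ‖x‖]
  have hpow : ‖(1 / (4 * Real.pi * (y * (Real.exp (2 * u) : ℝ))) : ℂ) ^
      (Module.finrank ℝ V / 2 : ℂ)‖ = (1 / (4 * Real.pi * ‖y‖)) ^ (Module.finrank ℝ V / 2 : ℝ) *
        Real.exp (-(Module.finrank ℝ V * u)) := by
    have : (Module.finrank ℝ V / 2 : ℂ) = ((Module.finrank ℝ V / 2 : ℝ) : ℂ) := by push_cast; rfl
    rw [this, Complex.norm_cpow_real]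
    have h2 : ‖(1 / (4 * Real.pi * (y * (Real.exp (2 * u) : ℝ))) : ℂ)‖ =
        1 / (4 * Real.pi * ‖y‖) * Real.exp (-(2 * u)) := by
      rw [norm_div, norm_one, norm_mul, norm_mul, norm_mul, Complex.norm_real, Complex.norm_real,
        Real.norm_of_nonneg Real.pi_pos.le, Real.norm_of_nonneg (Real.exp_pos _).le, Real.exp_neg,
        Complex.norm_ofNat]
      ring
    rw [h2, Real.mul_rpow (by positivity) (by positivity), ← Real.exp_mul]
    congr 2
    ring
  rw [h1, fourierInv_cexp_neg_mul_rad_sq hy', norm_mul, norm_mul, norm_mul, hpow, Complex.norm_exp,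
    Complex.norm_exp, Complex.norm_real, Real.norm_of_nonneg (Real.exp_pos _).le,
    Complex.re_mul_ofReal]
  calc _ ≤ Real.exp (-u) * Real.exp ((-y).re * (Real.exp (-(2 * u)) / 4)) *
      ((1 / (4 * Real.pi * ‖y‖)) ^ (Module.finrank ℝ V / 2 : ℝ) *
        Real.exp (-(Module.finrank ℝ V * u)) * 1) := by
        gcongr
        exact Real.exp_le_one_iff.2 hre
    _ = _ := by
        rw [add_mul, neg_add, Real.exp_add, one_mul, Complex.neg_re, mul_one]
        have : -y.re * (Real.exp (-(2 * u)) / 4) = -(y.re / 4) * Real.exp (-(2 * u)) := by ring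
        rw [this]
        ring

/-- Pointwise bound for the kernel of the damped half-wave propagator. -/
theorem exists_norm_fourierInv_cexp_neg_mul_rad_le :
    ∃ C : ℝ, 0 < C ∧ ∀ y : ℂ, 0 < y.re → ∀ x : V,
      ‖𝓕⁻ (fun ξ : V => Complex.exp (-y * rad ξ)) x‖ ≤
        C * y.re ^ (-((Module.finrank ℝ V + 1 : ℝ) / 2)) *
          ‖y‖ ^ (-((Module.finrank ℝ V - 1 : ℝ) / 2)) := by
  set J : ℝ := ∫ u : ℝ, Real.exp (-((Module.finrank ℝ V + 1 : ℝ) * u)) *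
    Real.exp (-(1 / 4) * Real.exp (-(2 * u))) with hJ
  have hJ0 : 0 ≤ J := integral_nonneg fun u => by positivity
  set n : ℝ := ((Module.finrank ℝ V : ℕ) : ℝ) with hn
  refine ⟨Real.pi ^ (-(1 / 2) : ℝ) * (1 / (4 * Real.pi)) ^ (n / 2) * J + 1, by positivity,
    fun y hy x => ?_⟩
  have hy0 : y ≠ 0 := fun h => by simp [h] at hy
  have hny : 0 < ‖y‖ := norm_pos_iff.2 hy0
  have hhalf : ‖(Real.pi / y : ℂ) ^ (1 / 2 : ℂ)‖ = (Real.pi / ‖y‖) ^ (1 / 2 : ℝ) := by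
    have : (1 / 2 : ℂ) = ((1 / 2 : ℝ) : ℂ) := by push_cast; rfl
    rw [this, Complex.norm_cpow_real, norm_div, Complex.norm_real,
      Real.norm_of_nonneg Real.pi_pos.le]
  have h1 : ‖∫ u, 𝓕⁻ (fun ξ : V => subIntegrand y ξ u) x‖ ≤
      (1 / (4 * Real.pi * ‖y‖)) ^ (n / 2) * (y.re ^ (-((n + 1) / 2)) * J) := by
    rw [hJ, ← integral_exp_neg_mul_exp_neg hy, ← integral_const_mul]
    exact norm_integral_le_of_norm_le
      ((integrable_exp_neg_mul_exp_neg (by positivity) (by positivity)).const_mul _)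
      (Filter.Eventually.of_forall fun u => norm_fourierInv_subIntegrand_le hy x u)
  rw [← fourierInv_cexp_neg_mul_rad hy, norm_mul, hhalf, mul_comm, ← le_div_iff₀ (by positivity)]
    at h1
  refine h1.trans ?_
  have e1 : (1 / (4 * Real.pi * ‖y‖)) ^ (n / 2) = (1 / (4 * Real.pi)) ^ (n / 2) * ‖y‖ ^ (-(n / 2)) := by
    rw [Real.rpow_neg hny.le, ← Real.inv_rpow hny.le, ← Real.mul_rpow (by positivity) (by positivity)]
    congr 1
    field_simp
  have e2 : ((Real.pi / ‖y‖) ^ (1 / 2 : ℝ))⁻¹ = Real.pi ^ (-(1 / 2) : ℝ) * ‖y‖ ^ (1 / 2 : ℝ) := by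
    rw [Real.div_rpow Real.pi_pos.le hny.le, Real.rpow_neg Real.pi_pos.le, inv_div, div_eq_inv_mul]
  have e3 : ‖y‖ ^ (-(n / 2)) * ‖y‖ ^ (1 / 2 : ℝ) = ‖y‖ ^ (-((n - 1) / 2)) := by
    rw [← Real.rpow_add hny]
    congr 1; ring
  rw [div_eq_mul_inv, e1, e2]
  calc _ = (Real.pi ^ (-(1 / 2) : ℝ) * (1 / (4 * Real.pi)) ^ (n / 2) * J) *
        y.re ^ (-((n + 1) / 2)) * (‖y‖ ^ (-(n / 2)) * ‖y‖ ^ (1 / 2 : ℝ)) := by ring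
    _ ≤ _ := by
        rw [e3]
        gcongr
        linarith

end KernelBound

/-- The `L^q` norm, written out as an integral. -/
def lpNorm (q : ℝ) (g : V → ℂ) : ℝ≥0∞ := (∫⁻ x, ‖g x‖ₑ ^ q) ^ (1 / q)

theorem enorm_integral_mul_le_lpNorm {p q : ℝ} (hpq : p.HolderConjugate q) {f g : V → ℂ}
    (hf : Measurable f) (hg : Measurable g) :
    ‖∫ x, f x * g x‖ₑ ≤ lpNorm p f * lpNorm q g := by
  refine (enorm_integral_le_lintegral_enorm _).trans ?_
  simp_rw [enorm_mul]
  exact ENNReal.lintegral_mul_le_Lp_mul_Lq volume hpq hf.enorm.aemeasurable hg.enorm.aemeasurable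

/-- The symbol of the half-wave propagator damped at frequency `exp (-s)`. -/
def dampedSymbol (t s : ℝ) (ξ : V) : ℂ :=
  Complex.exp (-((Real.exp s : ℂ) - Complex.I * t) * rad ξ)

theorem re_damping (t s : ℝ) : ((Real.exp s : ℂ) - Complex.I * t).re = Real.exp s := by
  rw [Complex.sub_re, Complex.ofReal_re, mul_comm, Complex.re_ofReal_mul, Complex.I_re]
  simp

theorem le_norm_damping (t s : ℝ) : |t| ≤ ‖(Real.exp s : ℂ) - Complex.I * t‖ := by
  have h := Complex.abs_im_le_norm ((Real.exp s : ℂ) - Complex.I * t)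
  have : ((Real.exp s : ℂ) - Complex.I * t).im = -t := by
    rw [Complex.sub_im, Complex.ofReal_im, mul_comm, Complex.im_ofReal_mul, Complex.I_im]
    simp
  rwa [this, abs_neg] at h

theorem dampedSymbol_eq (t s : ℝ) (ξ : V) : dampedSymbol t s ξ =
    Complex.exp (Complex.I * (t * rad ξ : ℝ)) * (Real.exp (-Real.exp s * rad ξ) : ℝ) := by
  rw [dampedSymbol, Complex.ofReal_exp (-Real.exp s * rad ξ), ← Complex.exp_add]
  congr 1
  push_cast
  ring

theorem norm_cexp_I_mul_ofReal (a : ℝ) : ‖Complex.exp (Complex.I * a)‖ = 1 := by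
  rw [mul_comm, Complex.norm_exp_ofReal_mul_I]

theorem norm_dampedSymbol_le (t s : ℝ) (ξ : V) : ‖dampedSymbol t s ξ‖ ≤ 1 := by
  rw [dampedSymbol_eq, norm_mul, norm_cexp_I_mul_ofReal, one_mul, Complex.norm_real,
    Real.norm_of_nonneg (Real.exp_pos _).le, Real.exp_le_one_iff]
  have := rad_nonneg ξ
  have := Real.exp_pos s
  nlinarith

theorem integrable_dampedSymbol [Nontrivial V] (t s : ℝ) :
    Integrable (dampedSymbol t s : V → ℂ) :=
  integrable_cexp_neg_mul_rad (by rw [re_damping]; exact Real.exp_pos s)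

theorem exists_lpNorm_damped_le [Nontrivial V] {p q : ℝ} (hp : 2 < p) (hq : q = p / (p - 1)) :
    ∃ C : ℝ, 0 < C ∧ ∀ t : ℝ, t ≠ 0 → ∀ s : ℝ, ∀ a : V → ℂ, IsBddIntegrable a →
      lpNorm p (𝓕⁻ fun ξ => dampedSymbol t s ξ * 𝓕 a ξ) ≤
        ENNReal.ofReal (C * Real.exp (-((Module.finrank ℝ V + 1) * (1 / 2 - 1 / p) * s)) *
          |t| ^ (-((Module.finrank ℝ V - 1) * (1 / 2 - 1 / p)))) * lpNorm q a := by
  obtain ⟨C, hC, hK⟩ := exists_norm_fourierInv_cexp_neg_mul_rad_le (V := V)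
  have hd : (1 : ℝ) ≤ Module.finrank ℝ V := by exact_mod_cast Module.finrank_pos (R := ℝ) (M := V)
  set n : ℝ := ((Module.finrank ℝ V : ℕ) : ℝ) with hn
  have hp0 : 0 < p := by linarith
  have hp1 : p - 1 ≠ 0 := by linarith
  refine ⟨4 ^ (1 / p) * (2 * C) ^ ((p - 2) / p), by positivity, fun t ht s a ha => ?_⟩
  have ht' : 0 < |t| := abs_pos.2 ht
  set A : ℝ := C * Real.exp s ^ (-((n + 1) / 2)) * |t| ^ (-((n - 1) / 2)) with hA
  have hA0 : 0 < A := by positivity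
  have hmA : ∀ x : V, ‖𝓕⁻ (dampedSymbol t s : V → ℂ) x‖ ≤ A := fun x => by
    refine (hK _ (by rw [re_damping]; exact Real.exp_pos s) x).trans ?_
    rw [re_damping, hA]
    exact mul_le_mul_of_nonneg_left
      (Real.rpow_le_rpow_of_nonpos ht' (le_norm_damping t s) (by linarith)) (by positivity)
  have h := lintegral_fourierInv_mul_fourier_rpow_le hp hq (integrable_dampedSymbol t s)
    (norm_dampedSymbol_le t s) hA0 hmA ha
  have h' := ENNReal.rpow_le_rpow h (z := 1 / p) (by positivity)
  rw [lpNorm, lpNorm]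
  refine h'.trans (le_of_eq ?_)
  have hq' : 1 / q = (p - 1) * (1 / p) := by rw [hq]; field_simp
  rw [ENNReal.mul_rpow_of_nonneg _ _ (by positivity), ENNReal.mul_rpow_of_nonneg _ _ (by positivity),
    ← ENNReal.rpow_mul _ (p - 1), hq', ENNReal.ofReal_rpow_of_nonneg (by positivity) (by positivity)]
  congr 1
  have h4 : (4 : ℝ≥0∞) = ENNReal.ofReal 4 := by simp
  rw [h4, ENNReal.ofReal_rpow_of_nonneg (by norm_num) (by positivity),
    ← ENNReal.ofReal_mul (by positivity)]
  congr 1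
  rw [← Real.rpow_mul (by positivity), hA]
  have e : 2 * (C * Real.exp s ^ (-((n + 1) / 2)) * |t| ^ (-((n - 1) / 2))) =
      (2 * C) * (Real.exp s ^ (-((n + 1) / 2)) * |t| ^ (-((n - 1) / 2))) := by ring
  rw [e, Real.mul_rpow (x := 2 * C) (by positivity) (by positivity),
    Real.mul_rpow (y := |t| ^ (-((n - 1) / 2))) (by positivity) (by positivity),
    ← Real.rpow_mul (by positivity), ← Real.rpow_mul (by positivity),
    ← Real.exp_mul]
  have e1 : s * (-((n + 1) / 2) * ((p - 2) * (1 / p))) = -((n + 1) * (1 / 2 - 1 / p) * s) := by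
    field_simp
  have e2 : -((n - 1) / 2) * ((p - 2) * (1 / p)) = -((n - 1) * (1 / 2 - 1 / p)) := by
    field_simp
  rw [e1, e2, mul_one_div]
  ring

theorem pieceSymbol_nonneg {ρ : ℝ} (hρ : 0 ≤ ρ) : 0 ≤ pieceSymbol ρ := by
  rw [pieceSymbol, sub_nonneg, Real.exp_le_exp, neg_le_neg_iff]
  gcongr
  exact le_mul_of_one_le_left hρ (Real.one_le_exp zero_le_one)

theorem pieceSymbol_pos {ρ : ℝ} (hρ : 0 < ρ) : 0 < pieceSymbol ρ := by
  rw [pieceSymbol, sub_pos, Real.exp_lt_exp, neg_lt_neg_iff]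
  gcongr
  exact lt_mul_of_one_lt_left hρ (Real.one_lt_exp_iff.2 one_pos)

theorem pieceSymbol_le_one (ρ : ℝ) : pieceSymbol ρ ≤ 1 := by
  have h1 : Real.exp (-ρ ^ 2) ≤ 1 := Real.exp_le_one_iff.2 (by nlinarith [sq_nonneg ρ])
  have h2 := Real.exp_pos (-(Real.exp 1 * ρ) ^ 2)
  rw [pieceSymbol]
  linarith

theorem continuous_pieceSymbol : Continuous pieceSymbol := by unfold pieceSymbol; fun_prop

/-- The integrand in the decomposition of the symbol `ρ ^ (-β)` into damped pieces. -/
def synthIntegrand (β ρ s : ℝ) : ℝ :=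
  Real.exp (β * s) * Real.exp (-Real.exp s * ρ) * pieceSymbol (Real.exp s * ρ) ^ 2

theorem continuous_synthIntegrand (β : ℝ) :
    Continuous fun z : ℝ × ℝ => synthIntegrand β z.1 z.2 := by
  have := continuous_pieceSymbol
  unfold synthIntegrand
  fun_prop

theorem synthIntegrand_nonneg (β ρ s : ℝ) : 0 ≤ synthIntegrand β ρ s := by
  unfold synthIntegrand; positivity

theorem synthIntegrand_le (β s : ℝ) {ρ : ℝ} (hρ : 0 ≤ ρ) :
    synthIntegrand β ρ s ≤ Real.exp (β * s) * Real.exp (-Real.exp s * ρ) := by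
  unfold synthIntegrand
  have h := pieceSymbol_nonneg (mul_nonneg (Real.exp_pos s).le hρ)
  exact mul_le_of_le_one_right (by positivity) (pow_le_one₀ h (pieceSymbol_le_one _))

/-- The truncated synthesis of the symbol `ρ ^ (-β)`. -/
def synth (β : ℝ) (N : ℕ) (ρ : ℝ) : ℝ := ∫ s in Ioc (-N : ℝ) N, synthIntegrand β ρ s

theorem synth_nonneg (β : ℝ) (N : ℕ) (ρ : ℝ) : 0 ≤ synth β N ρ :=
  integral_nonneg fun s => synthIntegrand_nonneg β ρ s

theorem synthIntegrand_le_of_mem {β : ℝ} (hβ : 0 ≤ β) {N s ρ : ℝ} (hρ : 0 ≤ ρ)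
    (hs : s ∈ Ioc (-N) N) :
    synthIntegrand β ρ s ≤ Real.exp (β * N) * Real.exp (-Real.exp (-N) * ρ) := by
  refine (synthIntegrand_le β s hρ).trans ?_
  gcongr
  · exact hs.2
  · exact hs.1.le

theorem measurable_synth (β : ℝ) (N : ℕ) : Measurable (synth β N) :=
  (StronglyMeasurable.integral_prod_right (f := fun ρ s => synthIntegrand β ρ s)
    (continuous_synthIntegrand β).stronglyMeasurable).measurable

theorem integrable_fourier_mul_fourier_neg {g h : V → ℂ} (hg : IsBddIntegrable g)
    (hh : IsBddIntegrable h) : Integrable fun ξ => 𝓕 g ξ * 𝓕 h (-ξ) :=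
  MemLp.integrable_mul (memLp_fourier hg.integrable hg.memLp_two)
    (memLp_comp_neg (memLp_fourier hh.integrable hh.memLp_two))

theorem enorm_integral_dampedSymbol_le [Nontrivial V] {p q t s : ℝ} (hpq : p.HolderConjugate q)
    {K : ℝ≥0∞} {a b : V → ℂ} (ha : IsBddIntegrable a) (hb : IsBddIntegrable b)
    (hK : lpNorm p (𝓕⁻ fun ξ => dampedSymbol t s ξ * 𝓕 a ξ) ≤ K * lpNorm q a) :
    ‖∫ ξ, dampedSymbol t s ξ * 𝓕 a ξ * 𝓕 b (-ξ)‖ₑ ≤ K * lpNorm q a * lpNorm q b := by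
  have hi := integrable_mul_fourier (integrable_dampedSymbol (V := V) t s) ha.integrable
  rw [← integral_fourierInv_mul_eq hi hb.integrable]
  exact (enorm_integral_mul_le_lpNorm hpq (continuous_fourierInv hi).measurable hb.measurable).trans
    (by gcongr)

theorem dampedSymbol_mul_fourier_heatPiece {g h : V → ℂ} (hg : IsBddIntegrable g)
    (hh : IsBddIntegrable h) (β t s : ℝ) (ξ : V) :
    (Real.exp (β * s) : ℂ) *
        (dampedSymbol t s ξ * 𝓕 (heatPiece s g) ξ * 𝓕 (heatPiece s h) (-ξ)) =
      synthIntegrand β (rad ξ) s *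
        (Complex.exp (Complex.I * (t * rad ξ : ℝ)) * (𝓕 g ξ * 𝓕 h (-ξ))) := by
  rw [fourier_heatPiece hg, fourier_heatPiece hh, dampedSymbol_eq, rad_neg, synthIntegrand]
  push_cast
  ring

theorem lpNorm_rpow_two (q : ℝ) (g : V → ℂ) :
    lpNorm q g ^ (2 : ℝ) = (∫⁻ x, ‖g x‖ₑ ^ q) ^ (2 / q) := by
  rw [lpNorm, ← ENNReal.rpow_mul]
  congr 1
  ring

theorem setLIntegral_lpNorm_heatPiece_mul_le {q : ℝ} (hq1 : 1 < q) (hq2 : q ≤ 2) {g h : V → ℂ}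
    (hg : IsBddIntegrable g) (hh : IsBddIntegrable h) (N : ℕ) :
    ∫⁻ s in Ioc (-N : ℝ) N, lpNorm q (heatPiece s g) * lpNorm q (heatPiece s h) ≤
      ENNReal.ofReal (16 / (q * (q - 1))) * (lpNorm q g * lpNorm q h) := by
  have hq : 0 < q := by linarith
  have hq' : 0 < q - 1 := by linarith
  have hsq : ∀ {g : V → ℂ}, IsBddIntegrable g →
      (∫⁻ s in Ioc (-N : ℝ) N, lpNorm q (heatPiece s g) ^ (2 : ℝ)) ^ (1 / (2 : ℝ)) ≤
        ENNReal.ofReal (16 / (q * (q - 1))) ^ (1 / (2 : ℝ)) * lpNorm q g := fun {g} hg => by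
    have h := setLIntegral_heatPiece_le hg hq1 hq2 (-N) (2 * N)
    have hN : (-N : ℝ) + (2 * N : ℕ) = N := by push_cast; ring
    simp only [← lpNorm_rpow_two, hN] at h
    refine (ENNReal.rpow_le_rpow h (z := 1 / 2) (by norm_num)).trans (le_of_eq ?_)
    rw [ENNReal.mul_rpow_of_nonneg _ _ (by norm_num), ← ENNReal.rpow_mul]
    norm_num
  have hm : ∀ {g : V → ℂ}, IsBddIntegrable g →
      AEMeasurable (fun s => lpNorm q (heatPiece s g)) (volume.restrict (Ioc (-N : ℝ) N)) :=
    fun {g} hg => (measurable_lintegral_heatPiece hg.integrable q (1 / q)).aemeasurable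
  refine (ENNReal.lintegral_mul_le_Lp_mul_Lq _ Real.HolderConjugate.two_two (hm hg) (hm hh)).trans ?_
  refine (mul_le_mul' (hsq hg) (hsq hh)).trans (le_of_eq ?_)
  rw [mul_mul_mul_comm, ← ENNReal.rpow_add_of_nonneg _ _ (by norm_num) (by norm_num)]
  norm_num

theorem integral_synth_mul {β : ℝ} (hβ : 0 ≤ β) (N : ℕ) {W : V → ℂ} (hW : Integrable W) :
    ∫ ξ, (synth β N (rad ξ) : ℂ) * W ξ =
      ∫ s in Ioc (-N : ℝ) N, ∫ ξ, (synthIntegrand β (rad ξ) s : ℂ) * W ξ := by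
  rw [← integral_integral_swap]
  · congr 1 with ξ
    rw [integral_mul_const, integral_complex_ofReal, synth]
  · have hc : Continuous fun z : V × ℝ => (synthIntegrand β (rad z.1) z.2 : ℂ) :=
      Complex.continuous_ofReal.comp ((continuous_synthIntegrand β).comp
        ((continuous_rad.comp continuous_fst).prodMk continuous_snd))
    have h1 : Integrable (fun z : V × ℝ => W z.1)
        (volume.prod (volume.restrict (Ioc (-N : ℝ) N))) := hW.comp_fst _
    refine h1.bdd_mul (c := Real.exp (β * N)) hc.aestronglyMeasurable ?_
    filter_upwards [Measure.quasiMeasurePreserving_snd.ae (ae_restrict_mem measurableSet_Ioc)]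
      with z hz
    rw [Complex.norm_real, Real.norm_of_nonneg (synthIntegrand_nonneg _ _ _)]
    refine (synthIntegrand_le_of_mem hβ (rad_nonneg z.1) hz).trans ?_
    refine mul_le_of_le_one_right (Real.exp_pos _).le (Real.exp_le_one_iff.2 ?_)
    have := rad_nonneg z.1
    have := Real.exp_pos (-(N : ℝ))
    nlinarith

theorem exists_enorm_integral_synth_le [Nontrivial V] {p q : ℝ} (hp : 2 < p)
    (hq : q = p / (p - 1)) :
    ∃ C : ℝ, 0 < C ∧ ∀ t : ℝ, t ≠ 0 → ∀ g h : V → ℂ, IsBddIntegrable g → IsBddIntegrable h →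
      ∀ N : ℕ, ‖∫ ξ, (synth ((Module.finrank ℝ V + 1) * (1 / 2 - 1 / p)) N (rad ξ) : ℂ) *
          (Complex.exp (Complex.I * (t * rad ξ : ℝ)) * (𝓕 g ξ * 𝓕 h (-ξ)))‖ₑ ≤
        ENNReal.ofReal (C * |t| ^ (-((Module.finrank ℝ V - 1) * (1 / 2 - 1 / p)))) *
          (lpNorm q g * lpNorm q h) := by
  obtain ⟨C, hC, hK⟩ := exists_lpNorm_damped_le (V := V) hp hq
  have hp1 : 0 < p - 1 := by linarith
  have hpq : p.HolderConjugate q := hq ▸ Real.HolderConjugate.conjExponent (by linarith)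
  have hq1 : 1 < q := hpq.symm.lt
  have hq2 : q ≤ 2 := by rw [hq, div_le_iff₀ hp1]; linarith
  have hα : 0 < 1 / 2 - 1 / p := by
    rw [sub_pos]; exact one_div_lt_one_div_of_lt two_pos hp
  set β : ℝ := (Module.finrank ℝ V + 1) * (1 / 2 - 1 / p) with hβ
  set γ : ℝ := (Module.finrank ℝ V - 1) * (1 / 2 - 1 / p) with hγ
  have hq0 : 0 < q * (q - 1) := mul_pos (by linarith) (by linarith)
  refine ⟨C * (16 / (q * (q - 1))), by positivity, fun t ht g h hg hh N => ?_⟩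
  have hW : Integrable fun ξ : V =>
      Complex.exp (Complex.I * (t * rad ξ : ℝ)) * (𝓕 g ξ * 𝓕 h (-ξ)) := by
    have := continuous_rad (V := V)
    exact (integrable_fourier_mul_fourier_neg hg hh).bdd_mul (c := 1)
      (Continuous.aestronglyMeasurable (by fun_prop))
      (Filter.Eventually.of_forall fun ξ => (norm_cexp_I_mul_ofReal _).le)
  rw [integral_synth_mul (by positivity) N hW]
  have hpt : ∀ s : ℝ, ‖∫ ξ, (synthIntegrand β (rad ξ) s : ℂ) *
      (Complex.exp (Complex.I * (t * rad ξ : ℝ)) * (𝓕 g ξ * 𝓕 h (-ξ)))‖ₑ ≤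
      ENNReal.ofReal (C * |t| ^ (-γ)) *
        (lpNorm q (heatPiece s g) * lpNorm q (heatPiece s h)) := fun s => by
    simp_rw [← dampedSymbol_mul_fourier_heatPiece hg hh β t s]
    rw [integral_const_mul, enorm_mul]
    refine (mul_le_mul_right (enorm_integral_dampedSymbol_le hpq (hg.heatPiece s)
      (hh.heatPiece s) (hK t ht s _ (hg.heatPiece s))) _).trans (le_of_eq ?_)
    have he : ‖(Real.exp (β * s) : ℂ)‖ₑ = ENNReal.ofReal (Real.exp (β * s)) := by
      rw [← ofReal_norm, Complex.norm_real, Real.norm_of_nonneg (Real.exp_pos _).le]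
    rw [he, ← mul_assoc, ← mul_assoc, ← mul_assoc, ← ENNReal.ofReal_mul (Real.exp_pos _).le]
    congr 3
    rw [Real.exp_neg]
    field_simp
  refine (enorm_integral_le_lintegral_enorm _).trans ((lintegral_mono hpt).trans ?_)
  rw [lintegral_const_mul' _ _ ENNReal.ofReal_ne_top]
  refine (mul_le_mul_right (setLIntegral_lpNorm_heatPiece_mul_le hq1 hq2 hg hh N) _).trans ?_
  rw [← mul_assoc, ← ENNReal.ofReal_mul (by positivity)]
  apply le_of_eq
  congr 2
  ring

theorem isBddIntegrable_indicator_ball {g : V → ℂ} (hg : Measurable g) {A : ℝ}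
    (hA : ∀ x, ‖g x‖ ≤ A) (R : ℝ) : IsBddIntegrable ((ball (0 : V) R).indicator g) := by
  refine ⟨hg.indicator measurableSet_ball, ?_,
    A, fun x => (norm_indicator_le_norm_self _ _).trans (hA x)⟩
  rw [integrable_indicator_iff measurableSet_ball]
  exact Measure.integrableOn_of_bounded (M := A) measure_ball_lt_top.ne hg.aestronglyMeasurable
    (Filter.Eventually.of_forall hA)

theorem lpNorm_indicator_le {q : ℝ} (hq : 0 < q) (g : V → ℂ) (E : Set V) :
    lpNorm q (E.indicator g) ≤ lpNorm q g := by
  unfold lpNorm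
  gcongr with x
  simp only [← ofReal_norm]
  exact ENNReal.ofReal_le_ofReal (norm_indicator_le_norm_self _ _)

theorem isBddIntegrable_synth_mul [Nontrivial V] {β : ℝ} (hβ : 0 ≤ β) (N : ℕ) (t : ℝ) {h : V → ℂ}
    (hh : IsBddIntegrable h) :
    IsBddIntegrable fun ξ : V => (synth β N (rad ξ) : ℂ) *
      (Complex.exp (Complex.I * (t * rad ξ : ℝ)) * 𝓕 h (-ξ)) := by
  have hcr := continuous_rad (V := V)
  have hch := continuous_fourier hh.integrable
  have hms : Measurable fun ξ : V => (synth β N (rad ξ) : ℂ) :=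
    Complex.measurable_ofReal.comp ((measurable_synth β N).comp measurable_rad)
  set L : ℝ := Real.exp (β * N) * (2 * N) with hL
  have hs : ∀ ξ : V, ‖(synth β N (rad ξ) : ℂ)‖ ≤ L * ‖dampedSymbol 0 (-N) ξ‖ := fun ξ => by
    have h1 : ‖dampedSymbol 0 (-N) ξ‖ = Real.exp (-Real.exp (-N) * rad ξ) := by
      rw [dampedSymbol_eq, norm_mul, norm_cexp_I_mul_ofReal, one_mul, Complex.norm_real,
        Real.norm_of_nonneg (Real.exp_pos _).le]
    rw [Complex.norm_real, h1, synth, hL]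
    refine (norm_setIntegral_le_of_norm_le_const (C := Real.exp (β * N) *
      Real.exp (-Real.exp (-N) * rad ξ)) measure_Ioc_lt_top fun s hs => ?_).trans (le_of_eq ?_)
    · rw [Real.norm_of_nonneg (synthIntegrand_nonneg _ _ _)]
      exact synthIntegrand_le_of_mem hβ (rad_nonneg ξ) hs
    · rw [Real.volume_real_Ioc_of_le (by linarith [N.cast_nonneg (α := ℝ)])]
      ring
  have hbd : ∀ ξ : V, ‖Complex.exp (Complex.I * (t * rad ξ : ℝ)) * 𝓕 h (-ξ)‖ ≤ ∫ x, ‖h x‖ :=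
    fun ξ => by
      rw [norm_mul, norm_cexp_I_mul_ofReal, one_mul]
      exact norm_fourier_le h _
  have hL0 : 0 ≤ L := by positivity
  refine ⟨hms.mul (Continuous.measurable (by fun_prop)), ?_, L * ∫ x, ‖h x‖, fun ξ => ?_⟩
  · refine Integrable.mul_bdd (c := ∫ x, ‖h x‖) ?_ (Continuous.aestronglyMeasurable (by fun_prop))
      (Filter.Eventually.of_forall hbd)
    exact ((integrable_dampedSymbol 0 (-N)).norm.const_mul L).mono' hms.aestronglyMeasurable
      (Filter.Eventually.of_forall hs)
  · rw [norm_mul]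
    refine mul_le_mul ((hs ξ).trans ?_) (hbd ξ) (norm_nonneg _) hL0
    exact mul_le_of_le_one_right hL0 (norm_dampedSymbol_le _ _ _)

theorem integrable_synthIntegrand {β ρ : ℝ} (hβ : 0 < β) (hρ : 0 < ρ) :
    Integrable (synthIntegrand β ρ) := by
  have hc : Continuous (synthIntegrand β ρ) :=
    (continuous_synthIntegrand β).comp (Continuous.prodMk_right ρ)
  refine (integrable_exp_mul_exp_neg_exp hβ hρ).mono' hc.aestronglyMeasurable
    (Filter.Eventually.of_forall fun s => ?_)
  rw [Real.norm_of_nonneg (synthIntegrand_nonneg _ _ _)]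
  refine (synthIntegrand_le β s hρ.le).trans (le_of_eq ?_)
  congr 2
  ring

theorem integral_synthIntegrand_one_pos {β : ℝ} (hβ : 0 < β) :
    0 < ∫ s, synthIntegrand β 1 s := by
  rw [integral_pos_iff_support_of_nonneg (synthIntegrand_nonneg β 1)
    (integrable_synthIntegrand hβ one_pos)]
  have : Function.support (synthIntegrand β 1) = univ := by
    refine eq_univ_of_forall fun s => ?_
    have := pieceSymbol_pos (mul_pos (Real.exp_pos s) one_pos)
    rw [Function.mem_support, synthIntegrand]
    positivity
  rw [this]
  simp

theorem integral_synthIntegrand {β ρ : ℝ} (hρ : 0 < ρ) :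
    ∫ s, synthIntegrand β ρ s = ρ ^ (-β) * ∫ s, synthIntegrand β 1 s := by
  rw [← integral_add_right_eq_self _ (-Real.log ρ), ← integral_const_mul]
  congr 1 with s
  have h1 : Real.exp (s + -Real.log ρ) * ρ = Real.exp s * 1 := by
    rw [Real.exp_add, Real.exp_neg, Real.exp_log hρ]
    field_simp
  have h2 : Real.exp (β * (s + -Real.log ρ)) = ρ ^ (-β) * Real.exp (β * s) := by
    rw [Real.rpow_def_of_pos hρ, ← Real.exp_add]
    congr 1; ring
  simp only [synthIntegrand, neg_mul, h1, h2]
  ring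

theorem synth_mul_rpow_le {β ρ : ℝ} (hβ : 0 < β) (N : ℕ) (hρ : 0 < ρ) :
    synth β N ρ * ρ ^ β ≤ ∫ s, synthIntegrand β 1 s := by
  have h : synth β N ρ ≤ ρ ^ (-β) * ∫ s, synthIntegrand β 1 s := by
    rw [← integral_synthIntegrand hρ]
    exact setIntegral_le_integral (integrable_synthIntegrand hβ hρ)
      (Filter.Eventually.of_forall (synthIntegrand_nonneg β ρ))
  refine (mul_le_mul_of_nonneg_right h (by positivity)).trans (le_of_eq ?_)
  rw [mul_right_comm, ← Real.rpow_add hρ]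
  simp

theorem tendsto_synth_mul_rpow {β ρ : ℝ} (hβ : 0 < β) (hρ : 0 < ρ) :
    Filter.Tendsto (fun N : ℕ => synth β N ρ * ρ ^ β) Filter.atTop
      (nhds (∫ s, synthIntegrand β 1 s)) := by
  have hN : Filter.Tendsto (fun N : ℕ => (N : ℝ)) Filter.atTop Filter.atTop :=
    tendsto_natCast_atTop_atTop
  have h := (aecover_Ioc (μ := (volume : Measure ℝ)) (Filter.tendsto_neg_atTop_atBot.comp hN)
    hN).integral_tendsto_of_countably_generated (integrable_synthIntegrand hβ hρ)
  have h' := h.mul_const (ρ ^ β)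
  rw [integral_synthIntegrand hρ, mul_right_comm, ← Real.rpow_add hρ, neg_add_cancel,
    Real.rpow_zero, one_mul] at h'
  exact h'

theorem exists_enorm_integral_le [Nontrivial V] {p q : ℝ} (hp : 2 < p) (hq : q = p / (p - 1)) :
    ∃ C : ℝ, 0 < C ∧ ∀ t : ℝ, t ≠ 0 → ∀ ψ h : V → ℂ, Integrable ψ → IsBddIntegrable h →
      let φ : V → ℂ := fun ξ =>
        ((rad ξ ^ ((Module.finrank ℝ V + 1) * (1 / 2 - 1 / p)) : ℝ) : ℂ) * ψ ξ
      Integrable φ → MemLp φ 2 →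
      ‖∫ ξ, Complex.exp (Complex.I * (t * rad ξ : ℝ)) * ψ ξ * 𝓕 h (-ξ)‖ₑ ≤
        ENNReal.ofReal (C * |t| ^ (-((Module.finrank ℝ V - 1) * (1 / 2 - 1 / p)))) *
          (lpNorm q (𝓕⁻ φ) * lpNorm q h) := by
  obtain ⟨C, hC, hK⟩ := exists_enorm_integral_synth_le (V := V) hp hq
  have hpq : p.HolderConjugate q := hq ▸ Real.HolderConjugate.conjExponent (by linarith)
  have hα : 0 < 1 / 2 - 1 / p := by
    rw [sub_pos]; exact one_div_lt_one_div_of_lt two_pos hp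
  set β : ℝ := (Module.finrank ℝ V + 1) * (1 / 2 - 1 / p) with hβ
  set γ : ℝ := (Module.finrank ℝ V - 1) * (1 / 2 - 1 / p) with hγ
  have hβ0 : 0 < β := by positivity
  set c : ℝ := ∫ s, synthIntegrand β 1 s with hc
  have hc0 : 0 < c := integral_synthIntegrand_one_pos hβ0
  refine ⟨C / c, by positivity, ?_⟩
  intro t ht ψ h hψ hh φ hφ hφ2
  have hcr := continuous_rad (V := V)
  have hch := continuous_fourier hh.integrable
  set w : ℕ → V → ℂ := fun N ξ => (synth β N (rad ξ) : ℂ) *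
    (Complex.exp (Complex.I * (t * rad ξ : ℝ)) * 𝓕 h (-ξ)) with hw
  have hwb : ∀ N, IsBddIntegrable (w N) := fun N => isBddIntegrable_synth_mul hβ0.le N t hh
  have hgm := (continuous_fourierInv hφ).measurable
  have htrunc : ∀ N, ‖∫ ξ, φ ξ * w N ξ‖ₑ ≤
      ENNReal.ofReal (C * |t| ^ (-γ)) * (lpNorm q (𝓕⁻ φ) * lpNorm q h) := fun N => by
    have hi : Integrable fun x => 𝓕⁻ φ x * 𝓕 (w N) x :=
      MemLp.integrable_mul (memLp_fourierInv hφ hφ2)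
        (memLp_fourier (hwb N).integrable (hwb N).memLp_two)
    have hlim := ((aecover_ball (μ := (volume : Measure V)) (x := (0 : V))
      (tendsto_natCast_atTop_atTop (R := ℝ))).integral_tendsto_of_countably_generated hi).enorm
    rw [integral_fourierInv_mul_fourier hφ hφ2 (hwb N).integrable (hwb N).memLp_two] at hlim
    refine le_of_tendsto hlim (Filter.Eventually.of_forall fun k => ?_)
    have hgk := isBddIntegrable_indicator_ball hgm (norm_fourierInv_le φ) (k : ℝ)
    have h1 := hK t ht _ h hgk hh N
    have h2 : ∫ x in ball (0 : V) k, 𝓕⁻ φ x * 𝓕 (w N) x =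
        ∫ ξ, (synth β N (rad ξ) : ℂ) * (Complex.exp (Complex.I * (t * rad ξ : ℝ)) *
          (𝓕 ((ball (0 : V) k).indicator (𝓕⁻ φ)) ξ * 𝓕 h (-ξ))) := by
      rw [← integral_indicator measurableSet_ball]
      simp_rw [indicator_mul_left]
      rw [← integral_fourier_mul_eq hgk.integrable (hwb N).integrable]
      congr 1 with ξ
      rw [hw]
      ring
    rw [h2]
    refine h1.trans ?_
    gcongr
    exact lpNorm_indicator_le hpq.symm.pos _ _
  have hlim : Filter.Tendsto (fun N => ∫ ξ, φ ξ * w N ξ) Filter.atTop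
      (nhds (∫ ξ, (c : ℂ) * (Complex.exp (Complex.I * (t * rad ξ : ℝ)) * ψ ξ * 𝓕 h (-ξ)))) := by
    have h0 : ∀ᵐ ξ : V, 0 < rad ξ := by
      have h0 : ∀ᵐ ξ : V, ξ ≠ 0 := by simp [ae_iff]
      filter_upwards [h0] with ξ hξ
      have := norm_pos_iff.2 hξ
      unfold rad; positivity
    have heq : ∀ N ξ, φ ξ * w N ξ = ((synth β N (rad ξ) * rad ξ ^ β : ℝ) : ℂ) *
        (Complex.exp (Complex.I * (t * rad ξ : ℝ)) * ψ ξ * 𝓕 h (-ξ)) := fun N ξ => by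
      simp only [φ, hw]
      push_cast
      ring
    refine tendsto_integral_of_dominated_convergence
      (fun ξ => c * (‖ψ ξ‖ * ∫ x, ‖h x‖)) (fun N => ?_) ?_ (fun N => ?_) ?_
    · exact hφ.1.mul (hwb N).measurable.aestronglyMeasurable
    · exact (hψ.norm.mul_const _).const_mul _
    · filter_upwards [h0] with ξ hξ
      rw [heq, norm_mul, norm_mul, norm_mul, norm_cexp_I_mul_ofReal, one_mul, Complex.norm_real,
        Real.norm_of_nonneg (mul_nonneg (synth_nonneg _ _ _) (by positivity))]
      have h1 := synth_mul_rpow_le hβ0 N hξ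
      have h2 := norm_fourier_le h (-ξ)
      gcongr
    · filter_upwards [h0] with ξ hξ
      simp_rw [heq]
      exact ((Complex.continuous_ofReal.tendsto _).comp
        (tendsto_synth_mul_rpow hβ0 hξ)).mul_const _
  have hfin := le_of_tendsto hlim.enorm (Filter.Eventually.of_forall htrunc)
  rw [integral_const_mul, enorm_mul] at hfin
  have hce : ‖(c : ℂ)‖ₑ = ENNReal.ofReal c := by
    rw [← ofReal_norm, Complex.norm_real, Real.norm_of_nonneg hc0.le]
  have hsplit : C / c * |t| ^ (-γ) = c⁻¹ * (C * |t| ^ (-γ)) := by ring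
  have hinv : ENNReal.ofReal c⁻¹ * ENNReal.ofReal c = 1 := by
    rw [← ENNReal.ofReal_mul (by positivity), inv_mul_cancel₀ hc0.ne', ENNReal.ofReal_one]
  rw [hsplit, ENNReal.ofReal_mul (p := c⁻¹) (by positivity), mul_assoc]
  calc _ = ENNReal.ofReal c⁻¹ * (ENNReal.ofReal c *
        ‖∫ ξ, Complex.exp (Complex.I * (t * rad ξ : ℝ)) * ψ ξ * 𝓕 h (-ξ)‖ₑ) := by
        rw [← mul_assoc, hinv, one_mul]
    _ ≤ _ := by
        rw [← hce]
        gcongr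

theorem eLpNorm_eq_lpNorm {q : ℝ} (hq : 0 < q) (g : V → ℂ) :
    eLpNorm g (ENNReal.ofReal q) = lpNorm q g := by
  rw [eLpNorm_eq_lintegral_rpow_enorm_toReal (by simpa using hq) ENNReal.ofReal_ne_top,
    ENNReal.toReal_ofReal hq.le, lpNorm]

theorem lpNorm_le_of_forall_enorm_integral_mul_le {p q : ℝ} (hp : 2 < p)
    (hpq : p.HolderConjugate q) {F : V → ℂ} (hF : Measurable F) {A : ℝ} (hA : ∀ x, ‖F x‖ ≤ A)
    {K : ℝ≥0∞} (hK : ∀ h : V → ℂ, IsBddIntegrable h → ‖∫ x, F x * h x‖ₑ ≤ K * lpNorm q h) :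
    lpNorm p F ≤ K := by
  have hp0 : 0 < p := hpq.pos
  have hball : ∀ k : ℕ, (∫⁻ x in ball (0 : V) k, ‖F x‖ₑ ^ p) ^ (1 / p) ≤ K := fun k => by
    set u : V → ℂ := (ball (0 : V) k).indicator F with hu
    have hub : IsBddIntegrable u := isBddIntegrable_indicator_ball hF hA k
    have huA : ∀ x, ‖u x‖ ≤ A := fun x => (norm_indicator_le_norm_self _ _).trans (hA x)
    set S : ℝ≥0∞ := ∫⁻ x, ‖u x‖ₑ ^ p with hS
    have hSF : ∫⁻ x in ball (0 : V) k, ‖F x‖ₑ ^ p = S := by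
      rw [hS, ← lintegral_indicator measurableSet_ball]
      congr 1 with x
      by_cases hx : x ∈ ball (0 : V) k
      · simp [hu, hx]
      · simp [hu, hx, hp0]
    set h : V → ℂ := fun x => ((‖u x‖ ^ (p - 2) : ℝ) : ℂ) * (starRingEnd ℂ) (u x) with hh
    have hum := hub.measurable
    have hwm : Measurable fun x => ((‖u x‖ ^ (p - 2) : ℝ) : ℂ) := by fun_prop
    have hwA : ∀ x, ‖((‖u x‖ ^ (p - 2) : ℝ) : ℂ)‖ ≤ A ^ (p - 2) := fun x => by
      rw [Complex.norm_real, Real.norm_of_nonneg (by positivity)]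
      exact Real.rpow_le_rpow (norm_nonneg _) (huA x) (by linarith)
    have hcm : Measurable fun x => (starRingEnd ℂ) (u x) :=
      Complex.continuous_conj.measurable.comp hum
    have hA0 : 0 ≤ A := (norm_nonneg _).trans (hA 0)
    have hhb : IsBddIntegrable h := by
      refine ⟨hwm.mul hcm, ?_, A ^ (p - 2) * A, fun x => ?_⟩
      · refine Integrable.bdd_mul (c := A ^ (p - 2)) ?_ hwm.aestronglyMeasurable
          (Filter.Eventually.of_forall hwA)
        exact hub.integrable.norm.mono' hcm.aestronglyMeasurable
          (Filter.Eventually.of_forall fun x => by simp)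
      · rw [hh, norm_mul]
        exact mul_le_mul (hwA x) (by simpa using huA x) (norm_nonneg _) (by positivity)
    have hFh : ∀ x, F x * h x = ((‖u x‖ ^ p : ℝ) : ℂ) := fun x => by
      by_cases hx : x ∈ ball (0 : V) k
      · have hux : u x = F x := by simp [hu, hx]
        have hpow : ‖F x‖ ^ p = ‖F x‖ ^ (p - 2) * ‖F x‖ ^ 2 := by
          rw [← Real.rpow_natCast, ← Real.rpow_add' (norm_nonneg _) (by push_cast; linarith)]
          congr 1
          push_cast
          ring
        simp only [hh, hux]
        rw [hpow, mul_left_comm, Complex.mul_conj, Complex.normSq_eq_norm_sq]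
        push_cast
        rfl
      · have hux : u x = 0 := by simp [hu, hx]
        simp [hh, hux, hp0.ne']
    have hint : ‖∫ x, F x * h x‖ₑ = S := by
      have hup : Integrable fun x => ‖u x‖ ^ p := by
        refine ⟨Measurable.aestronglyMeasurable (by fun_prop), ?_⟩
        refine (hub.lintegral_rpow_ne_top (q := p) (by linarith)).lt_top.trans_eq' ?_
        refine lintegral_congr fun x => ?_
        rw [enorm_rpow_eq_ofReal _ hp0.le, Real.enorm_eq_ofReal (by positivity)]
      simp_rw [hFh]
      rw [integral_complex_ofReal, ← ofReal_norm, Complex.norm_real,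
        Real.norm_of_nonneg (integral_nonneg fun x => by positivity),
        ofReal_integral_eq_lintegral_ofReal hup (Filter.Eventually.of_forall fun x => by
          simp only [Pi.zero_apply]; positivity), hS]
      refine lintegral_congr fun x => ?_
      rw [enorm_rpow_eq_ofReal _ hp0.le]
    have hhq : lpNorm q h = S ^ (1 / q) := by
      rw [lpNorm, hS]
      congr 1
      refine lintegral_congr fun x => ?_
      rw [enorm_rpow_eq_ofReal _ hpq.symm.nonneg, enorm_rpow_eq_ofReal _ hp0.le]
      congr 1
      have hn : ‖h x‖ = ‖u x‖ ^ (p - 1) := by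
        rw [hh, norm_mul, Complex.norm_real, Real.norm_of_nonneg (by positivity),
          RCLike.norm_conj]
        nth_rewrite 2 [← Real.rpow_one ‖u x‖]
        rw [← Real.rpow_add' (norm_nonneg _) (by linarith)]
        congr 1
        ring
      rw [hn, ← Real.rpow_mul (norm_nonneg _), hpq.sub_one_mul_conj]
    have hmain := hK h hhb
    rw [hint, hhq] at hmain
    rw [hSF]
    have hStop : S ≠ ⊤ := hub.lintegral_rpow_ne_top (by linarith)
    rcases eq_or_ne S 0 with hS0 | hS0
    · rw [hS0, ENNReal.zero_rpow_of_pos (by positivity)]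
      exact zero_le
    · have hq0 := hpq.symm.pos
      have hsplit : S = S ^ (1 / p) * S ^ (1 / q) := by
        rw [← ENNReal.rpow_add _ _ hS0 hStop, one_div, one_div, hpq.inv_add_inv_eq_one,
          ENNReal.rpow_one]
      nth_rewrite 1 [hsplit] at hmain
      exact (ENNReal.mul_le_mul_iff_left (ENNReal.rpow_pos (pos_iff_ne_zero.2 hS0) hStop).ne'
        (ENNReal.rpow_ne_top_of_nonneg (by positivity) hStop)).1 hmain
  have hlim := (aecover_ball (μ := (volume : Measure V)) (x := (0 : V))
    (tendsto_natCast_atTop_atTop (R := ℝ))).lintegral_tendsto_of_countably_generated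
    (f := fun x => ‖F x‖ₑ ^ p) (by fun_prop)
  exact le_of_tendsto ((ENNReal.continuous_rpow_const.tendsto _).comp hlim)
    (Filter.Eventually.of_forall hball)

/-- Dispersive decay of the half-wave propagator, for frequency-side data. -/
theorem exists_lpNorm_halfWave_le [Nontrivial V] {p q : ℝ} (hp : 2 < p) (hq : q = p / (p - 1)) :
    ∃ C : ℝ, 0 < C ∧ ∀ t : ℝ, t ≠ 0 → ∀ ψ : V → ℂ, Integrable ψ →
      let φ : V → ℂ := fun ξ =>
        ((rad ξ ^ ((Module.finrank ℝ V + 1) * (1 / 2 - 1 / p)) : ℝ) : ℂ) * ψ ξ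
      Integrable φ → MemLp φ 2 →
      lpNorm p (𝓕⁻ fun ξ => Complex.exp (Complex.I * (t * rad ξ : ℝ)) * ψ ξ) ≤
        ENNReal.ofReal (C * |t| ^ (-((Module.finrank ℝ V - 1) * (1 / 2 - 1 / p)))) *
          lpNorm q (𝓕⁻ φ) := by
  obtain ⟨C, hC, hK⟩ := exists_enorm_integral_le (V := V) hp hq
  have hpq : p.HolderConjugate q := hq ▸ Real.HolderConjugate.conjExponent (by linarith)
  refine ⟨C, hC, ?_⟩
  intro t ht ψ hψ φ hφ hφ2
  have hcr := continuous_rad (V := V)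
  have hi : Integrable fun ξ : V => Complex.exp (Complex.I * (t * rad ξ : ℝ)) * ψ ξ :=
    hψ.bdd_mul (c := 1) (Continuous.aestronglyMeasurable (by fun_prop))
      (Filter.Eventually.of_forall fun ξ => (norm_cexp_I_mul_ofReal _).le)
  refine lpNorm_le_of_forall_enorm_integral_mul_le hp hpq (continuous_fourierInv hi).measurable
    (norm_fourierInv_le _) fun h hh => ?_
  rw [integral_fourierInv_mul_eq hi hh.integrable, mul_assoc]
  exact hK t ht ψ h hψ hh hφ hφ2

theorem isBddIntegrable_rad_rpow_mul (f : 𝓢(V, ℂ)) {β : ℝ} (hβ : 0 ≤ β) :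
    IsBddIntegrable fun ξ => ((rad ξ ^ β : ℝ) : ℂ) * f ξ := by
  obtain ⟨k, hk⟩ := exists_nat_ge β
  have hcont : Continuous fun ξ => ((rad ξ ^ β : ℝ) : ℂ) * f ξ := by
    have := f.continuous
    have h1 : Continuous fun ξ : V => rad ξ ^ β :=
      continuous_rad.rpow_const fun _ => Or.inr hβ
    fun_prop
  have hle : ∀ ξ, ‖((rad ξ ^ β : ℝ) : ℂ) * f ξ‖ ≤
      ‖ξ‖ ^ 0 * ‖f ξ‖ + (2 * Real.pi) ^ k * (‖ξ‖ ^ k * ‖f ξ‖) := fun ξ => by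
    have h0 := rad_nonneg ξ
    have h1 : rad ξ ^ β ≤ 1 + rad ξ ^ k := by
      rcases le_total (rad ξ) 1 with h | h
      · exact (Real.rpow_le_one h0 h hβ).trans (by simp; positivity)
      · rw [← Real.rpow_natCast]
        exact (Real.rpow_le_rpow_of_exponent_le h hk).trans (by simp)
    rw [norm_mul, Complex.norm_real, Real.norm_of_nonneg (by positivity)]
    refine (mul_le_mul_of_nonneg_right h1 (norm_nonneg _)).trans (le_of_eq ?_)
    rw [rad]
    ring
  obtain ⟨C₀, _, hC₀⟩ := f.decay 0 0
  obtain ⟨C₁, _, hC₁⟩ := f.decay k 0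
  simp only [norm_iteratedFDeriv_zero] at hC₀ hC₁
  refine ⟨hcont.measurable, ?_, C₀ + (2 * Real.pi) ^ k * C₁, fun ξ => (hle ξ).trans ?_⟩
  · exact ((f.integrable_pow_mul volume 0).add
      ((f.integrable_pow_mul volume k).const_mul _)).mono' hcont.aestronglyMeasurable
      (Filter.Eventually.of_forall hle)
  · have := hC₀ ξ
    have := hC₁ ξ
    gcongr

end HalfWave

/-- **Dispersive decay for the half wave in `L^p`, `2 ≤ p < ∞`.** -/
theorem halfWave_dispersive_decay (d : ℕ) (hd : 2 ≤ d) (p : ℝ) (hp : 2 ≤ p) :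
    ∃ C : ℝ≥0, ∀ (σ : ℝ), (σ = 1 ∨ σ = -1) →
      ∀ (f : 𝓢(Ed d, ℂ)) (t : ℝ), t ≠ 0 →
        eLpNorm (halfWaveD d σ t (⇑f)) (ENNReal.ofReal p) volume ≤
          (C : ℝ≥0∞) *
            ENNReal.ofReal (|t| ^ (-(((d:ℝ) - 1) * (1/2 - 1/p)))) *
            eLpNorm (absGradD d (((d:ℝ) + 1) * (1/2 - 1/p)) (⇑f))
              (ENNReal.ofReal (p / (p - 1))) volume := by
  rcases hp.eq_or_lt with rfl | hp2
  · refine ⟨1, fun σ hσ f t ht => ?_⟩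
    have hf := (𝓕 f).integrable (μ := volume)
    have hf2 := (𝓕 f).memLp 2 (μ := volume)
    have hexp : ∀ ξ : Ed d, ‖Complex.exp (Complex.I * (σ * (2 * Real.pi * t * ‖ξ‖)))‖ = 1 :=
      fun ξ => by
        have := HalfWave.norm_cexp_I_mul_ofReal (σ * (2 * Real.pi * t * ‖ξ‖))
        push_cast at this
        exact this
    have hm : AEStronglyMeasurable
        (fun ξ : Ed d => Complex.exp (Complex.I * (σ * (2 * Real.pi * t * ‖ξ‖)))) volume :=
      Continuous.aestronglyMeasurable (by fun_prop)
    have hle : ∀ ξ : Ed d,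
        ‖Complex.exp (Complex.I * (σ * (2 * Real.pi * t * ‖ξ‖))) * (𝓕 f) ξ‖ = ‖(𝓕 f) ξ‖ :=
      fun ξ => by rw [norm_mul, hexp, one_mul]
    have h1 : eLpNorm (halfWaveD d σ t ⇑f) 2 volume = eLpNorm (⇑(𝓕 f : 𝓢(Ed d, ℂ))) 2 volume := by
      rw [halfWaveD, fmulD, ← fourier_coe, HalfWave.eLpNorm_fourierInv]
      · exact eLpNorm_congr_norm_ae (Filter.Eventually.of_forall hle)
      · exact hf.norm.mono' (hm.mul hf.1) (Filter.Eventually.of_forall fun ξ => (hle ξ).le)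
      · exact hf2.of_le (hm.mul hf.1) (Filter.Eventually.of_forall fun ξ => (hle ξ).le)
    have h2 : eLpNorm (absGradD d (((d : ℝ) + 1) * (1 / 2 - 1 / 2)) ⇑f) 2 volume =
        eLpNorm (⇑(𝓕 f : 𝓢(Ed d, ℂ))) 2 volume := by
      rw [absGradD, fmulD, ← fourier_coe]
      simp only [sub_self, mul_zero, Real.rpow_zero, Complex.ofReal_one, one_mul]
      exact HalfWave.eLpNorm_fourierInv hf hf2
    have h3 : ENNReal.ofReal 2 = 2 := by simp
    have h4 : (2 : ℝ) / (2 - 1) = 2 := by norm_num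
    rw [h4, h3, h1, h2]
    simp
  · have : Nontrivial (Ed d) := by
      apply Module.nontrivial_of_finrank_pos (R := ℝ)
      rw [finrank_euclideanSpace_fin]
      omega
    have hα : 0 ≤ 1 / 2 - 1 / p := by
      rw [sub_nonneg]; exact one_div_le_one_div_of_le two_pos hp
    obtain ⟨C, hC, hK⟩ := HalfWave.exists_lpNorm_halfWave_le (V := Ed d) hp2 rfl
    rw [finrank_euclideanSpace_fin] at hK
    refine ⟨C.toNNReal, fun σ hσ f t ht => ?_⟩
    have hφ := HalfWave.isBddIntegrable_rad_rpow_mul (𝓕 f)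
      (mul_nonneg (by positivity : (0 : ℝ) ≤ d + 1) hα)
    have hσt : σ * t ≠ 0 := mul_ne_zero (by rcases hσ with rfl | rfl <;> norm_num) ht
    have habs : |σ * t| = |t| := by rcases hσ with rfl | rfl <;> simp
    have h := hK (σ * t) hσt (⇑(𝓕 f : 𝓢(Ed d, ℂ))) (𝓕 f).integrable hφ.integrable hφ.memLp_two
    rw [habs, ENNReal.ofReal_mul hC.le] at h
    rw [HalfWave.eLpNorm_eq_lpNorm (by linarith),
      HalfWave.eLpNorm_eq_lpNorm (div_pos (by linarith) (by linarith))]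
    have hsymb : ∀ ξ : Ed d, Complex.exp (Complex.I * (σ * (2 * Real.pi * t * ‖ξ‖))) =
        Complex.exp (Complex.I * (σ * t * HalfWave.rad ξ : ℝ)) := fun ξ => by
      rw [HalfWave.rad]
      congr 2
      push_cast
      ring
    simp only [halfWaveD, fmulD, hsymb]
    exact h

end
end

section
/- (L^∞ dispersive decay for the half wave with Besov data.) Fix d ≥ 2. There is a constant C (depending only on d and the Littlewood–Paley bump φ) such that for every Schwartz function f on ℝ^d, every t ≠ 0, and either choice of sign, ‖ e^{±it|∇|} f ‖_{L^∞(ℝ^d)} ≤ Σ_{N∈2^ℤ} ‖ e^{±it|∇|} P_N f ‖_{L^∞(ℝ^d)} ≤ C · |t|^{−(d−1)/2} · ‖ f ‖_{Ḃ^{(d+1)/2}_{1,1}}. -/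
open MeasureTheory SchwartzMap Metric Set
open scoped ENNReal NNReal FourierTransform RealInnerProductSpace

noncomputable section

/-- Glasser's substitution `w = z r - a / r` in a Gaussian integral. -/
lemma integral_inv_sq_mul_exp {z a : ℝ} (hz : 0 < z) (ha : 0 < a) :
    ∫ r in Ioi (0:ℝ), 2 * (r ^ 2)⁻¹ * Real.exp (-Real.pi * (z ^ 2 * r ^ 2 + a ^ 2 / r ^ 2)) =
      Real.exp (-2 * Real.pi * z * a) / a := by
  set w : ℝ → ℝ := fun r => z * r - a / r with hw
  set G : ℝ → ℝ := fun y => Real.exp (-Real.pi * y ^ 2) with hG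
  have hGint : ∫ y, G y = 1 := by
    rw [hG, integral_gaussian, div_self Real.pi_ne_zero, Real.sqrt_one]
  have hderiv : ∀ r ∈ Ioi (0:ℝ), HasDerivWithinAt w (z + a / r ^ 2) (Ioi 0) r := by
    intro r hr
    have hr' : r ≠ 0 := (mem_Ioi.1 hr).ne'
    have h := ((hasDerivAt_id r).const_mul z).sub ((hasDerivAt_inv hr').const_mul a)
    refine (h.congr_deriv ?_).hasDerivWithinAt.congr_of_eventuallyEq ?_ ?_
    · field_simp; ring
    · exact Filter.Eventually.of_forall fun y => by simp [hw, div_eq_mul_inv]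
    · simp [hw, div_eq_mul_inv]
  have hmono : StrictMonoOn w (Ioi 0) := by
    intro r hr s hs hrs
    have h1 : a / s < a / r := div_lt_div_of_pos_left ha hr hrs
    have h2 : z * r < z * s := mul_lt_mul_of_pos_left hrs hz
    simp only [hw]; linarith
  have himage : w '' Ioi 0 = univ := by
    refine eq_univ_of_forall fun y => ?_
    have hs : 0 < √(y ^ 2 + 4 * z * a) := by positivity
    have hsq : √(y ^ 2 + 4 * z * a) ^ 2 = y ^ 2 + 4 * z * a := Real.sq_sqrt (by positivity)
    have hys : 0 < y + √(y ^ 2 + 4 * z * a) := by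
      have : |y| < √(y ^ 2 + 4 * z * a) := by
        rw [← Real.sqrt_sq_eq_abs]
        exact Real.sqrt_lt_sqrt (sq_nonneg _) (by nlinarith [mul_pos hz ha])
      linarith [neg_abs_le y]
    refine ⟨(y + √(y ^ 2 + 4 * z * a)) / (2 * z), by simp only [mem_Ioi]; positivity, ?_⟩
    generalize √(y ^ 2 + 4 * z * a) = S at hsq hys
    have hne : y + S ≠ 0 := hys.ne'
    simp only [hw]
    field_simp
    linear_combination hsq
  have hposd : ∀ r ∈ Ioi (0:ℝ), |z + a / r ^ 2| = z + a / r ^ 2 := fun r hr =>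
    abs_of_nonneg (by positivity)
  have htot : ∫ r in Ioi (0:ℝ), (z + a / r ^ 2) * G (w r) = 1 := by
    have h := integral_image_eq_integral_abs_deriv_smul measurableSet_Ioi hderiv hmono.injOn G
    rw [himage, Measure.restrict_univ, hGint] at h
    rw [h]
    exact setIntegral_congr_fun measurableSet_Ioi fun r hr => by simp [hposd r hr]
  have hfint : IntegrableOn (fun r => (z + a / r ^ 2) * G (w r)) (Ioi 0) := by
    by_contra h
    rw [integral_undef h] at htot
    exact zero_ne_one htot
  have hGpos : ∀ y, 0 < G y := fun y => Real.exp_pos _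
  have hmeas : Measurable fun r => G (w r) := by
    simp only [hG, hw]; fun_prop
  have hintA : IntegrableOn (fun r => z * G (w r)) (Ioi 0) := by
    refine Integrable.mono' hfint (by fun_prop) ?_
    filter_upwards [ae_restrict_mem measurableSet_Ioi] with r hr
    have := hGpos (w r)
    rw [Real.norm_of_nonneg (by positivity)]
    have : 0 ≤ a / r ^ 2 := by positivity
    nlinarith
  have hintB : IntegrableOn (fun r => a / r ^ 2 * G (w r)) (Ioi 0) := by
    refine Integrable.mono' hfint (by fun_prop) ?_
    filter_upwards [ae_restrict_mem measurableSet_Ioi] with r hr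
    have := hGpos (w r)
    rw [Real.norm_of_nonneg (by positivity)]
    nlinarith
  have hAB : ∫ r in Ioi (0:ℝ), z * G (w r) = ∫ r in Ioi (0:ℝ), a / r ^ 2 * G (w r) := by
    have hd : ∀ r ∈ Ioi (0:ℝ), HasDerivWithinAt (fun r : ℝ => a / z * r⁻¹)
        (a / z * -(r ^ 2)⁻¹) (Ioi 0) r := fun r hr =>
      ((hasDerivAt_inv (mem_Ioi.1 hr).ne').const_mul (a / z)).hasDerivWithinAt
    have hinj : InjOn (fun r : ℝ => a / z * r⁻¹) (Ioi 0) := fun r _ s _ hrs => by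
      have : a / z ≠ 0 := by positivity
      simpa [this] using hrs
    have him : (fun r : ℝ => a / z * r⁻¹) '' Ioi 0 = Ioi 0 := by
      ext y
      simp only [mem_image, mem_Ioi]
      constructor
      · rintro ⟨r, hr, rfl⟩; positivity
      · intro hy
        exact ⟨a / z * y⁻¹, by positivity, by field_simp⟩
    have h := integral_image_eq_integral_abs_deriv_smul measurableSet_Ioi hd hinj
      (fun r => z * G (w r))
    rw [him] at h
    rw [h]
    refine setIntegral_congr_fun measurableSet_Ioi fun r hr => ?_
    have hr0 : 0 < r := hr
    have h1 : w (a / z * r⁻¹) = - w r := by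
      simp only [hw]; field_simp; ring
    have h2 : |a / z * -(r ^ 2)⁻¹| = a / z * (r ^ 2)⁻¹ := by
      rw [mul_neg, abs_neg, abs_of_pos (by positivity)]
    simp only [h1, h2, hG, neg_sq, smul_eq_mul]
    field_simp
  have hB : ∫ r in Ioi (0:ℝ), a / r ^ 2 * G (w r) = 1 / 2 := by
    have : ∫ r in Ioi (0:ℝ), (z + a / r ^ 2) * G (w r) =
        (∫ r in Ioi (0:ℝ), z * G (w r)) + ∫ r in Ioi (0:ℝ), a / r ^ 2 * G (w r) := by
      rw [← integral_add hintA hintB]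
      simp only [add_mul]
    linarith
  have : ∀ r ∈ Ioi (0:ℝ),
      2 * (r ^ 2)⁻¹ * Real.exp (-Real.pi * (z ^ 2 * r ^ 2 + a ^ 2 / r ^ 2)) =
        (2 / a * Real.exp (-2 * Real.pi * z * a)) * (a / r ^ 2 * G (w r)) := by
    intro r hr
    have hr0 : r ≠ 0 := (mem_Ioi.1 hr).ne'
    have : Real.exp (-Real.pi * (z ^ 2 * r ^ 2 + a ^ 2 / r ^ 2)) =
        Real.exp (-2 * Real.pi * z * a) * G (w r) := by
      simp only [hG, hw, ← Real.exp_add]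
      congr 1
      field_simp
      ring
    rw [this]
    field_simp
  rw [setIntegral_congr_fun measurableSet_Ioi this, integral_const_mul, hB]
  ring

lemma integrable_norm_rpow_mul_exp_neg {d : ℕ} (hd : 1 ≤ d) {q c : ℝ} (hq : -d < q)
    (hc : 0 < c) : Integrable fun ξ : Ed d => ‖ξ‖ ^ q * Real.exp (-c * ‖ξ‖) := by
  have : NeZero d := ⟨by omega⟩
  rw [integrable_fun_norm_addHaar volume (f := fun y : ℝ => y ^ q * Real.exp (-c * y))]
  have h := integrableOn_rpow_mul_exp_neg_mul_rpow (p := 1) (s := (d - 1 : ℕ) + q) (b := c)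
    (by push_cast [Nat.cast_sub hd]; linarith) one_pos hc
  refine h.congr_fun (fun y hy => ?_) measurableSet_Ioi
  have hy : 0 < y := hy
  simp only [Real.rpow_one, finrank_euclideanSpace, Fintype.card_fin, smul_eq_mul]
  rw [Real.rpow_add hy, Real.rpow_natCast, mul_assoc]

/-- The symbol `e^{-2π z |ξ|} / |ξ|` with complex time `z`. -/
def poissonSymbol (d : ℕ) (z : ℂ) (ξ : Ed d) : ℂ :=
  Complex.exp (-(2 * Real.pi * z * ‖ξ‖)) / ‖ξ‖

lemma norm_poissonSymbol (d : ℕ) (z : ℂ) (ξ : Ed d) :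
    ‖poissonSymbol d z ξ‖ = ‖ξ‖ ^ (-1 : ℝ) * Real.exp (-(2 * Real.pi * z.re) * ‖ξ‖) := by
  rw [poissonSymbol, norm_div, Complex.norm_exp, Real.rpow_neg_one, div_eq_inv_mul]
  simp

lemma measurable_poissonSymbol (d : ℕ) (z : ℂ) : Measurable (poissonSymbol d z) := by
  unfold poissonSymbol; fun_prop

lemma integrable_poissonSymbol {d : ℕ} (hd : 2 ≤ d) {z : ℂ} (hz : 0 < z.re) :
    Integrable (poissonSymbol d z) := by
  have hd' : (2:ℝ) ≤ d := by exact_mod_cast hd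
  have h := integrable_norm_rpow_mul_exp_neg (d := d) (by omega) (q := -1)
    (c := 2 * Real.pi * z.re) (by linarith) (by positivity)
  refine h.mono' (measurable_poissonSymbol d z).aestronglyMeasurable ?_
  exact Filter.Eventually.of_forall fun ξ => (norm_poissonSymbol d z ξ).le

lemma ae_norm_pos {d : ℕ} (hd : 1 ≤ d) : ∀ᵐ ξ : Ed d, 0 < ‖ξ‖ := by
  have : NeZero d := ⟨by omega⟩
  have : ∀ᵐ ξ : Ed d, ξ ≠ 0 := by simp [ae_iff]
  filter_upwards [this] with ξ hξ using norm_pos_iff.2 hξ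

/-- The inverse Fourier transform of a Gaussian of width `r⁻¹`. -/
lemma fourierInv_gaussian_inv_sq {d : ℕ} {r : ℝ} (hr : 0 < r) (x : Ed d) :
    𝓕⁻ (fun ξ : Ed d => ((Real.exp (-Real.pi * (‖ξ‖ ^ 2 / r ^ 2)) : ℝ) : ℂ)) x =
      ((r ^ d * Real.exp (-Real.pi * (‖x‖ ^ 2 * r ^ 2)) : ℝ) : ℂ) := by
  have hb : 0 < (((Real.pi / r ^ 2 : ℝ) : ℂ)).re := by
    rw [Complex.ofReal_re]; positivity
  have h := fourier_gaussian_innerProductSpace hb (-x)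
  rw [Real.fourierInv_eq_fourier_neg]
  convert h using 2
  · ext ξ
    push_cast
    congr 1
    ring
  · have h1 : (Real.pi : ℂ) / ((Real.pi / r ^ 2 : ℝ) : ℂ) = ((r ^ 2 : ℝ) : ℂ) := by
      have := Real.pi_ne_zero
      rw [← Complex.ofReal_div]
      congr 1
      field_simp
    have h2 : ((r ^ 2 : ℝ) : ℂ) ^ ((Module.finrank ℝ (Ed d) : ℂ) / 2) = ((r ^ d : ℝ) : ℂ) := by
      have : ((Module.finrank ℝ (Ed d) : ℂ) / 2) = (((d : ℝ) / 2 : ℝ) : ℂ) := by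
        simp
      rw [this, ← Complex.ofReal_cpow (by positivity), ← Real.rpow_natCast, ← Real.rpow_mul hr.le]
      congr 1
      rw [← Real.rpow_natCast]
      congr 1
      push_cast; ring
    rw [h1, h2, norm_neg]
    push_cast
    congr 2
    have := Real.pi_ne_zero
    field_simp

/-- The constant in the kernel of `e^{-2π z |∇|} / |∇|`. -/
def poissonConst (d : ℕ) : ℝ :=
  Real.pi ^ (-(((d:ℝ) - 1) / 2)) * Real.Gamma (((d:ℝ) - 1) / 2)

lemma fourierInv_poissonSymbol_ofReal {d : ℕ} (hd : 2 ≤ d) {z : ℝ} (hz : 0 < z) (x : Ed d) :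
    𝓕⁻ (poissonSymbol d z) x =
      ((poissonConst d * (z ^ 2 + ‖x‖ ^ 2) ^ (-(((d:ℝ) - 1) / 2)) : ℝ) : ℂ) := by
  have hd' : (2:ℝ) ≤ d := by exact_mod_cast hd
  set k : Ed d → ℝ → ℝ := fun ξ r =>
    2 * (r ^ 2)⁻¹ * Real.exp (-Real.pi * (z ^ 2 * r ^ 2 + ‖ξ‖ ^ 2 / r ^ 2)) with hk
  have hk0 : ∀ ξ r, 0 ≤ k ξ r := fun ξ r => by positivity
  have hkint : ∀ ξ : Ed d, 0 < ‖ξ‖ →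
      ∫ r in Ioi (0:ℝ), k ξ r = Real.exp (-2 * Real.pi * z * ‖ξ‖) / ‖ξ‖ :=
    fun ξ hξ => integral_inv_sq_mul_exp hz hξ
  set F : Ed d → ℝ → ℂ := fun ξ r => Real.fourierChar ⟪ξ, x⟫ • (k ξ r : ℂ) with hF
  have hFnorm : ∀ ξ r, ‖F ξ r‖ = k ξ r := fun ξ r => by
    simp only [hF]
    rw [Circle.norm_smul, Complex.norm_real, Real.norm_of_nonneg (hk0 ξ r)]
  have hkmeas : Measurable (Function.uncurry k) := by
    simp only [hk, Function.uncurry_def]; fun_prop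
  have hFmeas : Measurable (Function.uncurry F) := by
    have : Measurable (fun p : Ed d × ℝ => ((Real.fourierChar ⟪p.1, x⟫ : Circle) : ℂ)) := by
      have : Continuous (fun p : Ed d × ℝ => ((Real.fourierChar ⟪p.1, x⟫ : Circle) : ℂ)) := by
        simp only [Real.fourierChar_apply]; fun_prop
      exact this.measurable
    exact this.mul (Complex.measurable_ofReal.comp hkmeas)
  have hFint : Integrable (Function.uncurry F) (volume.prod (volume.restrict (Ioi 0))) := by
    rw [integrable_prod_iff hFmeas.aestronglyMeasurable]
    constructor
    · filter_upwards [ae_norm_pos (d := d) (by omega)] with ξ hξ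
      have h1 : Integrable (k ξ) (volume.restrict (Ioi 0)) := by
        by_contra h
        have := hkint ξ hξ
        rw [integral_undef h] at this
        have : 0 < Real.exp (-2 * Real.pi * z * ‖ξ‖) / ‖ξ‖ := by positivity
        linarith
      refine h1.mono' (hFmeas.comp measurable_prodMk_left).aestronglyMeasurable ?_
      exact Filter.Eventually.of_forall fun r => (hFnorm ξ r).le
    · refine (integrable_poissonSymbol hd (z := z) (by simpa using hz)).norm.congr ?_
      filter_upwards [ae_norm_pos (d := d) (by omega)] with ξ hξ
      simp only [Function.uncurry_apply_pair, hFnorm]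
      rw [hkint ξ hξ, norm_poissonSymbol, Real.rpow_neg_one, div_eq_inv_mul]
      simp
  calc 𝓕⁻ (poissonSymbol d z) x
      = ∫ ξ, ∫ r in Ioi (0:ℝ), F ξ r := by
        rw [Real.fourierInv_eq]
        refine integral_congr_ae ?_
        filter_upwards [ae_norm_pos (d := d) (by omega)] with ξ hξ
        simp only [hF, Circle.smul_def, smul_eq_mul]
        rw [integral_const_mul, integral_complex_ofReal, hkint ξ hξ, poissonSymbol]
        push_cast
        congr 4
        ring
    _ = ∫ r in Ioi (0:ℝ), ∫ ξ, F ξ r := integral_integral_swap hFint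
    _ = ∫ r in Ioi (0:ℝ), ((2 * (r ^ ((d:ℝ) - 2) *
          Real.exp (-(Real.pi * (z ^ 2 + ‖x‖ ^ 2)) * r ^ (2:ℝ))) : ℝ) : ℂ) := by
        refine setIntegral_congr_fun measurableSet_Ioi fun r hr => ?_
        have hr : 0 < r := hr
        have h1 : ∀ ξ, F ξ r = ((2 * (r ^ 2)⁻¹ * Real.exp (-Real.pi * (z ^ 2 * r ^ 2)) : ℝ) : ℂ) *
            (Real.fourierChar ⟪ξ, x⟫ •
              ((Real.exp (-Real.pi * (‖ξ‖ ^ 2 / r ^ 2)) : ℝ) : ℂ)) := by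
          intro ξ
          simp only [hF, hk, mul_add, Real.exp_add, Circle.smul_def, smul_eq_mul]
          push_cast
          ring
        simp only [h1]
        rw [integral_const_mul, ← Real.fourierInv_eq, fourierInv_gaussian_inv_sq hr,
          ← Complex.ofReal_mul]
        congr 1
        rw [Real.rpow_sub hr, Real.rpow_natCast, Real.rpow_two,
          show -(Real.pi * (z ^ 2 + ‖x‖ ^ 2)) * r ^ 2 =
            -Real.pi * (z ^ 2 * r ^ 2) + -Real.pi * (‖x‖ ^ 2 * r ^ 2) by ring, Real.exp_add]
        ring
    _ = _ := by
        rw [integral_complex_ofReal, integral_const_mul,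
          integral_rpow_mul_exp_neg_mul_rpow two_pos (by linarith) (by positivity), poissonConst,
          Real.mul_rpow Real.pi_pos.le (by positivity)]
        congr 1
        rw [show -((d:ℝ) - 2 + 1) / 2 = -(((d:ℝ) - 1) / 2) by ring,
          show ((d:ℝ) - 2 + 1) / 2 = (((d:ℝ) - 1) / 2) by ring]
        ring

lemma differentiableOn_fourierInv_poissonSymbol {d : ℕ} (hd : 2 ≤ d) (x : Ed d) :
    DifferentiableOn ℂ (fun z => 𝓕⁻ (poissonSymbol d z) x) {z | 0 < z.re} := by
  intro z₀ hz₀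
  have hz₀ : 0 < z₀.re := hz₀
  refine DifferentiableAt.differentiableWithinAt ?_
  simp only [Real.fourierInv_eq]
  have hchar : Measurable (fun ξ : Ed d => ((Real.fourierChar ⟪ξ, x⟫ : Circle) : ℂ)) := by
    have : Continuous (fun ξ : Ed d => ((Real.fourierChar ⟪ξ, x⟫ : Circle) : ℂ)) := by
      simp only [Real.fourierChar_apply]; fun_prop
    exact this.measurable
  have hmeas : ∀ z, AEStronglyMeasurable
      (fun ξ : Ed d => Real.fourierChar ⟪ξ, x⟫ • poissonSymbol d z ξ) volume := fun z =>
    (hchar.mul (measurable_poissonSymbol d z)).aestronglyMeasurable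
  set F' : ℂ → Ed d → ℂ := fun z ξ =>
    Real.fourierChar ⟪ξ, x⟫ • (-(2 * Real.pi) * Complex.exp (-(2 * Real.pi * z * ‖ξ‖))) with hF'
  have hs : {z : ℂ | z₀.re / 2 < z.re} ∈ nhds z₀ :=
    (isOpen_lt continuous_const Complex.continuous_re).mem_nhds (by simp; linarith)
  have hd' : (2:ℝ) ≤ d := by exact_mod_cast hd
  refine (hasDerivAt_integral_of_dominated_loc_of_deriv_le (F' := F')
    (bound := fun ξ => 2 * Real.pi * (‖ξ‖ ^ (0:ℝ) * Real.exp (-(Real.pi * z₀.re) * ‖ξ‖))) hs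
    (Filter.Eventually.of_forall hmeas) ?_ ?_ ?_ ?_ ?_).2.differentiableAt
  · refine (integrable_poissonSymbol hd hz₀).mono (hmeas z₀) ?_
    exact Filter.Eventually.of_forall fun ξ => by rw [Circle.norm_smul]
  · have : Measurable fun ξ : Ed d =>
        -(2 * (Real.pi:ℂ)) * Complex.exp (-(2 * Real.pi * z₀ * ‖ξ‖)) := by fun_prop
    exact (hchar.mul this).aestronglyMeasurable
  · refine Filter.Eventually.of_forall fun ξ z hz => ?_
    have hz : z₀.re / 2 < z.re := hz
    simp only [hF']
    rw [Circle.norm_smul, norm_mul, Complex.norm_exp, Real.rpow_zero, one_mul]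
    have h1 : ‖-(2 * (Real.pi : ℂ))‖ = 2 * Real.pi := by
      simp [Real.pi_pos.le]
    rw [h1]
    gcongr
    simp only [Complex.neg_re, Complex.mul_re, Complex.re_ofNat, Complex.im_ofNat,
      Complex.ofReal_re, Complex.ofReal_im, Complex.mul_im]
    have := mul_le_mul_of_nonneg_right hz.le (norm_nonneg ξ)
    nlinarith [Real.pi_pos]
  · exact (integrable_norm_rpow_mul_exp_neg (by omega) (by linarith) (by positivity)).const_mul _
  · filter_upwards [ae_norm_pos (d := d) (by omega)] with ξ hξ z _
    have hξ' : (‖ξ‖ : ℂ) ≠ 0 := by exact_mod_cast hξ.ne'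
    have h1 : HasDerivAt (fun z : ℂ => -(2 * Real.pi * z * ‖ξ‖)) (-(2 * Real.pi * ‖ξ‖)) z := by
      have : HasDerivAt (fun z : ℂ => 2 * Real.pi * z * ‖ξ‖) (2 * Real.pi * ‖ξ‖) z := by
        simpa using ((hasDerivAt_id z).const_mul (2 * (Real.pi:ℂ))).mul_const (‖ξ‖:ℂ)
      exact this.neg
    have h2 := (h1.cexp.div_const (‖ξ‖:ℂ)).const_mul ((Real.fourierChar ⟪ξ, x⟫ : Circle) : ℂ)
    refine h2.congr_deriv ?_
    simp only [hF', Circle.smul_def, smul_eq_mul]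
    field_simp

lemma sq_add_sq_mem_slitPlane {z : ℂ} (hz : 0 < z.re) (a : ℝ) :
    z ^ 2 + (a:ℂ) ^ 2 ∈ Complex.slitPlane := by
  rw [Complex.mem_slitPlane_iff]
  by_cases h : z.im = 0
  · left
    simp [pow_two, h]
    nlinarith [mul_self_nonneg a]
  · right
    simp [pow_two]
    rw [mul_comm, ← two_mul]
    have := hz.ne'
    positivity

/-- The kernel of `e^{-2π z |∇|} / |∇|`, for complex times `z` in the right half plane. -/
lemma fourierInv_poissonSymbol {d : ℕ} (hd : 2 ≤ d) {z : ℂ} (hz : 0 < z.re) (x : Ed d) :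
    𝓕⁻ (poissonSymbol d z) x =
      poissonConst d * (z ^ 2 + (‖x‖:ℂ) ^ 2) ^ ((-(((d:ℝ) - 1) / 2) : ℝ) : ℂ) := by
  have hopen : IsOpen {z : ℂ | 0 < z.re} := isOpen_lt continuous_const Complex.continuous_re
  have hconv : IsPreconnected {z : ℂ | 0 < z.re} :=
    (convex_halfSpace_re_gt 0).isPreconnected
  have hf := (differentiableOn_fourierInv_poissonSymbol hd x).analyticOnNhd hopen
  have hg : AnalyticOnNhd ℂ (fun z : ℂ =>
      poissonConst d * (z ^ 2 + (‖x‖:ℂ) ^ 2) ^ ((-(((d:ℝ) - 1) / 2) : ℝ) : ℂ))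
      {z : ℂ | 0 < z.re} := by
    refine DifferentiableOn.analyticOnNhd (fun w hw => ?_) hopen
    refine DifferentiableAt.differentiableWithinAt ?_
    have h := sq_add_sq_mem_slitPlane hw ‖x‖
    refine DifferentiableAt.const_mul ?_ _
    exact DifferentiableAt.cpow_const (by fun_prop) h
  refine hf.eqOn_of_preconnected_of_frequently_eq hg hconv (z₀ := 1) (by simp) ?_ hz
  have hreal : ∀ y : ℝ, 0 < y → 𝓕⁻ (poissonSymbol d (y:ℂ)) x =
      poissonConst d * ((y:ℂ) ^ 2 + (‖x‖:ℂ) ^ 2) ^ ((-(((d:ℝ) - 1) / 2) : ℝ) : ℂ) := by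
    intro y hy
    rw [fourierInv_poissonSymbol_ofReal hd hy x, Complex.ofReal_mul,
      Complex.ofReal_cpow (by positivity)]
    push_cast
    rfl
  have htend : Filter.Tendsto (fun n : ℕ => ((1 + 1 / ((n:ℝ) + 1) : ℝ) : ℂ)) Filter.atTop
      (nhdsWithin 1 {1}ᶜ) := by
    refine tendsto_nhdsWithin_iff.2 ⟨?_, Filter.Eventually.of_forall fun n => ?_⟩
    · have := (tendsto_one_div_add_atTop_nhds_zero_nat (𝕜 := ℝ)).const_add 1
      rw [add_zero] at this
      exact (Complex.continuous_ofReal.tendsto 1).comp this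
    · have : (0:ℝ) < 1 / ((n:ℝ) + 1) := by positivity
      simp only [mem_compl_iff, mem_singleton_iff]
      intro h
      have : (1 + 1 / ((n:ℝ) + 1) : ℝ) = 1 := by exact_mod_cast h
      linarith
  exact htend.frequently (Filter.Frequently.of_forall fun n => hreal _ (by positivity))

lemma poissonConst_nonneg {d : ℕ} (hd : 1 ≤ d) : 0 ≤ poissonConst d := by
  have hd' : (1:ℝ) ≤ d := by exact_mod_cast hd
  exact mul_nonneg (by positivity) (Real.Gamma_nonneg_of_nonneg (by linarith))

lemma norm_fourierInv_poissonSymbol_le {d : ℕ} (hd : 2 ≤ d) {ε t : ℝ} (hε : 0 < ε) (ht : t ≠ 0)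
    (x : Ed d) :
    ‖𝓕⁻ (poissonSymbol d (ε - t * Complex.I)) x‖ ≤
      poissonConst d * (2 * ε * |t|) ^ (-(((d:ℝ) - 1) / 2)) := by
  have hd' : (2:ℝ) ≤ d := by exact_mod_cast hd
  have hz : 0 < ((ε:ℂ) - t * Complex.I).re := by simpa using hε
  have ht' : 0 < |t| := abs_pos.2 ht
  have hne := Complex.slitPlane_ne_zero (sq_add_sq_mem_slitPlane hz ‖x‖)
  rw [fourierInv_poissonSymbol hd hz, norm_mul, Complex.norm_real,
    Real.norm_of_nonneg (poissonConst_nonneg (by omega)),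
    Complex.norm_cpow_real]
  refine mul_le_mul_of_nonneg_left ?_ (poissonConst_nonneg (by omega))
  refine Real.rpow_le_rpow_of_nonpos (by positivity) ?_ (by linarith)
  refine le_trans (le_of_eq ?_) (Complex.abs_im_le_norm _)
  simp [pow_two]
  rw [← neg_add, abs_neg, mul_comm t ε, ← two_mul, abs_mul, abs_mul, abs_of_pos hε, abs_two,
    mul_assoc]

lemma fourier_modulate {d : ℕ} (m : Ed d → ℂ) (x y : Ed d) :
    𝓕 (fun ξ => Real.fourierChar ⟪ξ, x⟫ • m ξ) y = 𝓕⁻ m (x - y) := by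
  rw [Real.fourier_eq, Real.fourierInv_eq]
  refine integral_congr_ae (Filter.Eventually.of_forall fun ξ => ?_)
  simp only
  rw [← mul_smul, ← AddChar.map_add_eq_mul, inner_sub_right]
  congr 2
  ring

/-- A Fourier multiplier with integrable symbol acts by convolution. -/
lemma fmulD_eq_integral {d : ℕ} {m g : Ed d → ℂ} (hm : Integrable m) (hg : Integrable g)
    (x : Ed d) : fmulD d m g x = ∫ y, g y * 𝓕⁻ m (x - y) := by
  have hmod : Integrable fun ξ => Real.fourierChar ⟪ξ, x⟫ • m ξ := by
    have := (Real.fourierIntegral_convergent_iff (f := m) (μ := volume) (-x)).2 hm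
    simpa using this
  have h := VectorFourier.integral_fourierIntegral_smul_eq_flip (L := innerₗ (Ed d))
    (μ := volume) (ν := volume) Real.continuous_fourierChar continuous_inner hg hmod
  rw [flip_innerₗ] at h
  calc fmulD d m g x
      = ∫ ξ, 𝓕 g ξ • (Real.fourierChar ⟪ξ, x⟫ • m ξ) := by
        rw [fmulD, Real.fourierInv_eq]
        refine integral_congr_ae (Filter.Eventually.of_forall fun ξ => ?_)
        simp only [Circle.smul_def, smul_eq_mul]
        ring
    _ = ∫ y, g y • 𝓕 (fun ξ => Real.fourierChar ⟪ξ, x⟫ • m ξ) y := h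
    _ = _ := by simp only [fourier_modulate, smul_eq_mul]

lemma enorm_fmulD_le {d : ℕ} {m g : Ed d → ℂ} (hm : Integrable m) (hg : Integrable g)
    {A : ℝ≥0∞} (hA : ∀ x, ‖𝓕⁻ m x‖ₑ ≤ A) (x : Ed d) :
    ‖fmulD d m g x‖ₑ ≤ A * ∫⁻ y, ‖g y‖ₑ := by
  rw [fmulD_eq_integral hm hg]
  refine (enorm_integral_le_lintegral_enorm _).trans ?_
  rw [mul_comm A, ← lintegral_mul_const'' _ hg.aestronglyMeasurable.enorm]
  refine lintegral_mono fun y => ?_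
  rw [enorm_mul]
  gcongr
  exact hA _

lemma lintegral_enorm_fmulD_le {d : ℕ} {m g : Ed d → ℂ} (hm : Integrable m) (hg : Integrable g)
    (hmc : Continuous (𝓕⁻ m)) (hgc : Continuous g) :
    ∫⁻ x, ‖fmulD d m g x‖ₑ ≤ (∫⁻ x, ‖𝓕⁻ m x‖ₑ) * ∫⁻ y, ‖g y‖ₑ := by
  calc ∫⁻ x, ‖fmulD d m g x‖ₑ
      ≤ ∫⁻ x, ∫⁻ y, ‖g y‖ₑ * ‖𝓕⁻ m (x - y)‖ₑ := by
        refine lintegral_mono fun x => ?_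
        rw [fmulD_eq_integral hm hg]
        refine (enorm_integral_le_lintegral_enorm _).trans ?_
        simp only [enorm_mul, le_refl]
    _ = ∫⁻ y, ∫⁻ x, ‖g y‖ₑ * ‖𝓕⁻ m (x - y)‖ₑ := by
        refine lintegral_lintegral_swap (Measurable.aemeasurable ?_)
        have h1 : Continuous fun p : Ed d × Ed d => g p.2 := by fun_prop
        have h2 : Continuous fun p : Ed d × Ed d => 𝓕⁻ m (p.1 - p.2) :=
          hmc.comp (continuous_fst.sub continuous_snd)
        exact h1.measurable.enorm.mul h2.measurable.enorm
    _ = ∫⁻ y, ‖g y‖ₑ * ∫⁻ x, ‖𝓕⁻ m x‖ₑ := by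
        refine lintegral_congr fun y => ?_
        have h2 : Continuous fun x : Ed d => 𝓕⁻ m (x - y) :=
          hmc.comp (continuous_id.sub continuous_const)
        rw [lintegral_const_mul _ h2.measurable.enorm,
          lintegral_sub_right_eq_self (fun x => ‖𝓕⁻ m x‖ₑ) y]
    _ = _ := by
        rw [lintegral_mul_const _ hgc.measurable.enorm, mul_comm]

lemma fourierInv_comp_smul {d : ℕ} (η : Ed d → ℂ) {ε : ℝ} (hε : 0 < ε) (x : Ed d) :
    𝓕⁻ (fun ξ => η (ε • ξ)) x = ((ε ^ d)⁻¹ : ℝ) • 𝓕⁻ η (ε⁻¹ • x) := by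
  have h := Measure.integral_comp_smul volume
    (fun ξ : Ed d => Real.fourierChar ⟪ξ, ε⁻¹ • x⟫ • η ξ) ε
  rw [finrank_euclideanSpace, Fintype.card_fin, abs_of_pos (by positivity)] at h
  rw [Real.fourierInv_eq, Real.fourierInv_eq, ← h]
  refine integral_congr_ae (Filter.Eventually.of_forall fun ξ => ?_)
  simp only [real_inner_smul_left, real_inner_smul_right]
  congr 2
  field_simp

lemma lintegral_enorm_fourierInv_comp_smul {d : ℕ} {η : Ed d → ℂ} (hη : Continuous (𝓕⁻ η))
    {ε : ℝ} (hε : 0 < ε) :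
    ∫⁻ x, ‖𝓕⁻ (fun ξ => η (ε • ξ)) x‖ₑ = ∫⁻ x, ‖𝓕⁻ η x‖ₑ := by
  have hε' : ε⁻¹ ≠ 0 := by positivity
  have hmap := Measure.map_addHaar_smul (volume : Measure (Ed d)) hε'
  rw [finrank_euclideanSpace, Fintype.card_fin, abs_of_pos (by positivity)] at hmap
  have hc : ∫⁻ x, ‖𝓕⁻ η (ε⁻¹ • x)‖ₑ = ENNReal.ofReal (ε ^ d) * ∫⁻ x, ‖𝓕⁻ η x‖ₑ := by
    rw [← lintegral_map hη.measurable.enorm (measurable_const_smul ε⁻¹), hmap,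
      lintegral_smul_measure, inv_pow, inv_inv, smul_eq_mul]
  have hmeas : Measurable fun x => ‖𝓕⁻ η (ε⁻¹ • x)‖ₑ :=
    (hη.comp (continuous_const_smul ε⁻¹)).measurable.enorm
  simp only [fourierInv_comp_smul η hε, enorm_smul]
  rw [lintegral_const_mul _ hmeas, hc, ← mul_assoc, Real.enorm_of_nonneg (by positivity),
    ← ENNReal.ofReal_mul (by positivity), inv_mul_cancel₀ (by positivity), ENNReal.ofReal_one,
    one_mul]

/-- A smooth compactly supported multiplier maps Schwartz functions to Schwartz functions. -/
lemma exists_schwartzMap_eq_fmulD {d : ℕ} {m : Ed d → ℂ} (hm : ContDiff ℝ (⊤ : ℕ∞) m)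
    (hsupp : HasCompactSupport m) (f : 𝓢(Ed d, ℂ)) :
    ∃ g : 𝓢(Ed d, ℂ), ⇑g = fmulD d m ⇑f ∧ ∀ ξ, 𝓕 (⇑g) ξ = m ξ * 𝓕 (⇑f) ξ := by
  have htemp := hsupp.hasTemperateGrowth hm
  refine ⟨𝓕⁻ (smulLeftCLM ℂ m (𝓕 f)), ?_, fun ξ => ?_⟩
  · rw [SchwartzMap.fourierInv_coe, fmulD, SchwartzMap.smulLeftCLM_apply htemp,
      SchwartzMap.fourier_coe]
    rfl
  · rw [← SchwartzMap.fourier_coe, FourierTransform.fourier_fourierInv_eq,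
      SchwartzMap.smulLeftCLM_apply_apply htemp, SchwartzMap.fourier_coe, smul_eq_mul]

lemma continuous_fourierInv_schwartzMap {d : ℕ} (η : 𝓢(Ed d, ℂ)) : Continuous (𝓕⁻ (⇑η)) := by
  rw [← SchwartzMap.fourierInv_coe]
  exact (𝓕⁻ η).continuous

namespace IsLPBumpD

variable {d : ℕ} {φ : Ed d → ℝ}

/-- The fattened annular cutoff, weighted by `|ξ| e^{2π|ξ|}`. -/
def weight (_ : IsLPBumpD d φ) (ξ : Ed d) : ℂ :=
  (((φ ((1 / 2 : ℝ) • ξ) - φ ((4 : ℝ) • ξ)) * (‖ξ‖ * Real.exp (2 * Real.pi * ‖ξ‖)) : ℝ) : ℂ)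

lemma weight_eq (hφ : IsLPBumpD d φ) {ξ : Ed d} (h1 : 1 / 2 ≤ ‖ξ‖) (h2 : ‖ξ‖ ≤ 2) :
    hφ.weight ξ = ((‖ξ‖ * Real.exp (2 * Real.pi * ‖ξ‖) : ℝ) : ℂ) := by
  rw [weight, hφ.eq_one _ (by rw [norm_smul]; norm_num; linarith),
    hφ.eq_zero _ (by rw [norm_smul]; norm_num; linarith)]
  simp

lemma weight_eq_zero_of_le (hφ : IsLPBumpD d φ) {ξ : Ed d} (h : ‖ξ‖ ≤ 1 / 4) :
    hφ.weight ξ = 0 := by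
  rw [weight, hφ.eq_one _ (by rw [norm_smul]; norm_num; linarith),
    hφ.eq_one _ (by rw [norm_smul]; norm_num; linarith)]
  simp

lemma contDiff_weight (hφ : IsLPBumpD d φ) : ContDiff ℝ (⊤ : ℕ∞) hφ.weight := by
  rw [contDiff_iff_contDiffAt]
  intro ξ
  by_cases hξ : ξ = 0
  · have : hφ.weight =ᶠ[nhds ξ] fun _ => 0 := by
      filter_upwards [ball_mem_nhds ξ (show (0:ℝ) < 1 / 4 by norm_num)] with y hy
      refine hφ.weight_eq_zero_of_le ?_
      rw [hξ, mem_ball_zero_iff] at hy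
      exact hy.le
    exact contDiffAt_const.congr_of_eventuallyEq this
  · have hn : ContDiffAt ℝ (⊤ : ℕ∞) (fun ξ : Ed d => ‖ξ‖) ξ := contDiffAt_norm ℝ hξ
    have h1 : ContDiff ℝ (⊤ : ℕ∞) fun ξ => φ ((1 / 2 : ℝ) • ξ) :=
      hφ.smooth.comp (contDiff_const_smul _)
    have h2 : ContDiff ℝ (⊤ : ℕ∞) fun ξ => φ ((4 : ℝ) • ξ) :=
      hφ.smooth.comp (contDiff_const_smul _)
    have h3 := (h1.sub h2).contDiffAt.mul (hn.mul ((contDiffAt_const (c := 2 * Real.pi)).mul hn).exp) (x := ξ)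
    exact Complex.ofRealCLM.contDiff.contDiffAt.comp ξ h3

lemma hasCompactSupport_weight (hφ : IsLPBumpD d φ) : HasCompactSupport hφ.weight := by
  refine HasCompactSupport.intro (isCompact_closedBall (0 : Ed d) 4) fun ξ hξ => ?_
  rw [mem_closedBall_zero_iff, not_le] at hξ
  rw [weight, hφ.eq_zero _ (by rw [norm_smul]; norm_num; linarith),
    hφ.eq_zero _ (by rw [norm_smul]; norm_num; linarith)]
  simp

lemma lintegral_fourierInv_weight_lt_top (hφ : IsLPBumpD d φ) :
    ∫⁻ x, ‖𝓕⁻ hφ.weight x‖ₑ < ∞ := by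
  have h : Integrable
      ⇑(𝓕⁻ (hφ.hasCompactSupport_weight.toSchwartzMap hφ.contDiff_weight) : 𝓢(Ed d, ℂ)) :=
    SchwartzMap.integrable _
  rw [SchwartzMap.fourierInv_coe] at h
  exact h.2

lemma continuous_fourierInv_weight (hφ : IsLPBumpD d φ) : Continuous (𝓕⁻ hφ.weight) :=
  continuous_fourierInv_schwartzMap
    (hφ.hasCompactSupport_weight.toSchwartzMap hφ.contDiff_weight)

/-- Dispersive estimate for data with frequencies in an annulus of size `ε⁻¹`. -/
lemma enorm_halfWaveD_le (hφ : IsLPBumpD d φ) (hd : 2 ≤ d) {ε σ t : ℝ} (hε : 0 < ε)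
    (hσt : σ * t ≠ 0) (g : 𝓢(Ed d, ℂ))
    (hg : ∀ ξ, 𝓕 (⇑g) ξ ≠ 0 → 1 / 2 ≤ ε * ‖ξ‖ ∧ ε * ‖ξ‖ ≤ 2) (x : Ed d) :
    ‖halfWaveD d σ t (⇑g) x‖ₑ ≤
      ENNReal.ofReal (ε⁻¹ * (poissonConst d * (2 * ε * |σ * t|) ^ (-(((d:ℝ) - 1) / 2)))) *
        ((∫⁻ y, ‖𝓕⁻ hφ.weight y‖ₑ) * ∫⁻ y, ‖g y‖ₑ) := by
  have hsm : ContDiff ℝ (⊤ : ℕ∞) fun ξ : Ed d => hφ.weight (ε • ξ) :=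
    hφ.contDiff_weight.comp (contDiff_const_smul _)
  have hcs : HasCompactSupport fun ξ : Ed d => hφ.weight (ε • ξ) :=
    hφ.hasCompactSupport_weight.comp_smul hε.ne'
  obtain ⟨h, hh, hFh⟩ := exists_schwartzMap_eq_fmulD hsm hcs g
  have hhint : ∫⁻ y, ‖h y‖ₑ ≤ (∫⁻ y, ‖𝓕⁻ hφ.weight y‖ₑ) * ∫⁻ y, ‖g y‖ₑ := by
    rw [hh, ← lintegral_enorm_fourierInv_comp_smul hφ.continuous_fourierInv_weight hε]
    exact lintegral_enorm_fmulD_le (hsm.continuous.integrable_of_hasCompactSupport hcs)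
      g.integrable (continuous_fourierInv_schwartzMap (hcs.toSchwartzMap hsm)) g.continuous
  set z : ℂ := ε - (σ * t : ℝ) * Complex.I with hz
  have hzre : 0 < z.re := by simpa [hz] using hε
  have hwave : halfWaveD d σ t (⇑g) x = (ε⁻¹ : ℝ) • fmulD d (poissonSymbol d z) (⇑h) x := by
    rw [halfWaveD, fmulD, fmulD, Real.fourierInv_eq, Real.fourierInv_eq, ← integral_smul]
    refine integral_congr_ae (Filter.Eventually.of_forall fun ξ => ?_)
    simp only [hFh]
    by_cases h0 : 𝓕 (⇑g) ξ = 0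
    · simp [h0]
    obtain ⟨h1, h2⟩ := hg ξ h0
    have hξ : 0 < ‖ξ‖ := by
      by_contra hneg
      have : ‖ξ‖ = 0 := le_antisymm (not_lt.1 hneg) (norm_nonneg ξ)
      rw [this] at h1
      norm_num at h1
    have hnorm : ‖ε • ξ‖ = ε * ‖ξ‖ := by rw [norm_smul, Real.norm_of_nonneg hε.le]
    rw [hφ.weight_eq (by rwa [hnorm]) (by rwa [hnorm]), hnorm, smul_comm]
    congr 1
    have hexp : Complex.exp (Complex.I * (σ * (2 * Real.pi * t * ‖ξ‖))) =
        Complex.exp (-(2 * Real.pi * z * ‖ξ‖)) *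
          ((Real.exp (2 * Real.pi * (ε * ‖ξ‖)) : ℝ) : ℂ) := by
      rw [Complex.ofReal_exp, ← Complex.exp_add]
      congr 1
      rw [hz]
      push_cast
      ring
    rw [hexp, poissonSymbol, Complex.real_smul]
    have h3 : (‖ξ‖ : ℂ) ≠ 0 := by exact_mod_cast hξ.ne'
    have h4 : (ε : ℂ) ≠ 0 := by exact_mod_cast hε.ne'
    push_cast
    field_simp
  have hker : ∀ y, ‖𝓕⁻ (poissonSymbol d z) y‖ₑ ≤
      ENNReal.ofReal (poissonConst d * (2 * ε * |σ * t|) ^ (-(((d:ℝ) - 1) / 2))) := fun y => by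
    rw [← ofReal_norm]
    exact ENNReal.ofReal_le_ofReal (norm_fourierInv_poissonSymbol_le hd hε hσt y)
  rw [hwave, enorm_smul, Real.enorm_of_nonneg (by positivity),
    ENNReal.ofReal_mul (by positivity), mul_assoc]
  gcongr
  refine (enorm_fmulD_le (integrable_poissonSymbol hd hzre) h.integrable hker x).trans ?_
  gcongr

end IsLPBumpD

namespace IsLPBumpD

variable {d : ℕ} {φ : Ed d → ℝ}

/-- A Littlewood–Paley piece of a Schwartz function is a Schwartz function. -/
lemma exists_schwartzMap_eq_LPD (hφ : IsLPBumpD d φ) {N : ℝ} (hN : 0 < N) (f : 𝓢(Ed d, ℂ)) :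
    ∃ g : 𝓢(Ed d, ℂ), ⇑g = LPD d φ N ⇑f ∧
      ∀ ξ, 𝓕 (⇑g) ξ = ((φ (N⁻¹ • ξ) - φ ((2 / N) • ξ) : ℝ) : ℂ) * 𝓕 (⇑f) ξ := by
  refine exists_schwartzMap_eq_fmulD ?_ ?_ f
  · have h1 : ContDiff ℝ (⊤ : ℕ∞) fun ξ => φ (N⁻¹ • ξ) :=
      hφ.smooth.comp (contDiff_const_smul _)
    have h2 : ContDiff ℝ (⊤ : ℕ∞) fun ξ => φ ((2 / N) • ξ) :=
      hφ.smooth.comp (contDiff_const_smul _)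
    exact Complex.ofRealCLM.contDiff.comp (h1.sub h2)
  · refine HasCompactSupport.intro (isCompact_closedBall (0 : Ed d) (2 * N)) fun ξ hξ => ?_
    rw [mem_closedBall_zero_iff, not_le] at hξ
    have h : 2 ≤ N⁻¹ * ‖ξ‖ := by
      rw [inv_mul_eq_div, le_div_iff₀ hN]; exact hξ.le
    rw [hφ.eq_zero (N⁻¹ • ξ) (by rwa [norm_smul, Real.norm_of_nonneg (by positivity)]),
      hφ.eq_zero ((2 / N) • ξ) ?_]
    · simp
    · rw [norm_smul, Real.norm_of_nonneg (by positivity), div_eq_mul_inv, mul_assoc]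
      linarith

lemma eLpNorm_halfWaveD_LPD_le (hφ : IsLPBumpD d φ) (hd : 2 ≤ d) {N σ t : ℝ} (hN : 0 < N)
    (hσt : σ * t ≠ 0) (f : 𝓢(Ed d, ℂ)) :
    eLpNorm (halfWaveD d σ t (LPD d φ N ⇑f)) ∞ volume ≤
      (ENNReal.ofReal (poissonConst d * 2 ^ (-(((d:ℝ) - 1) / 2))) *
          ∫⁻ y, ‖𝓕⁻ hφ.weight y‖ₑ) *
        ENNReal.ofReal (|σ * t| ^ (-(((d:ℝ) - 1) / 2))) *
        (ENNReal.ofReal (N ^ (((d:ℝ) + 1) / 2)) * eLpNorm (LPD d φ N ⇑f) 1 volume) := by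
  obtain ⟨g, hg, hFg⟩ := hφ.exists_schwartzMap_eq_LPD hN f
  rw [← hg, eLpNorm_one_eq_lintegral_enorm, eLpNorm_exponent_top]
  refine eLpNormEssSup_le_of_ae_enorm_bound (Filter.Eventually.of_forall fun x => ?_)
  have hsupp : ∀ ξ, 𝓕 (⇑g) ξ ≠ 0 → 1 / 2 ≤ N⁻¹ * ‖ξ‖ ∧ N⁻¹ * ‖ξ‖ ≤ 2 := by
    intro ξ hξ
    have h1 : ‖N⁻¹ • ξ‖ = N⁻¹ * ‖ξ‖ := by rw [norm_smul, Real.norm_of_nonneg (by positivity)]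
    have h2 : ‖(2 / N) • ξ‖ = 2 * (N⁻¹ * ‖ξ‖) := by
      rw [norm_smul, Real.norm_of_nonneg (by positivity), div_eq_mul_inv, mul_assoc]
    have hpos : 0 ≤ N⁻¹ * ‖ξ‖ := by positivity
    rw [hFg] at hξ
    constructor
    · by_contra! h
      rw [hφ.eq_one _ (by rw [h1]; linarith), hφ.eq_one _ (by rw [h2]; linarith)] at hξ
      simp at hξ
    · by_contra! h
      rw [hφ.eq_zero _ (by rw [h1]; linarith), hφ.eq_zero _ (by rw [h2]; linarith)] at hξ
      simp at hξ
  refine (hφ.enorm_halfWaveD_le hd (inv_pos.2 hN) hσt g hsupp x).trans (le_of_eq ?_)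
  have hc := poissonConst_nonneg (d := d) (by omega)
  have hreal : N⁻¹⁻¹ * (poissonConst d * (2 * N⁻¹ * |σ * t|) ^ (-(((d:ℝ) - 1) / 2))) =
      (poissonConst d * 2 ^ (-(((d:ℝ) - 1) / 2))) * |σ * t| ^ (-(((d:ℝ) - 1) / 2)) *
        N ^ (((d:ℝ) + 1) / 2) := by
    rw [Real.mul_rpow (by positivity) (by positivity), Real.mul_rpow (by positivity)
      (by positivity), Real.inv_rpow hN.le, Real.rpow_neg hN.le, inv_inv, inv_inv,
      show ((d:ℝ) + 1) / 2 = 1 + ((d:ℝ) - 1) / 2 by ring, Real.rpow_add hN, Real.rpow_one]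
    ring
  rw [hreal, ENNReal.ofReal_mul (by positivity), ENNReal.ofReal_mul (by positivity)]
  ring

lemma sum_range_LP_symbol (K : ℕ) (ξ : Ed d) :
    ∑ j ∈ Finset.range (2 * K), (φ (((2:ℝ) ^ ((j:ℤ) - K))⁻¹ • ξ) -
        φ ((2 / (2:ℝ) ^ ((j:ℤ) - K)) • ξ)) =
      φ ((2 * ((2:ℝ) ^ K)⁻¹) • ξ) - φ ((2 * (2:ℝ) ^ K) • ξ) := by
  have h := Finset.sum_range_sub (fun j : ℕ => φ ((2 / (2:ℝ) ^ ((j:ℤ) - K)) • ξ)) (2 * K)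
  have h1 : ∀ j : ℕ, 2 / (2:ℝ) ^ (((j + 1 : ℕ) : ℤ) - K) = ((2:ℝ) ^ ((j:ℤ) - K))⁻¹ := by
    intro j
    rw [show (((j + 1 : ℕ) : ℤ) - K) = ((j:ℤ) - K) + 1 by push_cast; ring,
      zpow_add_one₀ (by norm_num)]
    field_simp
  have h2 : 2 / (2:ℝ) ^ (((2 * K : ℕ) : ℤ) - K) = 2 * ((2:ℝ) ^ K)⁻¹ := by
    rw [show (((2 * K : ℕ) : ℤ) - K) = (K:ℤ) by push_cast; ring, zpow_natCast, div_eq_mul_inv]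
  have h3 : 2 / (2:ℝ) ^ (((0 : ℕ) : ℤ) - K) = 2 * (2:ℝ) ^ K := by
    rw [Nat.cast_zero, zero_sub, zpow_neg, zpow_natCast, div_inv_eq_mul]
  simpa only [h1, h2, h3] using h

lemma tendsto_LP_symbol (hφ : IsLPBumpD d φ) {ξ : Ed d} (hξ : 0 < ‖ξ‖) :
    Filter.Tendsto (fun K : ℕ => φ ((2 * ((2:ℝ) ^ K)⁻¹) • ξ) - φ ((2 * (2:ℝ) ^ K) • ξ))
      Filter.atTop (nhds 1) := by
  have hpow := tendsto_pow_atTop_atTop_of_one_lt (one_lt_two (α := ℝ))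
  refine tendsto_const_nhds.congr' ?_
  filter_upwards [hpow.eventually_ge_atTop (2 * ‖ξ‖), hpow.eventually_ge_atTop ‖ξ‖⁻¹]
    with K h1 h2
  have hK : (0:ℝ) < 2 ^ K := by positivity
  rw [hφ.eq_one, hφ.eq_zero, sub_zero]
  · rw [norm_smul, Real.norm_of_nonneg (by positivity), mul_assoc]
    have := (inv_le_iff_one_le_mul₀ hξ).1 h2
    linarith
  · rw [norm_smul, Real.norm_of_nonneg (by positivity), mul_right_comm, ← div_eq_mul_inv,
      div_le_one hK]
    exact h1

lemma tendsto_sum_halfWaveD_LPD (hφ : IsLPBumpD d φ) (hd : 1 ≤ d) (σ t : ℝ) (f : 𝓢(Ed d, ℂ))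
    (x : Ed d) :
    Filter.Tendsto (fun K : ℕ => ∑ j ∈ Finset.range (2 * K),
        halfWaveD d σ t (LPD d φ ((2:ℝ) ^ ((j:ℤ) - K)) ⇑f) x)
      Filter.atTop (nhds (halfWaveD d σ t (⇑f) x)) := by
  set F : Ed d → ℂ := fun ξ => Real.fourierChar ⟪ξ, x⟫ •
    (Complex.exp (Complex.I * (σ * (2 * Real.pi * t * ‖ξ‖))) * 𝓕 (⇑f) ξ) with hF
  have hFf : Integrable (𝓕 (⇑f)) := by
    rw [← SchwartzMap.fourier_coe]; exact SchwartzMap.integrable _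
  have hFfc : Continuous (𝓕 (⇑f)) := by
    rw [← SchwartzMap.fourier_coe]; exact (𝓕 f).continuous
  have hFc : Continuous F := by
    simp only [hF, Circle.smul_def, Real.fourierChar_apply]; fun_prop
  have hFnorm : ∀ ξ, ‖F ξ‖ = ‖𝓕 (⇑f) ξ‖ := fun ξ => by
    simp only [hF]
    rw [Circle.norm_smul, norm_mul, Complex.norm_exp]
    simp
  have hφc := hφ.smooth.continuous
  have hbound : ∀ a b : ℝ, ∀ ξ, ‖((φ (a • ξ) - φ (b • ξ) : ℝ) : ℂ) * F ξ‖ ≤ ‖𝓕 (⇑f) ξ‖ := by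
    intro a b ξ
    rw [norm_mul, hFnorm, Complex.norm_real]
    refine mul_le_of_le_one_left (norm_nonneg _) ?_
    have h1 := hφ.mem_Icc (a • ξ)
    have h2 := hφ.mem_Icc (b • ξ)
    rw [Real.norm_eq_abs, abs_le]
    exact ⟨by linarith [h1.1, h2.2], by linarith [h1.2, h2.1]⟩
  have hcont : ∀ a b : ℝ, Continuous fun ξ => ((φ (a • ξ) - φ (b • ξ) : ℝ) : ℂ) * F ξ := by
    intro a b; fun_prop
  have hfint : ∀ a b : ℝ, Integrable fun ξ => ((φ (a • ξ) - φ (b • ξ) : ℝ) : ℂ) * F ξ :=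
    fun a b => hFf.norm.mono' (hcont a b).aestronglyMeasurable
      (Filter.Eventually.of_forall (hbound a b))
  have hpiece : ∀ N : ℝ, 0 < N → halfWaveD d σ t (LPD d φ N ⇑f) x =
      ∫ ξ, ((φ (N⁻¹ • ξ) - φ ((2 / N) • ξ) : ℝ) : ℂ) * F ξ := by
    intro N hN
    obtain ⟨g, hg, hFg⟩ := hφ.exists_schwartzMap_eq_LPD hN f
    rw [← hg, halfWaveD, fmulD, Real.fourierInv_eq]
    refine integral_congr_ae (Filter.Eventually.of_forall fun ξ => ?_)
    simp only [hFg, hF, Circle.smul_def, smul_eq_mul]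
    ring
  have hsum : ∀ K : ℕ, ∑ j ∈ Finset.range (2 * K),
      halfWaveD d σ t (LPD d φ ((2:ℝ) ^ ((j:ℤ) - K)) ⇑f) x =
      ∫ ξ, ((φ ((2 * ((2:ℝ) ^ K)⁻¹) • ξ) - φ ((2 * (2:ℝ) ^ K) • ξ) : ℝ) : ℂ) * F ξ := by
    intro K
    rw [Finset.sum_congr rfl fun j _ => hpiece _ (by positivity),
      ← integral_finsetSum _ fun j _ => hfint _ _]
    refine integral_congr_ae (Filter.Eventually.of_forall fun ξ => ?_)
    simp only
    rw [← Finset.sum_mul, ← Complex.ofReal_sum, sum_range_LP_symbol]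
  have hlim : halfWaveD d σ t (⇑f) x = ∫ ξ, F ξ := by
    rw [halfWaveD, fmulD, Real.fourierInv_eq]
  simp only [hsum, hlim]
  refine tendsto_integral_of_dominated_convergence _
    (fun K => (hcont _ _).aestronglyMeasurable) hFf.norm
    (fun K => Filter.Eventually.of_forall (hbound _ _)) ?_
  filter_upwards [ae_norm_pos hd] with ξ hξ
  have h := (Complex.continuous_ofReal.tendsto 1).comp (hφ.tendsto_LP_symbol hξ)
  simpa using h.mul_const (F ξ)

lemma eLpNorm_halfWaveD_le_tsum (hφ : IsLPBumpD d φ) (hd : 1 ≤ d) (σ t : ℝ)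
    (f : 𝓢(Ed d, ℂ)) :
    eLpNorm (halfWaveD d σ t (⇑f)) ∞ volume ≤
      ∑' n : ℤ, eLpNorm (halfWaveD d σ t (LPD d φ ((2:ℝ) ^ n) (⇑f))) ∞ volume := by
  simp only [eLpNorm_exponent_top]
  refine eLpNormEssSup_le_of_ae_enorm_bound ?_
  have hae : ∀ᵐ x : Ed d, ∀ n : ℤ, ‖halfWaveD d σ t (LPD d φ ((2:ℝ) ^ n) (⇑f)) x‖ₑ ≤
      eLpNormEssSup (halfWaveD d σ t (LPD d φ ((2:ℝ) ^ n) (⇑f))) volume :=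
    ae_all_iff.2 fun n => enorm_ae_le_eLpNormEssSup _ _
  filter_upwards [hae] with x hx
  refine le_of_tendsto (hφ.tendsto_sum_halfWaveD_LPD hd σ t f x).enorm
    (Filter.Eventually.of_forall fun K => ?_)
  refine (enorm_sum_le _ _).trans ?_
  refine (Finset.sum_le_sum (s := Finset.range (2 * K)) fun (j : ℕ) _ =>
    hx ((j:ℤ) - K)).trans ?_
  have hinj : Function.Injective fun j : ℕ => (j:ℤ) - K := fun i j h => by
    simpa using h
  exact (ENNReal.sum_le_tsum _).trans (ENNReal.tsum_comp_le_tsum_of_injective hinj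
    fun n : ℤ => eLpNormEssSup (halfWaveD d σ t (LPD d φ ((2:ℝ) ^ n) (⇑f))) volume)

end IsLPBumpD

/-- **`L^∞` dispersive decay for the half wave with Besov data.** -/
theorem halfWave_dispersive_decay_Linfty (d : ℕ) (hd : 2 ≤ d)
    (φ : Ed d → ℝ) (hφ : IsLPBumpD d φ) :
    ∃ C : ℝ≥0, ∀ (σ : ℝ), (σ = 1 ∨ σ = -1) →
      ∀ (f : 𝓢(Ed d, ℂ)) (t : ℝ), t ≠ 0 →
        eLpNorm (halfWaveD d σ t (⇑f)) ∞ volume ≤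
          (∑' n : ℤ, eLpNorm (halfWaveD d σ t (LPD d φ ((2:ℝ) ^ n) (⇑f))) ∞ volume) ∧
        (∑' n : ℤ, eLpNorm (halfWaveD d σ t (LPD d φ ((2:ℝ) ^ n) (⇑f))) ∞ volume) ≤
          (C : ℝ≥0∞) * ENNReal.ofReal (|t| ^ (-(((d:ℝ) - 1) / 2))) *
            besovD d φ (((d:ℝ) + 1) / 2) 1 (⇑f) := by
  have hA := hφ.lintegral_fourierInv_weight_lt_top
  have hC : ENNReal.ofReal (poissonConst d * 2 ^ (-(((d:ℝ) - 1) / 2))) *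
      ∫⁻ y, ‖𝓕⁻ hφ.weight y‖ₑ ≠ ∞ := ENNReal.mul_ne_top ENNReal.ofReal_ne_top hA.ne
  refine ⟨(ENNReal.ofReal (poissonConst d * 2 ^ (-(((d:ℝ) - 1) / 2))) *
      ∫⁻ y, ‖𝓕⁻ hφ.weight y‖ₑ).toNNReal, fun σ hσ f t ht =>
    ⟨hφ.eLpNorm_halfWaveD_le_tsum (by omega) σ t f, ?_⟩⟩
  have hσt : σ * t ≠ 0 := by
    rcases hσ with rfl | rfl <;> simpa using ht
  have habs : |σ * t| = |t| := by
    rcases hσ with rfl | rfl <;> simp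
  rw [ENNReal.coe_toNNReal hC, besovD, ← ENNReal.tsum_mul_left, ← habs]
  exact ENNReal.tsum_le_tsum fun n => hφ.eLpNorm_halfWaveD_LPD_le hd (by positivity) hσt f

end
end
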